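/- arXiv:1605.02548 — 6 statements merged into one kernel-verified Lean document; each statement's English description precedes it below -/
import Mathlib

section
/- Let Ω ⊆ ℝP² be a divisible properly convex domain. Then either Ω is a triangle (some element of SL^±₃(ℝ) maps Ω onto the projectivization of the open positive octant {x ∈ ℝ³ : x₁, x₂, x₃ > 0}), or Ω is round, i.e., Ω is strictly convex and ∂Ω is C¹ (every boundary point lies in a unique supporting hyperplane). -/
open Matrix

noncomputable section

/-- `ℝ^{d+1}`. -/
abbrev Vec (d : ℕ) := Fin (d + 1) → ℝ

/-- The real projective space `ℝP^d`. -/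
abbrev RP (d : ℕ) := Projectivization ℝ (Vec d)

instance (d : ℕ) : TopologicalSpace (RP d) :=
  inferInstanceAs (TopologicalSpace (Quotient (projectivizationSetoid ℝ (Vec d))))

/-- The projective transformation of `ℝP^d` induced by an invertible matrix. -/
def projMap {d : ℕ} (g : GL (Fin (d + 1)) ℝ) : RP d → RP d :=
  Projectivization.map (Matrix.mulVecLin (g : Matrix (Fin (d + 1)) (Fin (d + 1)) ℝ))
    (by
      intro x y hxy
      have hdet : IsUnit (g : Matrix (Fin (d + 1)) (Fin (d + 1)) ℝ).det :=
        (Matrix.isUnit_iff_isUnit_det _).mp g.isUnit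
      have h := congrArg
        (Matrix.mulVec ((g : Matrix (Fin (d + 1)) (Fin (d + 1)) ℝ))⁻¹) hxy
      simpa [Matrix.mulVecLin_apply, Matrix.mulVec_mulVec,
        Matrix.nonsing_inv_mul _ hdet] using h)

/-- A sharp convex open cone in `ℝ^{d+1}`: nonempty, open, convex, stable under positive
scalars, containing no affine line. -/
def IsProperCone {d : ℕ} (C : Set (Vec d)) : Prop :=
  C.Nonempty ∧ IsOpen C ∧ Convex ℝ C ∧
    (∀ x ∈ C, ∀ t : ℝ, 0 < t → t • x ∈ C) ∧
    ¬ ∃ x v : Vec d, v ≠ 0 ∧ ∀ t : ℝ, x + t • v ∈ C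

/-- The projectivization of a cone: a subset of `ℝP^d`. -/
def projOfCone {d : ℕ} (C : Set (Vec d)) : Set (RP d) :=
  {P | ∃ (v : Vec d) (hv : v ≠ 0), v ∈ C ∧ P = Projectivization.mk ℝ v hv}

/-- `Ω` is a properly convex domain if it is the projectivization of a sharp convex open
cone. -/
def IsProperlyConvexDomain {d : ℕ} (Ω : Set (RP d)) : Prop :=
  ∃ C : Set (Vec d), IsProperCone C ∧ Ω = projOfCone C

/-- Membership in `SL^±_{d+1}(ℝ)`: determinant `±1`. -/
def detPM1 {d : ℕ} (g : GL (Fin (d + 1)) ℝ) : Prop :=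
  (g : Matrix (Fin (d + 1)) (Fin (d + 1)) ℝ).det = 1 ∨
  (g : Matrix (Fin (d + 1)) (Fin (d + 1)) ℝ).det = -1

/-- `Γ` preserves `Ω` (projectively). -/
def PreservesDomain {d : ℕ} (Γ : Subgroup (GL (Fin (d + 1)) ℝ)) (Ω : Set (RP d)) : Prop :=
  ∀ γ ∈ Γ, projMap γ '' Ω = Ω

/-- The action of `Γ` on `Ω` is properly discontinuous. -/
def ProperlyDiscontinuousOn {d : ℕ} (Γ : Subgroup (GL (Fin (d + 1)) ℝ))
    (Ω : Set (RP d)) : Prop :=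
  ∀ K : Set (RP d), K ⊆ Ω → IsCompact K →
    {γ : Γ | (projMap (γ : GL (Fin (d + 1)) ℝ) '' K ∩ K).Nonempty}.Finite

/-- The action of `Γ` on `Ω` is cocompact: `Ω/Γ` is compact. -/
def CocompactOn {d : ℕ} (Γ : Subgroup (GL (Fin (d + 1)) ℝ)) (Ω : Set (RP d)) : Prop :=
  ∃ K : Set (RP d), IsCompact K ∧ K ⊆ Ω ∧
    (⋃ γ ∈ Γ, projMap γ '' K) = Ω

/-- `Ω` is divided by `Γ`: `Γ` consists of determinant-`±1` matrices, is discrete,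
preserves `Ω`, and acts properly discontinuously and cocompactly on `Ω`. -/
def Divides {d : ℕ} (Γ : Subgroup (GL (Fin (d + 1)) ℝ)) (Ω : Set (RP d)) : Prop :=
  (∀ γ ∈ Γ, detPM1 γ) ∧ DiscreteTopology Γ ∧ PreservesDomain Γ Ω ∧
    ProperlyDiscontinuousOn Γ Ω ∧ CocompactOn Γ Ω

/-- `Ω` is strictly convex: its boundary contains no nondegenerate projective line
segment. -/
def IsStrictlyConvexDomain {d : ℕ} (Ω : Set (RP d)) : Prop :=
  ∀ v w : Vec d, LinearIndependent ℝ ![v, w] →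
    ¬ ∀ t ∈ Set.Icc (0 : ℝ) 1, ∀ h : t • v + (1 - t) • w ≠ 0,
        Projectivization.mk ℝ (t • v + (1 - t) • w) h ∈ frontier Ω

/-- Every finite-index subgroup of `Γ` acts irreducibly on `ℝ^{d+1}`. -/
def StronglyIrreducible {d : ℕ} (Γ : Subgroup (GL (Fin (d + 1)) ℝ)) : Prop :=
  ∀ Δ : Subgroup (GL (Fin (d + 1)) ℝ), Δ ≤ Γ → (Δ.subgroupOf Γ).FiniteIndex →
    ∀ W : Submodule ℝ (Vec d),
      (∀ γ ∈ Δ, ∀ x ∈ W,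
        Matrix.mulVec ((γ : GL (Fin (d + 1)) ℝ) : Matrix (Fin (d + 1)) (Fin (d + 1)) ℝ) x ∈ W) →
      W = ⊥ ∨ W = ⊤

/-- The `k`-simplex spanned by `v : Fin (k+1) → ℝ^{d+1}` in `ℝP^d`. -/
def simplexSet {d k : ℕ} (v : Fin (k + 1) → Vec d) : Set (RP d) :=
  {P | ∃ t : Fin (k + 1) → ℝ, (∀ i, 0 ≤ t i) ∧ t ≠ 0 ∧
    ∃ h : (∑ i, t i • v i) ≠ 0, P = Projectivization.mk ℝ (∑ i, t i • v i) h}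

/-- The relative interior of the `k`-simplex spanned by `v`. -/
def simplexInterior {d k : ℕ} (v : Fin (k + 1) → Vec d) : Set (RP d) :=
  {P | ∃ t : Fin (k + 1) → ℝ, (∀ i, 0 < t i) ∧
    ∃ h : (∑ i, t i • v i) ≠ 0, P = Projectivization.mk ℝ (∑ i, t i • v i) h}

/-- A properly embedded `k`-simplex in `Ω`: relative interior inside `Ω` and boundary
inside `∂Ω`. -/
def ProperlyEmbeddedSimplex {d k : ℕ} (Ω : Set (RP d)) (v : Fin (k + 1) → Vec d) : Prop :=
  LinearIndependent ℝ v ∧ simplexInterior v ⊆ Ω ∧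
    simplexSet v \ simplexInterior v ⊆ frontier Ω

/-- `φ` cuts out a supporting hyperplane of `Ω` at `x`. -/
def IsSupportingAt {d : ℕ} (Ω : Set (RP d)) (φ : Module.Dual ℝ (Vec d)) (x : RP d) : Prop :=
  φ ≠ 0 ∧ φ x.rep = 0 ∧ ∀ P ∈ Ω, φ (Projectivization.rep P) ≠ 0

end

/-- The open positive octant in `ℝ³`, whose projectivization is a triangle. -/
def octantCone : Set (Vec 2) := {x | ∀ i, 0 < x i}

open Filter Topology

namespace IsProperCone

variable {d : ℕ} {C : Set (Vec d)}

theorem zero_mem_closure (hC : IsProperCone C) : (0 : Vec d) ∈ closure C := by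
  obtain ⟨⟨x, hx⟩, -, -, hs, -⟩ := hC
  have h : Tendsto (fun t : ℝ => t • x) (𝓝[>] 0) (𝓝 ((0 : ℝ) • x)) :=
    ((continuous_id.smul continuous_const).tendsto 0).mono_left nhdsWithin_le_nhds
  rw [zero_smul] at h
  refine mem_closure_of_tendsto h ?_
  filter_upwards [self_mem_nhdsWithin] with t ht using hs x hx t ht

theorem smul_mem_closure (hC : IsProperCone C) {y : Vec d} (hy : y ∈ closure C) {t : ℝ}
    (ht : 0 ≤ t) : t • y ∈ closure C := by
  rcases ht.eq_or_lt with rfl | ht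
  · simpa using hC.zero_mem_closure
  · exact map_mem_closure (continuous_const_smul t) hy fun x hx => hC.2.2.2.1 x hx t ht

theorem add_mem (hC : IsProperCone C) {x y : Vec d} (hx : x ∈ C) (hy : y ∈ closure C) :
    x + y ∈ C := by
  have h := hC.2.2.1.combo_interior_closure_mem_interior
    (hC.2.1.interior_eq.symm ▸ hx) hy (a := 1 / 2) (b := 1 / 2) (by norm_num) (by norm_num)
    (by norm_num)
  have h2 := hC.2.2.2.1 _ (interior_subset h) 2 (by norm_num)
  rw [← smul_add, smul_smul] at h2
  simpa using h2

theorem add_mem_closure (hC : IsProperCone C) {x y : Vec d} (hx : x ∈ closure C)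
    (hy : y ∈ closure C) : x + y ∈ closure C := by
  have h := hC.2.2.1.closure hx hy (a := 1 / 2) (b := 1 / 2) (by norm_num) (by norm_num)
    (by norm_num)
  have h2 := hC.smul_mem_closure h (t := 2) (by norm_num)
  rw [← smul_add, smul_smul] at h2
  simpa using h2

theorem neg_notMem_closure (hC : IsProperCone C) {v : Vec d} (hv : v ∈ closure C) (h0 : v ≠ 0) :
    -v ∉ closure C := by
  intro hn
  obtain ⟨x, hx⟩ := hC.1
  refine hC.2.2.2.2 ⟨x, v, h0, fun t => hC.add_mem hx ?_⟩
  rcases le_total 0 t with ht | ht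
  · exact hC.smul_mem_closure hv ht
  · simpa using hC.smul_mem_closure hn (neg_nonneg.2 ht)

/-- A linear functional bounded below on a cone is nonnegative there. -/
theorem nonneg_of_lt (hC : IsProperCone C) {f : Vec d →L[ℝ] ℝ} {u : ℝ}
    (h : ∀ v ∈ closure C, u < f v) {v : Vec d} (hv : v ∈ closure C) : 0 ≤ f v := by
  by_contra! hneg
  have hu : u < 0 := by simpa using h 0 hC.zero_mem_closure
  have := h _ (hC.smul_mem_closure hv (t := u / f v) (div_nonneg_of_nonpos hu.le hneg.le))
  rw [map_smul, smul_eq_mul, div_mul_cancel₀ _ hneg.ne] at this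
  exact lt_irrefl _ this

theorem exists_nonneg_pos (hC : IsProperCone C) {v : Vec d} (hv : v ∈ closure C) (h0 : v ≠ 0) :
    ∃ f : Vec d →L[ℝ] ℝ, (∀ x ∈ closure C, 0 ≤ f x) ∧ 0 < f v := by
  obtain ⟨f, u, hu, hf⟩ := geometric_hahn_banach_point_closed hC.2.2.1.closure isClosed_closure
    (hC.neg_notMem_closure hv h0)
  refine ⟨f, fun x hx => hC.nonneg_of_lt hf hx, ?_⟩
  have h1 : u < 0 := by simpa using hf 0 hC.zero_mem_closure
  rw [map_neg] at hu
  linarith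

theorem exists_norm_le (hC : IsProperCone C) :
    ∃ f : Vec d →L[ℝ] ℝ, ∀ v ∈ closure C, ‖v‖ ≤ f v := by
  have hS : IsCompact (closure C ∩ Metric.sphere (0 : Vec d) 1) :=
    (isCompact_sphere _ _).inter_left isClosed_closure
  obtain ⟨f, hf0, hf1⟩ : ∃ f : Vec d →L[ℝ] ℝ, (∀ x ∈ closure C, 0 ≤ f x) ∧
      ∀ x ∈ closure C ∩ Metric.sphere (0 : Vec d) 1, 0 < f x := by
    refine hS.induction_on (p := fun T => ∃ f : Vec d →L[ℝ] ℝ, (∀ x ∈ closure C, 0 ≤ f x) ∧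
      ∀ x ∈ closure C ∩ T, 0 < f x) ⟨0, by simp, by simp⟩ ?_ ?_ ?_ |>.imp ?_
    · rintro s t hst ⟨f, h0, h1⟩
      exact ⟨f, h0, fun x hx => h1 x ⟨hx.1, hst hx.2⟩⟩
    · rintro s t ⟨f, h0, h1⟩ ⟨g, h0', h1'⟩
      refine ⟨f + g, fun x hx => add_nonneg (h0 x hx) (h0' x hx), ?_⟩
      rintro x ⟨hx, hs | ht⟩
      · exact add_pos_of_pos_of_nonneg (h1 x ⟨hx, hs⟩) (h0' x hx)
      · exact add_pos_of_nonneg_of_pos (h0 x hx) (h1' x ⟨hx, ht⟩)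
    · rintro x ⟨hx, hx1⟩
      have hx0 : x ≠ 0 := by
        rintro rfl
        simp at hx1
      obtain ⟨f, h0, h1⟩ := hC.exists_nonneg_pos hx hx0
      exact ⟨{y | 0 < f y}, mem_nhdsWithin_of_mem_nhds
        ((isOpen_lt continuous_const f.continuous).mem_nhds h1), f, h0, fun y hy => hy.2⟩
    · rintro f ⟨h0, h1⟩
      exact ⟨h0, fun x hx => h1 x ⟨hx.1, hx⟩⟩
  obtain ⟨c, hc, hfc⟩ : ∃ c : ℝ, 0 < c ∧
      ∀ x ∈ closure C ∩ Metric.sphere (0 : Vec d) 1, c ≤ f x := by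
    rcases (closure C ∩ Metric.sphere (0 : Vec d) 1).eq_empty_or_nonempty with h | h
    · exact ⟨1, one_pos, by simp [h]⟩
    · obtain ⟨x, hx, hm⟩ := hS.exists_isMinOn h f.continuous.continuousOn
      exact ⟨f x, hf1 x hx, fun y hy => hm hy⟩
  refine ⟨c⁻¹ • f, fun v hv => ?_⟩
  rcases eq_or_ne v 0 with rfl | h0
  · simp
  have hn : 0 < ‖v‖ := norm_pos_iff.2 h0
  have h := hfc (‖v‖⁻¹ • v) ⟨hC.smul_mem_closure hv (by positivity), by
    simp [norm_smul, hn.ne']⟩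
  rw [map_smul, smul_eq_mul, inv_mul_eq_div, le_div_iff₀ hn] at h
  rw [_root_.smul_apply, smul_eq_mul, inv_mul_eq_div, le_div_iff₀ hc]
  linarith

/-- A nonzero functional which is nonnegative on an open cone is positive on it. -/
theorem pos_of_nonneg (hC : IsProperCone C) {f : Vec d →ₗ[ℝ] ℝ} (hf : f ≠ 0)
    (h : ∀ v ∈ C, 0 ≤ f v) {v : Vec d} (hv : v ∈ C) : 0 < f v := by
  refine (h v hv).lt_of_ne' fun h0 => hf ?_
  ext1 i
  have hlim : ∀ w : Vec d, 0 ≤ f w := by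
    intro w
    have hc : Tendsto (fun t : ℝ => v + t • w) (𝓝[>] 0) (𝓝 (v + (0 : ℝ) • w)) :=
      ((continuous_const.add (continuous_id.smul continuous_const)).tendsto 0).mono_left
        nhdsWithin_le_nhds
    rw [zero_smul, add_zero] at hc
    obtain ⟨t, ht, htp⟩ := ((hc.eventually (hC.2.1.mem_nhds hv)).and self_mem_nhdsWithin).exists
    have := h _ ht
    rw [map_add, h0, zero_add, map_smul, smul_eq_mul] at this
    exact nonneg_of_mul_nonneg_right this htp
  ext
  have h1 := hlim (Pi.single i 1)
  have h2 := hlim (-Pi.single i 1)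
  rw [map_neg] at h2
  simp
  linarith

end IsProperCone

theorem norm_apply_le_of_norm_le {E F : Type*} [AddCommGroup E] [Module ℝ E]
    [NormedAddCommGroup F] [NormedSpace ℝ F] {L : E →ₗ[ℝ] F} {g : F →ₗ[ℝ] ℝ} {y e : E} {r : ℝ}
    (hr : 0 < r) (h1 : ‖L (y + r • e)‖ ≤ g (L (y + r • e)))
    (h2 : ‖L (y - r • e)‖ ≤ g (L (y - r • e))) : ‖L e‖ ≤ g (L y) / r := by
  have h := norm_sub_le (L (y + r • e)) (L (y - r • e))
  have e1 : L (y + r • e) - L (y - r • e) = (2 * r) • L e := by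
    simp only [map_add, map_sub, map_smul]
    module
  have e2 : g (L (y + r • e)) + g (L (y - r • e)) = 2 * g (L y) := by
    simp only [map_add, map_sub]
    ring
  rw [e1, norm_smul, Real.norm_of_nonneg (by positivity)] at h
  rw [le_div_iff₀ hr]
  linarith

theorem opNorm_le_of_norm_single_le {d : ℕ} {F : Type*} [NormedAddCommGroup F] [NormedSpace ℝ F]
    {L : Vec d →L[ℝ] F} {B : ℝ} (hB : 0 ≤ B) (h : ∀ i, ‖L (Pi.single i 1)‖ ≤ B) :
    ‖L‖ ≤ (d + 1) * B := by
  refine L.opNorm_le_bound (by positivity) fun x => ?_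
  have hx : L x = ∑ i, x i • L (Pi.single i 1) := by
    conv_lhs => rw [pi_eq_sum_univ' x]
    simp
  rw [hx]
  calc ‖∑ i, x i • L (Pi.single i 1)‖ ≤ ∑ i : Fin (d + 1), ‖x‖ * B := by
        refine (norm_sum_le _ _).trans (Finset.sum_le_sum fun i _ => ?_)
        rw [norm_smul]
        exact mul_le_mul (norm_le_pi_norm x i) (h i) (norm_nonneg _) (norm_nonneg _)
    _ = (d + 1) * B * ‖x‖ := by
        simp
        ring

theorem mem_octantCone_of_nonneg {U : Set (Vec 2)} (hU : IsOpen U)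
    (h : ∀ v ∈ U, ∀ i, 0 ≤ v i) : U ⊆ octantCone := by
  intro v hv i
  have hsub : U ⊆ Set.univ.pi fun _ => Set.Ici (0 : ℝ) := fun w hw i _ => h w hw i
  have := (interior_maximal hsub hU) hv
  rw [interior_pi_set Set.finite_univ] at this
  simpa using this i (Set.mem_univ i)

/-- The linear automorphism group of the cone `C` acts cocompactly on `C`. -/
def IsQuasiHomogeneousCone {d : ℕ} (C : Set (Vec d)) : Prop :=
  ∃ K : Set (Vec d), IsCompact K ∧ K ⊆ C ∧
    ∀ x ∈ C, ∃ γ : Vec d ≃ₗ[ℝ] Vec d, (∀ v, γ v ∈ C ↔ v ∈ C) ∧ γ x ∈ K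

/-- If a cone `C` on which the automorphism group acts cocompactly can be rescaled so as to
converge to the octant, then `C` is linearly equivalent to the octant. -/
theorem exists_equiv_octantCone {C : Set (Vec 2)} (hC : IsProperCone C)
    (hdiv : IsQuasiHomogeneousCone C)
    (m : ℕ → Vec 2 ≃ₗ[ℝ] Vec 2) (hin : ∀ v ∈ octantCone, ∀ᶠ n in atTop, m n v ∈ C)
    {g : Vec 2 →ₗ[ℝ] ℝ} (hg : ∀ n v, m n v ∈ C → ‖v‖ ≤ g v)
    (hlim : ∀ σ : ℕ → ℕ, StrictMono σ → ∀ (u : ℕ → Vec 2) (v : Vec 2),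
      (∀ n, m (σ n) (u n) ∈ C) → Tendsto u atTop (𝓝 v) → ∀ i, 0 ≤ v i) :
    ∃ k : Vec 2 ≃ₗ[ℝ] Vec 2, ∀ v, k v ∈ C ↔ v ∈ octantCone := by
  obtain ⟨K, hK, hKC, hdiv⟩ := hdiv
  obtain ⟨f, hf⟩ := hC.exists_norm_le
  let x : Vec 2 := fun _ => 1
  have hxp : ∀ i, x + (1 / 2 : ℝ) • Pi.single i 1 ∈ octantCone := by
    intro i j
    by_cases h : j = i
    · subst h
      simp [x]
      norm_num
    · simp [x, h]
  have hxm : ∀ i, x - (1 / 2 : ℝ) • Pi.single i 1 ∈ octantCone := by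
    intro i j
    by_cases h : j = i
    · subst h
      simp [x]
      norm_num
    · simp [x, h]
  have hx0 : x ∈ octantCone := fun _ => one_pos
  obtain ⟨N, hN⟩ := eventually_atTop.1 ((hin x hx0).and
    ((eventually_all.2 fun i => hin _ (hxp i)).and (eventually_all.2 fun i => hin _ (hxm i))))
  choose! γ hγC hγK using hdiv
  obtain ⟨δ, hδ, hKδ⟩ := hK.exists_cthickening_subset_open hC.2.1 hKC
  obtain ⟨M, hM⟩ := hK.exists_bound_of_continuousOn f.continuous.continuousOn
  let k : ℕ → Vec 2 ≃ₗ[ℝ] Vec 2 := fun n => (m (n + N)).trans (γ (m (n + N) x))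
  have hmx : ∀ n, m (n + N) x ∈ C := fun n => (hN _ (Nat.le_add_left _ _)).1
  have hkC : ∀ n v, k n v ∈ C ↔ m (n + N) v ∈ C := fun n v => hγC _ (hmx n) _
  have hkK : ∀ n, k n x ∈ K := fun n => hγK _ (hmx n)
  have hM0 : 0 ≤ M := (norm_nonneg _).trans (hM _ (hkK 0))
  have hgx : 0 ≤ g x := (norm_nonneg _).trans (hg _ _ (hmx 0))
  have hsymm : ∀ n v, v ∈ C → m (n + N) ((k n).symm v) ∈ C := by
    intro n v hv
    rw [← hkC, LinearEquiv.apply_symm_apply]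
    exact hv
  have b1 : ∀ n i, ‖k n (Pi.single i 1)‖ ≤ M / (1 / 2) := by
    intro n i
    refine (norm_apply_le_of_norm_le (L := (k n).toLinearMap) (g := f.toLinearMap) (y := x)
      (r := 1 / 2)
      (by norm_num) (hf _ (subset_closure ?_)) (hf _ (subset_closure ?_))).trans ?_
    · exact (hkC _ _).2 ((hN _ (Nat.le_add_left _ _)).2.1 i)
    · exact (hkC _ _).2 ((hN _ (Nat.le_add_left _ _)).2.2 i)
    · gcongr
      exact (le_abs_self _).trans (hM _ (hkK n))
  have hball : ∀ n (w : Vec 2), ‖w‖ ≤ δ → k n x + w ∈ C := by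
    intro n w hw
    refine hKδ (Metric.mem_cthickening_of_dist_le _ _ _ _ (hkK n) ?_)
    simpa using hw
  have b2 : ∀ n i, ‖(k n).symm (Pi.single i 1)‖ ≤ g x / δ := by
    intro n i
    have hw : ‖δ • (Pi.single i 1 : Vec 2)‖ ≤ δ := by
      rw [norm_smul, Real.norm_of_nonneg hδ.le, Pi.norm_single]
      simp
    have := norm_apply_le_of_norm_le (L := (k n).symm.toLinearMap) (g := g) (y := k n x)
      (e := Pi.single i 1) hδ (hg (n + N) _ (hsymm _ _ (hball _ _ hw)))
      (hg (n + N) _ (hsymm _ _ (by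
        rw [sub_eq_add_neg]
        exact hball _ _ (by rwa [norm_neg]))))
    simpa using this
  let A : ℕ → (Vec 2 →L[ℝ] Vec 2) × (Vec 2 →L[ℝ] Vec 2) := fun n =>
    (LinearMap.toContinuousLinearMap (k n).toLinearMap,
      LinearMap.toContinuousLinearMap (k n).symm.toLinearMap)
  have hA : ∀ n, A n ∈ Metric.closedBall 0
      (max ((2 + 1) * (M / (1 / 2))) ((2 + 1) * (g x / δ))) := by
    intro n
    rw [mem_closedBall_zero_iff]
    refine max_le_max ?_ ?_
    · exact_mod_cast opNorm_le_of_norm_single_le (by positivity) (b1 n)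
    · exact_mod_cast opNorm_le_of_norm_single_le (by positivity) (b2 n)
  obtain ⟨⟨P, Q⟩, -, σ, hσ, hlimA⟩ := tendsto_subseq_of_bounded Metric.isBounded_closedBall hA
  have hP : ∀ v, Tendsto (fun n => k (σ n) v) atTop (𝓝 (P v)) := fun v =>
    (((ContinuousLinearMap.apply ℝ (Vec 2) v).continuous.comp continuous_fst).tendsto _).comp hlimA
  have hQ : ∀ v, Tendsto (fun n => (k (σ n)).symm v) atTop (𝓝 (Q v)) := fun v =>
    (((ContinuousLinearMap.apply ℝ (Vec 2) v).continuous.comp continuous_snd).tendsto _).comp hlimA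
  have hfst := (continuous_fst.tendsto _).comp hlimA
  have hsnd := (continuous_snd.tendsto _).comp hlimA
  have hPQ : P * Q = 1 := by
    refine tendsto_nhds_unique (hfst.mul hsnd) ?_
    refine tendsto_const_nhds.congr fun n => ?_
    ext1 v
    simp [A]
  have hQP : Q * P = 1 := by
    refine tendsto_nhds_unique (hsnd.mul hfst) ?_
    refine tendsto_const_nhds.congr fun n => ?_
    ext1 v
    simp [A]
  have hPQ' : ∀ v, P (Q v) = v := fun v => DFunLike.congr_fun hPQ v
  have hQP' : ∀ v, Q (P v) = v := fun v => DFunLike.congr_fun hQP v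
  have hσN : Tendsto (fun n => σ n + N) atTop atTop :=
    tendsto_atTop_mono (fun _ => Nat.le_add_right _ _) hσ.tendsto_atTop
  have hoct : IsOpen octantCone := by
    simp only [octantCone, Set.ofPred_forall]
    exact isOpen_iInter_of_finite fun i => isOpen_lt continuous_const (continuous_apply i)
  refine ⟨LinearEquiv.ofLinearMap P.toLinearMap Q.toLinearMap (LinearMap.ext hPQ')
    (LinearMap.ext hQP'), fun v => ⟨fun hv => ?_, fun hv => ?_⟩⟩
  · refine mem_octantCone_of_nonneg (hC.2.1.preimage P.continuous) (fun w hw => ?_) hv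
    refine hlim (fun n => σ n + N) (hσ.add_const N) _ w (fun n => hsymm (σ n) (P w) hw) ?_
    simpa only [hQP'] using hQ (P w)
  · have hsub : Q ⁻¹' octantCone ⊆ closure C := by
      intro w hw
      have := hP (Q w)
      rw [hPQ'] at this
      refine mem_closure_of_tendsto this ?_
      filter_upwards [hσN.eventually (hin _ hw)] with n hn using (hkC _ _).2 hn
    have := interior_maximal hsub (hoct.preimage Q.continuous)
      (show Q (P v) ∈ octantCone by rwa [hQP'])
    rwa [hC.2.2.1.interior_closure_eq_interior_of_nonempty_interior
      (by rw [hC.2.1.interior_eq]; exact hC.1), hC.2.1.interior_eq] at this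

/-- Zooming out from a segment in the boundary of a cone. -/
theorem exists_equiv_octantCone_of_segment {C : Set (Vec 2)} (hC : IsProperCone C)
    (hdiv : IsQuasiHomogeneousCone C) {φ : Vec 2 →ₗ[ℝ] ℝ} (hφ : ∀ c ∈ C, 0 < φ c)
    {v w : Vec 2} (hvw : LinearIndependent ℝ ![v, w]) (hv : v ∈ closure C) (hw : w ∈ closure C)
    (hφv : φ v = 0) (hφw : φ w = 0) :
    ∃ k : Vec 2 ≃ₗ[ℝ] Vec 2, ∀ v, k v ∈ C ↔ v ∈ octantCone := by
  obtain ⟨f, hf⟩ := hC.exists_norm_le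
  have hv0 : v ≠ 0 := by simpa using hvw.ne_zero 0
  have hw0 : w ≠ 0 := by simpa using hvw.ne_zero 1
  have hfpos : ∀ u ∈ closure C, u ≠ 0 → 0 < f u := fun u hu h0 =>
    (norm_pos_iff.2 h0).trans_le (hf u hu)
  have hfv := hfpos v hv hv0
  have hfw := hfpos w hw hw0
  have hφcont : Continuous φ := φ.continuous_of_finiteDimensional
  have hφcl : ∀ u ∈ closure C, 0 ≤ φ u := fun u hu =>
    closure_minimal (fun c hc => (hφ c hc).le) (isClosed_le continuous_const hφcont) hu
  let S : Set (Vec 2) := {u | u ∈ closure C ∧ φ u = 0 ∧ f u = 1}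
  have hS : IsCompact S := by
    refine Metric.isCompact_of_isClosed_isBounded ?_ ?_
    · exact isClosed_closure.inter ((isClosed_eq hφcont continuous_const).inter
        (isClosed_eq f.continuous continuous_const))
    · refine isBounded_iff_forall_norm_le.2 ⟨1, fun u hu => (hf u hu.1).trans hu.2.2.le⟩
  have hSmem : ∀ u ∈ closure C, φ u = 0 → 0 < f u → (f u)⁻¹ • u ∈ S := fun u hu h0 hp =>
    ⟨hC.smul_mem_closure hu (inv_nonneg.2 hp.le), by simp [h0], by simp [hp.ne']⟩
  obtain ⟨i, hi⟩ : ∃ i, ((f v)⁻¹ • v) i ≠ ((f w)⁻¹ • w) i := by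
    refine Function.ne_iff.1 fun h => ?_
    have := LinearIndependent.pair_iff.1 hvw (f v)⁻¹ (-(f w)⁻¹) (by rw [h]; module)
    exact inv_ne_zero hfv.ne' this.1
  obtain ⟨a, ha, hamax⟩ := hS.exists_isMaxOn ⟨_, hSmem v hv hφv hfv⟩
    (continuous_apply i).continuousOn
  obtain ⟨b, hb, hbmin⟩ := hS.exists_isMinOn ⟨_, hSmem v hv hφv hfv⟩
    (continuous_apply i).continuousOn
  have hab : b i < a i := by
    have h1 := hamax (hSmem v hv hφv hfv)
    have h2 := hamax (hSmem w hw hφw hfw)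
    have h3 := hbmin (hSmem v hv hφv hfv)
    have h4 := hbmin (hSmem w hw hφw hfw)
    simp only [Set.mem_ofPred_eq] at h1 h2 h3 h4
    rcases lt_or_gt_of_ne hi with h | h <;> linarith
  have hquad : ∀ s t : ℝ, s • a + t • b ∈ closure C → 0 ≤ s ∧ 0 ≤ t := by
    intro s t hst
    have hfst : f (s • a + t • b) = s + t := by simp [ha.2.2, hb.2.2]
    have hφst : φ (s • a + t • b) = 0 := by simp [ha.2.1, hb.2.1]
    rcases eq_or_ne (s • a + t • b) 0 with h0 | h0
    · rw [h0, map_zero] at hfst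
      have := congrFun h0 i
      simp at this
      obtain rfl : t = -s := by linarith
      have : s * (a i - b i) = 0 := by linarith
      rcases mul_eq_zero.1 this with rfl | h
      · simp
      · linarith
    · have hpos := hfpos _ hst h0
      have hmem := hSmem _ hst hφst hpos
      have h1 := hamax hmem
      have h2 := hbmin hmem
      rw [hfst] at hpos
      simp only [Set.mem_ofPred_eq, Pi.smul_apply, Pi.add_apply, smul_eq_mul, hfst] at h1 h2
      rw [inv_mul_eq_div, div_le_iff₀ hpos] at h1
      rw [inv_mul_eq_div, le_div_iff₀ hpos] at h2
      constructor <;> nlinarith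
  obtain ⟨p, hp⟩ := hC.1
  let L : ℕ → Vec 2 →ₗ[ℝ] Vec 2 := fun n =>
    ((n + 1 : ℝ) • LinearMap.proj 0).smulRight a + ((n + 1 : ℝ) • LinearMap.proj 1).smulRight b +
      (LinearMap.proj 2).smulRight p
  have hL : ∀ n u, L n u = ((n + 1 : ℝ) * u 0) • a + ((n + 1 : ℝ) * u 1) • b + u 2 • p := by
    intro n u
    simp [L]
  have hφL : ∀ n u, φ (L n u) = u 2 * φ p := by
    intro n u
    simp [hL, ha.2.1, hb.2.1]
  have hφp := hφ p hp
  have hinj : ∀ n, Function.Injective (L n) := by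
    intro n
    refine (injective_iff_map_eq_zero _).2 fun u hu => ?_
    have h2 : u 2 = 0 := by
      have := hφL n u
      rw [hu, map_zero] at this
      exact (mul_eq_zero.1 this.symm).resolve_right hφp.ne'
    rw [hL, h2, zero_smul, add_zero] at hu
    have hq := hquad _ _ (hu.symm ▸ hC.zero_mem_closure)
    have hq' := hquad (-((n + 1 : ℝ) * u 0)) (-((n + 1 : ℝ) * u 1)) (by
      rw [neg_smul, neg_smul, ← neg_add, hu, neg_zero]
      exact hC.zero_mem_closure)
    have hn : (0 : ℝ) < n + 1 := by positivity
    ext j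
    fin_cases j
    · simp; nlinarith
    · simp; nlinarith
    · simpa using h2
  let m : ℕ → Vec 2 ≃ₗ[ℝ] Vec 2 := fun n => LinearEquiv.ofInjectiveEndo (L n) (hinj n)
  have hm : ∀ n u, m n u = ((n + 1 : ℝ) * u 0) • a + ((n + 1 : ℝ) * u 1) • b + u 2 • p := hL
  have hpos2 : ∀ n u, m n u ∈ C → 0 < u 2 := by
    intro n u hu
    have h := hφ _ hu
    rw [show φ (m n u) = u 2 * φ p from hφL n u] at h
    exact pos_of_mul_pos_left h hφp.le
  let T : Vec 2 →L[ℝ] Vec 2 := LinearMap.toContinuousLinearMap (m 0).symm.toLinearMap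
  refine exists_equiv_octantCone hC hdiv m
    (g := ‖T‖ • f.toLinearMap ∘ₗ (m 0).toLinearMap) ?_ ?_ ?_
  · intro v hv
    refine Eventually.of_forall fun n => ?_
    have hn : (0 : ℝ) < n + 1 := by positivity
    rw [hm, add_comm]
    exact hC.add_mem (hC.2.2.2.1 _ hp _ (hv 2)) (hC.add_mem_closure
      (hC.smul_mem_closure ha.1 (mul_pos hn (hv 0)).le)
      (hC.smul_mem_closure hb.1 (mul_pos hn (hv 1)).le))
  · intro n u hu
    suffices h : m 0 u ∈ C by
      calc ‖u‖ = ‖T (m 0 u)‖ := by simp [T]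
        _ ≤ ‖T‖ * ‖m 0 u‖ := T.le_opNorm _
        _ ≤ ‖T‖ * f (m 0 u) := by
          gcongr
          exact hf _ (subset_closure h)
    have hn : (0 : ℝ) < n + 1 := by positivity
    have key : m 0 u = (n + 1 : ℝ)⁻¹ • m n u + ((1 - (n + 1 : ℝ)⁻¹) * u 2) • p := by
      simp only [hm, smul_add, smul_smul]
      rw [inv_mul_cancel_left₀ hn.ne', inv_mul_cancel_left₀ hn.ne']
      simp
      module
    rw [key]
    refine hC.add_mem (hC.2.2.2.1 _ hu _ (inv_pos.2 hn)) (hC.smul_mem_closure (subset_closure hp)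
      (mul_nonneg (sub_nonneg.2 (inv_le_one_of_one_le₀ (by simp))) (hpos2 n u hu).le))
  · intro σ hσ u v hu huv
    have hcoord : ∀ i, Tendsto (fun n => u n i) atTop (𝓝 (v i)) := tendsto_pi_nhds.1 huv
    have hinv : Tendsto (fun n => ((σ n : ℝ) + 1)⁻¹) atTop (𝓝 0) :=
      (tendsto_inv_atTop_zero.comp (tendsto_atTop_add_const_right _ _
        tendsto_natCast_atTop_atTop)).comp hσ.tendsto_atTop
    have hlim : Tendsto (fun n => ((σ n : ℝ) + 1)⁻¹ • m (σ n) (u n)) atTop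
        (𝓝 (v 0 • a + v 1 • b + (0 * v 2) • p)) := by
      refine ((((hcoord 0).smul_const a).add ((hcoord 1).smul_const b)).add
        ((hinv.mul (hcoord 2)).smul_const p)).congr fun n => ?_
      have hn : (0 : ℝ) < σ n + 1 := by positivity
      simp only [hm, smul_add, smul_smul]
      rw [inv_mul_cancel_left₀ hn.ne', inv_mul_cancel_left₀ hn.ne']
    rw [zero_mul, zero_smul, add_zero] at hlim
    have hq := hquad _ _ (mem_closure_of_tendsto hlim (Eventually.of_forall fun n =>
      hC.2.2.2.1 _ (hu n) _ (by positivity)))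
    intro j
    fin_cases j
    · exact hq.1
    · exact hq.2
    · exact ge_of_tendsto' (hcoord 2) fun n => (hpos2 _ _ (hu n)).le

theorem ker_eq_ker_of_linearIndependent {φ ψ : Vec 2 →ₗ[ℝ] ℝ} {u v : Vec 2}
    (huv : LinearIndependent ℝ ![u, v]) (hφ : φ ≠ 0) (hψ : ψ ≠ 0) (hφu : φ u = 0) (hφv : φ v = 0)
    (hψu : ψ u = 0) (hψv : ψ v = 0) : LinearMap.ker φ = LinearMap.ker ψ := by
  have key : ∀ χ : Vec 2 →ₗ[ℝ] ℝ, χ ≠ 0 → χ u = 0 → χ v = 0 →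
      Submodule.span ℝ (Set.range ![u, v]) = LinearMap.ker χ := by
    intro χ hχ hu hv
    refine Submodule.eq_of_le_of_finrank_eq ?_ ?_
    · rw [Submodule.span_le]
      rintro _ ⟨i, rfl⟩
      fin_cases i
      · exact hu
      · exact hv
    · have h := Module.Dual.finrank_ker_add_one_of_ne_zero hχ
      rw [finrank_span_eq_card huv]
      simp at h ⊢
      omega
  rw [← key φ hφ hφu hφv, ← key ψ hψ hψu hψv]

/-- Zooming in at a corner of a cone. -/
theorem exists_equiv_octantCone_of_corner {C : Set (Vec 2)} (hC : IsProperCone C)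
    (hdiv : IsQuasiHomogeneousCone C) {φ ψ : Vec 2 →ₗ[ℝ] ℝ} (hφ : ∀ c ∈ C, 0 < φ c)
    (hψ : ∀ c ∈ C, 0 < ψ c) {p : Vec 2} (hp : p ∈ closure C) (hp0 : p ≠ 0)
    (hφp : φ p = 0) (hψp : ψ p = 0) (hne : LinearMap.ker φ ≠ LinearMap.ker ψ) :
    ∃ k : Vec 2 ≃ₗ[ℝ] Vec 2, ∀ v, k v ∈ C ↔ v ∈ octantCone := by
  obtain ⟨f, hf⟩ := hC.exists_norm_le
  have hfpos : ∀ u ∈ closure C, u ≠ 0 → 0 < f u := fun u hu h0 =>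
    (norm_pos_iff.2 h0).trans_le (hf u hu)
  have hfp := hfpos p hp hp0
  have hC0 : ∀ c ∈ C, c ≠ 0 := by
    rintro c hc rfl
    simpa using hφ 0 hc
  have hfC : ∀ c ∈ C, 0 < f c := fun c hc => hfpos c (subset_closure hc) (hC0 c hc)
  have hφcont : Continuous φ := φ.continuous_of_finiteDimensional
  have hψcont : Continuous ψ := ψ.continuous_of_finiteDimensional
  have hθ : ∀ c ∈ C, 0 < φ c + ψ c := fun c hc => add_pos (hφ c hc) (hψ c hc)
  let r : Vec 2 → ℝ := fun c => φ c / (φ c + ψ c)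
  have hr0 : ∀ c ∈ C, 0 ≤ r c := fun c hc => (div_pos (hφ c hc) (hθ c hc)).le
  have hr1 : ∀ c ∈ C, r c ≤ 1 := fun c hc =>
    (div_le_one (hθ c hc)).2 (by linarith [hψ c hc])
  have hrcont : ContinuousOn r C := hφcont.continuousOn.div
    (hφcont.add hψcont).continuousOn fun c hc => (hθ c hc).ne'
  have hne' : (r '' C).Nonempty := hC.1.image r
  have hbelow : BddBelow (r '' C) := ⟨0, by rintro _ ⟨c, hc, rfl⟩; exact hr0 c hc⟩
  have habove : BddAbove (r '' C) := ⟨1, by rintro _ ⟨c, hc, rfl⟩; exact hr1 c hc⟩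
  obtain ⟨α, hα⟩ : ∃ α, IsGLB (r '' C) α := ⟨_, isGLB_csInf hne' hbelow⟩
  obtain ⟨β, hβ⟩ : ∃ β, IsLUB (r '' C) β := ⟨_, isLUB_csSup hne' habove⟩
  let φ' : Vec 2 →ₗ[ℝ] ℝ := φ - α • (φ + ψ)
  let ψ' : Vec 2 →ₗ[ℝ] ℝ := β • (φ + ψ) - φ
  have hφ' : ∀ c, φ' c = φ c - α * (φ c + ψ c) := fun c => by simp [φ', mul_add]
  have hψ' : ∀ c, ψ' c = β * (φ c + ψ c) - φ c := fun c => by simp [ψ', mul_add]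
  have hφ'0 : ∀ c ∈ C, 0 ≤ φ' c := by
    intro c hc
    have := hα.1 ⟨c, hc, rfl⟩
    rw [le_div_iff₀ (hθ c hc)] at this
    rw [hφ']
    linarith
  have hψ'0 : ∀ c ∈ C, 0 ≤ ψ' c := by
    intro c hc
    have := hβ.1 ⟨c, hc, rfl⟩
    rw [div_le_iff₀ (hθ c hc)] at this
    rw [hψ']
    linarith
  have hindep : ∀ s t : ℝ, (∀ c, s * φ c = t * ψ c) → s = 0 ∧ t = 0 := by
    intro s t h
    obtain ⟨c, hc⟩ := hC.1
    have hcc := h c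
    rcases eq_or_ne s 0 with rfl | hs
    · simpa [(hψ c hc).ne'] using hcc
    rcases eq_or_ne t 0 with rfl | ht
    · simpa [(hφ c hc).ne'] using hcc
    refine absurd ?_ hne
    ext u
    rw [LinearMap.mem_ker, LinearMap.mem_ker]
    constructor <;> intro hu <;> simpa [hu, hs, ht] using h u
  have hφ'ne : φ' ≠ 0 := by
    intro h
    have h1 := hindep (1 - α) α fun c => by
      have := hφ' c
      rw [h, LinearMap.zero_apply] at this
      linarith
    linarith
  have hψ'ne : ψ' ≠ 0 := by
    intro h
    have h1 := hindep (1 - β) β fun c => by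
      have := hψ' c
      rw [h, LinearMap.zero_apply] at this
      linarith
    linarith
  have hφ'pos : ∀ c ∈ C, 0 < φ' c := fun c hc => hC.pos_of_nonneg hφ'ne hφ'0 hc
  have hψ'pos : ∀ c ∈ C, 0 < ψ' c := fun c hc => hC.pos_of_nonneg hψ'ne hψ'0 hc
  have hαβ : α < β := by
    obtain ⟨c, hc⟩ := hC.1
    have h1 := hφ'pos c hc
    have h2 := hψ'pos c hc
    rw [hφ'] at h1
    rw [hψ'] at h2
    have h3 : 0 < (β - α) * (φ c + ψ c) := by linarith
    exact sub_pos.1 (pos_of_mul_pos_left h3 (hθ c hc).le)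
  have hφ'p : φ' p = 0 := by simp [hφ', hφp, hψp]
  have hψ'p : ψ' p = 0 := by simp [hψ', hφp, hψp]
  have hsurj : ∀ x y : ℝ, 0 < x → 0 < y → ∃ c ∈ C, φ' c = x ∧ ψ' c = y := by
    intro x y hx hy
    have hβα := sub_pos.2 hαβ
    set q : ℝ := α + (β - α) * (x / (x + y)) with hq
    have hx1 : x / (x + y) < 1 := (div_lt_one (by positivity)).2 (by linarith)
    have hαq : α < q := by
      have : 0 < (β - α) * (x / (x + y)) := by positivity
      linarith
    have hqβ : q < β := by nlinarith
    obtain ⟨_, ⟨c₁, hc₁, rfl⟩, hlt₁⟩ := (isGLB_lt_iff hα).1 hαq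
    obtain ⟨_, ⟨c₂, hc₂, rfl⟩, hlt₂⟩ := (lt_isLUB_iff hβ).1 hqβ
    obtain ⟨c, hc, hcq⟩ := hC.2.2.1.isPreconnected.intermediate_value hc₁ hc₂ hrcont
      ⟨hlt₁.le, hlt₂.le⟩
    have hθc := hθ c hc
    have hφc : φ c = q * (φ c + ψ c) := (div_eq_iff hθc.ne').1 hcq
    refine ⟨((x + y) / ((β - α) * (φ c + ψ c))) • c, hC.2.2.2.1 c hc _ (by positivity), ?_, ?_⟩
    · have h1 : φ' c = (β - α) * (φ c + ψ c) * (x / (x + y)) := by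
        rw [hφ']
        linear_combination hφc
      rw [map_smul, smul_eq_mul, h1]
      field_simp
    · have h1 : ψ' c = (β - α) * (φ c + ψ c) * (y / (x + y)) := by
        have h2 : y / (x + y) = 1 - x / (x + y) := by field_simp; ring
        rw [hψ', h2]
        linear_combination -hφc
      rw [map_smul, smul_eq_mul, h1]
      field_simp
  let L : ℕ → Vec 2 →ₗ[ℝ] Vec 2 := fun n =>
    LinearMap.pi ![(n + 1 : ℝ) • φ', (n + 1 : ℝ) • ψ', f.toLinearMap]
  have hL0 : ∀ n u, L n u 0 = (n + 1 : ℝ) * φ' u := fun n u => rfl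
  have hL1 : ∀ n u, L n u 1 = (n + 1 : ℝ) * ψ' u := fun n u => rfl
  have hL2 : ∀ n u, L n u 2 = f u := fun n u => rfl
  have hinj : ∀ n, Function.Injective (L n) := by
    intro n
    refine (injective_iff_map_eq_zero _).2 fun u hu => ?_
    have hn : (n + 1 : ℝ) ≠ 0 := by positivity
    have h0 : φ' u = 0 := by
      have := hL0 n u
      rw [hu] at this
      simpa [hn] using this.symm
    have h1 : ψ' u = 0 := by
      have := hL1 n u
      rw [hu] at this
      simpa [hn] using this.symm
    have h2 : f u = 0 := by
      have := hL2 n u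
      rw [hu] at this
      simpa using this.symm
    rw [hφ'] at h0
    rw [hψ'] at h1
    have h3 : φ u + ψ u = 0 := by
      have : (β - α) * (φ u + ψ u) = 0 := by linarith
      exact (mul_eq_zero.1 this).resolve_left (sub_pos.2 hαβ).ne'
    rw [h3] at h0 h1
    by_contra hu0
    refine hne (ker_eq_ker_of_linearIndependent (u := u) (v := p) ?_ ?_ ?_ ?_ hφp ?_ hψp)
    · refine LinearIndependent.pair_iff.2 fun s t hst => ?_
      have ht : t = 0 := by
        have := congrArg f hst
        simpa [h2, hfp.ne'] using this
      rw [ht, zero_smul, add_zero] at hst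
      exact ⟨(smul_eq_zero.1 hst).resolve_right hu0, ht⟩
    · obtain ⟨c, hc⟩ := hC.1
      rintro rfl
      exact lt_irrefl _ (hφ c hc)
    · obtain ⟨c, hc⟩ := hC.1
      rintro rfl
      exact lt_irrefl _ (hψ c hc)
    · linarith
    · linarith
  let m : ℕ → Vec 2 ≃ₗ[ℝ] Vec 2 := fun n => (LinearEquiv.ofInjectiveEndo (L n) (hinj n)).symm
  have hmL : ∀ n u, L n (m n u) = u := fun n u =>
    (LinearEquiv.ofInjectiveEndo (L n) (hinj n)).apply_symm_apply u
  have hLm : ∀ n u, m n (L n u) = u := fun n u =>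
    (LinearEquiv.ofInjectiveEndo (L n) (hinj n)).symm_apply_apply u
  have hpos : ∀ n u, m n u ∈ C → ∀ i, 0 ≤ u i := by
    intro n u hu i
    rw [← hmL n u]
    have hn : (0 : ℝ) ≤ n + 1 := by positivity
    fin_cases i
    · exact mul_nonneg hn (hφ'0 _ hu)
    · exact mul_nonneg hn (hψ'0 _ hu)
    · exact (hfC _ hu).le
  refine exists_equiv_octantCone hC hdiv m (g := ∑ i, LinearMap.proj i) ?_ ?_ ?_
  · intro v hv
    obtain ⟨c, hc, hc0, hc1⟩ := hsurj (v 0) (v 1) (hv 0) (hv 1)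
    filter_upwards [eventually_ge_atTop ⌈f c / v 2⌉₊] with n hn
    have hn1 : (0 : ℝ) < n + 1 := by positivity
    have hn2 : (n + 1 : ℝ)⁻¹ * f c ≤ v 2 := by
      have := Nat.ceil_le.1 hn
      rw [div_le_iff₀ (hv 2)] at this
      rw [inv_mul_le_iff₀ hn1]
      nlinarith [hv 2]
    have key : L n ((n + 1 : ℝ)⁻¹ • c + ((v 2 - (n + 1 : ℝ)⁻¹ * f c) / f p) • p) = v := by
      ext j
      fin_cases j
      · change L n _ 0 = v 0
        rw [hL0, map_add, map_smul, map_smul, hφ'p, hc0]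
        simp [hn1.ne']
      · change L n _ 1 = v 1
        rw [hL1, map_add, map_smul, map_smul, hψ'p, hc1]
        simp [hn1.ne']
      · change L n _ 2 = v 2
        rw [hL2, map_add, map_smul, map_smul]
        simp [hfp.ne']
    rw [← key, hLm]
    exact hC.add_mem (hC.2.2.2.1 c hc _ (inv_pos.2 hn1))
      (hC.smul_mem_closure hp (div_nonneg (sub_nonneg.2 hn2) hfp.le))
  · intro n v hv
    have hv0 := hpos n v hv
    have hsum : (∑ i, LinearMap.proj i : Vec 2 →ₗ[ℝ] ℝ) v = ∑ i, v i := by simp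
    rw [hsum]
    refine (pi_norm_le_iff_of_nonneg (Finset.sum_nonneg fun i _ => hv0 i)).2 fun i => ?_
    rw [Real.norm_of_nonneg (hv0 i)]
    exact Finset.single_le_sum (fun i _ => hv0 i) (Finset.mem_univ i)
  · intro σ _ u v hu huv i
    exact ge_of_tendsto' (tendsto_pi_nhds.1 huv i) fun n => hpos _ _ (hu n) i

theorem isQuotientMap_projectivizationMk' (d : ℕ) :
    Topology.IsQuotientMap (Projectivization.mk' ℝ : {v : Vec d // v ≠ 0} → RP d) :=
  isQuotientMap_quotient_mk'

theorem mulVec_ne_zero {d : ℕ} (γ : GL (Fin (d + 1)) ℝ) {v : Vec d} (hv : v ≠ 0) :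
    (γ : Matrix (Fin (d + 1)) (Fin (d + 1)) ℝ) *ᵥ v ≠ 0 := by
  intro h
  exact hv (Matrix.mulVec_injective_iff_isUnit.2 γ.isUnit (by rw [h, Matrix.mulVec_zero]))

theorem projMap_mk {d : ℕ} (γ : GL (Fin (d + 1)) ℝ) {v : Vec d} (hv : v ≠ 0) :
    projMap γ (Projectivization.mk ℝ v hv) =
      Projectivization.mk ℝ ((γ : Matrix (Fin (d + 1)) (Fin (d + 1)) ℝ) *ᵥ v)
        (mulVec_ne_zero γ hv) :=
  rfl

theorem projMap_injective {d : ℕ} (γ : GL (Fin (d + 1)) ℝ) : Function.Injective (projMap γ) :=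
  Projectivization.map_injective _ (Matrix.mulVec_injective_iff_isUnit.2 γ.isUnit)

namespace IsProperCone

variable {d : ℕ} {C : Set (Vec d)}

theorem ne_zero (hC : IsProperCone C) {v : Vec d} (hv : v ∈ C) : v ≠ 0 := by
  rintro rfl
  obtain ⟨w, hw⟩ := exists_ne (0 : Vec d)
  have hc : Tendsto (fun t : ℝ => t • w) (𝓝[>] 0) (𝓝 0) := by
    have h : Tendsto (fun t : ℝ => t • w) (𝓝[>] 0) (𝓝 ((0 : ℝ) • w)) :=
      ((continuous_id.smul continuous_const).tendsto 0).mono_left nhdsWithin_le_nhds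
    rwa [zero_smul] at h
  have hev := hc.eventually (hC.2.1.mem_nhds hv)
  have hev' := hc.neg.eventually (hC.2.1.mem_nhds (by rwa [neg_zero]))
  obtain ⟨t, ⟨h1, h2⟩, ht⟩ := ((hev.and hev').and self_mem_nhdsWithin).exists
  exact hC.neg_notMem_closure (subset_closure h1) (smul_ne_zero (ne_of_gt ht) hw)
    (subset_closure h2)

theorem mk_mem_projOfCone_iff (hC : IsProperCone C) {v : Vec d} (hv : v ≠ 0) :
    Projectivization.mk ℝ v hv ∈ projOfCone C ↔ v ∈ C ∨ -v ∈ C := by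
  constructor
  · rintro ⟨w, hw, hwC, h⟩
    obtain ⟨a, rfl⟩ := (Projectivization.mk_eq_mk_iff' ℝ _ _ _ _).1 h
    rcases lt_trichotomy a 0 with ha | rfl | ha
    · right
      rw [← neg_smul]
      exact hC.2.2.2.1 w hwC _ (neg_pos.2 ha)
    · simp at hv
    · exact Or.inl (hC.2.2.2.1 w hwC _ ha)
  · rintro (h | h)
    · exact ⟨v, hv, h, rfl⟩
    · exact ⟨-v, neg_ne_zero.2 hv, h,
        (Projectivization.mk_eq_mk_iff' ℝ _ _ _ _).2 ⟨-1, by simp⟩⟩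

theorem isOpen_projOfCone (hC : IsProperCone C) : IsOpen (projOfCone C) := by
  rw [← (isQuotientMap_projectivizationMk' d).isOpen_preimage]
  have h : Projectivization.mk' ℝ ⁻¹' projOfCone C =
      (Subtype.val : {v : Vec d // v ≠ 0} → Vec d) ⁻¹' (C ∪ -C) := by
    ext v
    exact hC.mk_mem_projOfCone_iff v.2
  rw [h]
  exact (hC.2.1.union hC.2.1.neg).preimage continuous_subtype_val

theorem mk_mem_frontier (hC : IsProperCone C) {v : Vec d} (hv : v ≠ 0)
    (h : Projectivization.mk ℝ v hv ∈ frontier (projOfCone C)) :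
    (v ∈ closure C ∨ -v ∈ closure C) ∧ v ∉ C ∧ -v ∉ C := by
  rw [hC.isOpen_projOfCone.frontier_eq] at h
  refine ⟨?_, fun h' => h.2 ((hC.mk_mem_projOfCone_iff hv).2 (Or.inl h')),
    fun h' => h.2 ((hC.mk_mem_projOfCone_iff hv).2 (Or.inr h'))⟩
  by_contra! hn
  let U : Set (RP d) := {P | P.rep ∉ closure C ∧ -P.rep ∉ closure C}
  have hU : ∀ w (hw : w ≠ 0), Projectivization.mk ℝ w hw ∈ U ↔
      w ∉ closure C ∧ -w ∉ closure C := by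
    intro w hw
    obtain ⟨a, ha⟩ := Projectivization.exists_smul_eq_mk_rep ℝ w hw
    have key : ∀ (x : Vec d) (t : ℝ), (x ∈ closure C ∨ -x ∈ closure C) →
        (t • x ∈ closure C ∨ -(t • x) ∈ closure C) := by
      intro x t hx
      rw [← smul_neg]
      rcases le_total 0 t with ht | ht
      · exact hx.imp (fun h => hC.smul_mem_closure h ht) (fun h => hC.smul_mem_closure h ht)
      · refine hx.symm.imp (fun h => ?_) (fun h => ?_)
        · simpa using hC.smul_mem_closure h (neg_nonneg.2 ht)
        · simpa using hC.smul_mem_closure h (neg_nonneg.2 ht)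
    change (_ ∉ closure C ∧ _ ∉ closure C) ↔ _
    rw [← ha, ← not_or, ← not_or, not_iff_not]
    refine ⟨fun h => ?_, fun h => key w a h⟩
    have := key _ ((a⁻¹ : ℝˣ) : ℝ) h
    rwa [Units.smul_def, smul_smul, Units.inv_mul, one_smul] at this
  have hUo : IsOpen U := by
    rw [← (isQuotientMap_projectivizationMk' d).isOpen_preimage]
    have h : Projectivization.mk' ℝ ⁻¹' U =
        (Subtype.val : {v : Vec d // v ≠ 0} → Vec d) ⁻¹' ((closure C)ᶜ ∩ (-closure C)ᶜ) := by
      ext w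
      exact hU w w.2
    rw [h]
    exact (isClosed_closure.isOpen_compl.inter
      isClosed_closure.neg.isOpen_compl).preimage continuous_subtype_val
  obtain ⟨_, hPU, w, hw, hwC, rfl⟩ := mem_closure_iff.1 h.1 U hUo ((hU v hv).2 hn)
  exact ((hU w hw).1 hPU).1 (subset_closure hwC)

/-- A projective transformation preserving the projectivization of a cone lifts to a linear
automorphism of the cone. -/
theorem exists_equiv_of_projMap_image_eq (hC : IsProperCone C) {γ : GL (Fin (d + 1)) ℝ}
    (hγ : projMap γ '' projOfCone C = projOfCone C) :
    ∃ e : Vec d ≃ₗ[ℝ] Vec d, (∀ v, e v ∈ C ↔ v ∈ C) ∧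
      ∃ ε : ℝ, ∀ v, e v = ε • ((γ : Matrix (Fin (d + 1)) (Fin (d + 1)) ℝ) *ᵥ v) := by
  obtain ⟨f, hf⟩ := hC.exists_norm_le
  set M : Matrix (Fin (d + 1)) (Fin (d + 1)) ℝ := γ.val
  have hfpos : ∀ c ∈ C, 0 < f c := fun c hc =>
    (norm_pos_iff.2 (hC.ne_zero hc)).trans_le (hf c (subset_closure hc))
  have himg : ∀ c ∈ C, M *ᵥ c ∈ C ∨ -(M *ᵥ c) ∈ C := by
    intro c hc
    have h0 := hC.ne_zero hc
    rw [← hC.mk_mem_projOfCone_iff (mulVec_ne_zero γ h0), ← hγ]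
    exact ⟨_, ⟨c, h0, hc, rfl⟩, projMap_mk γ h0⟩
  have hpre : ∀ v, M *ᵥ v ∈ C ∨ -(M *ᵥ v) ∈ C → v ∈ C ∨ -v ∈ C := by
    intro v hv
    have h0 : v ≠ 0 := by
      rintro rfl
      rw [Matrix.mulVec_zero, neg_zero, or_self] at hv
      exact hC.ne_zero hv rfl
    rw [← hC.mk_mem_projOfCone_iff (mulVec_ne_zero γ h0), ← hγ, ← projMap_mk γ h0,
      (projMap_injective γ).mem_set_image] at hv
    exact (hC.mk_mem_projOfCone_iff h0).1 hv
  have hcont : Continuous fun v : Vec d => f (M *ᵥ v) :=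
    f.continuous.comp (continuous_const.matrix_mulVec continuous_id)
  obtain ⟨ε, hε, hεC⟩ : ∃ ε : ℝ, (ε = 1 ∨ ε = -1) ∧ ∀ c ∈ C, ε • (M *ᵥ c) ∈ C := by
    by_cases h : ∀ c ∈ C, M *ᵥ c ∈ C
    · exact ⟨1, Or.inl rfl, by simpa using h⟩
    · push Not at h
      obtain ⟨c, hc, hcn⟩ := h
      refine ⟨-1, Or.inr rfl, fun c' hc' => ?_⟩
      rw [neg_one_smul]
      refine (himg c' hc').resolve_left fun hc'C => ?_
      have h1 : f (M *ᵥ c) < 0 := by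
        have := hfpos _ ((himg c hc).resolve_left hcn)
        rw [map_neg] at this
        linarith
      obtain ⟨x, hx, hx0⟩ := hC.2.2.1.isPreconnected.intermediate_value hc hc'
        hcont.continuousOn ⟨h1.le, (hfpos _ hc'C).le⟩
      rcases himg x hx with h2 | h2
      · exact (hfpos _ h2).ne' hx0
      · have := hfpos _ h2
        rw [map_neg] at this
        simp only at hx0
        linarith
  have hε0 : ε ≠ 0 := by rcases hε with rfl | rfl <;> norm_num
  let e : Vec d ≃ₗ[ℝ] Vec d := LinearEquiv.ofInjectiveEndo (ε • M.mulVecLin) (by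
    intro x y hxy
    exact Matrix.mulVec_injective_iff_isUnit.2 γ.isUnit (smul_right_injective _ hε0 hxy))
  have he : ∀ v, e v = ε • (M *ᵥ v) := fun v => rfl
  refine ⟨e, fun v => ⟨fun hv => ?_, fun hv => hεC v hv⟩, ε, he⟩
  have hv' : M *ᵥ v ∈ C ∨ -(M *ᵥ v) ∈ C := by
    rw [he] at hv
    rcases hε with rfl | rfl
    · exact Or.inl (by simpa using hv)
    · exact Or.inr (by simpa using hv)
  refine (hpre v hv').resolve_right fun hn => ?_
  have := hεC _ hn
  rw [← he, map_neg] at this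
  exact hC.neg_notMem_closure (subset_closure hv) (hC.ne_zero hv) (subset_closure this)

theorem isQuasiHomogeneousCone (hC : IsProperCone C) {Γ : Subgroup (GL (Fin (d + 1)) ℝ)}
    (hΓ : PreservesDomain Γ (projOfCone C)) (hco : CocompactOn Γ (projOfCone C)) :
    IsQuasiHomogeneousCone C := by
  obtain ⟨f, hf⟩ := hC.exists_norm_le
  have hfpos : ∀ c ∈ C, 0 < f c := fun c hc =>
    (norm_pos_iff.2 (hC.ne_zero hc)).trans_le (hf c (subset_closure hc))
  obtain ⟨K, hK, hKΩ, hcov⟩ := hco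
  let s : RP d → Vec d := fun P => (f P.rep)⁻¹ • P.rep
  have hs : ∀ v (hv : v ≠ 0), s (Projectivization.mk ℝ v hv) = (f v)⁻¹ • v := by
    intro v hv
    obtain ⟨a, ha⟩ := Projectivization.exists_smul_eq_mk_rep ℝ v hv
    have ha0 : (a : ℝ) ≠ 0 := a.ne_zero
    simp only [s]
    rw [← ha, Units.smul_def, map_smul, smul_smul, smul_eq_mul, _root_.mul_inv_rev, mul_assoc,
      inv_mul_cancel₀ ha0, mul_one]
  have hsC : ∀ P ∈ projOfCone C, s P ∈ C := by
    rintro _ ⟨v, hv, hvC, rfl⟩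
    rw [hs]
    exact hC.2.2.2.1 v hvC _ (inv_pos.2 (hfpos v hvC))
  have hcont : ContinuousOn s (projOfCone C) := by
    rw [(isQuotientMap_projectivizationMk' d).continuousOn_isOpen_iff hC.isOpen_projOfCone]
    have h : s ∘ Projectivization.mk' ℝ =
        fun v : {v : Vec d // v ≠ 0} => (f v.1)⁻¹ • v.1 := by
      ext1 v
      exact hs v.1 v.2
    rw [h]
    refine ContinuousOn.smul (ContinuousOn.inv₀ (f.continuous.comp
      continuous_subtype_val).continuousOn fun v hv => ?_) continuous_subtype_val.continuousOn
    rcases (hC.mk_mem_projOfCone_iff v.2).1 hv with h | h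
    · exact (hfpos _ h).ne'
    · have := hfpos _ h
      rw [map_neg] at this
      exact (neg_pos.1 this).ne
  refine ⟨s '' K, hK.image_of_continuousOn (hcont.mono hKΩ), ?_, fun x hx => ?_⟩
  · rintro _ ⟨P, hP, rfl⟩
    exact hsC P (hKΩ hP)
  · have hx0 := hC.ne_zero hx
    have hmem : Projectivization.mk ℝ x hx0 ∈ ⋃ γ ∈ Γ, projMap γ '' K := by
      rw [hcov]
      exact ⟨x, hx0, hx, rfl⟩
    simp only [Set.mem_iUnion] at hmem
    obtain ⟨γ, hγ, P, hP, hPx⟩ := hmem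
    obtain ⟨e, heC, ε, he⟩ := hC.exists_equiv_of_projMap_image_eq (hΓ _ (Γ.inv_mem hγ))
    have hex := (heC x).2 hx
    have hex0 := hC.ne_zero hex
    have hPe : P = Projectivization.mk ℝ (e x) hex0 := by
      refine projMap_injective γ (hPx.trans ?_)
      have h1 : (γ : Matrix (Fin (d + 1)) (Fin (d + 1)) ℝ) *ᵥ e x = ε • x := by
        rw [he, Matrix.mulVec_smul, Matrix.mulVec_mulVec, ← Units.val_mul, mul_inv_cancel,
          Units.val_one, Matrix.one_mulVec]
      refine ((Projectivization.mk_eq_mk_iff' ℝ _ _ _ _).2 ⟨ε, ?_⟩).symm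
      exact h1.symm
    have hfe : (f (e x))⁻¹ ≠ 0 := (inv_pos.2 (hfpos _ hex)).ne'
    refine ⟨e.trans (LinearEquiv.smulOfNeZero ℝ _ _ hfe), fun v => ?_, P, hP, ?_⟩
    · rw [← heC v]
      change (f (e x))⁻¹ • e v ∈ C ↔ _
      refine ⟨fun h => ?_, fun h => hC.2.2.2.1 _ h _ (inv_pos.2 (hfpos _ hex))⟩
      have := hC.2.2.2.1 _ h _ (hfpos _ hex)
      rwa [smul_inv_smul₀ (hfpos _ hex).ne'] at this
    · rw [hPe, hs]
      rfl

/-- Through every boundary point of a cone passes a supporting hyperplane. -/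
theorem exists_pos_of_notMem (hC : IsProperCone C) {v : Vec d} (hv : v ∈ closure C)
    (hvC : v ∉ C) : ∃ φ : Vec d →ₗ[ℝ] ℝ, (∀ c ∈ C, 0 < φ c) ∧ φ v = 0 := by
  obtain ⟨f, hf⟩ := geometric_hahn_banach_open_point hC.2.2.1 hC.2.1 hvC
  have hcl : ∀ c ∈ closure C, f c ≤ f v := fun c hc =>
    closure_minimal (fun c hc => (hf c hc).le) (isClosed_le f.continuous continuous_const) hc
  have h0 : 0 ≤ f v := by simpa using hcl 0 hC.zero_mem_closure
  have h1 : f v = 0 := by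
    have := hcl _ (hC.smul_mem_closure hv (t := 2) (by norm_num))
    rw [map_smul, smul_eq_mul] at this
    linarith
  refine ⟨-f.toLinearMap, fun c hc => ?_, by simp [h1]⟩
  have := hf c hc
  rw [h1] at this
  simpa using this

theorem exists_sign (hC : IsProperCone C) {φ : Vec d →ₗ[ℝ] ℝ} (h : ∀ c ∈ C, φ c ≠ 0) :
    (∀ c ∈ C, 0 < φ c) ∨ ∀ c ∈ C, 0 < (-φ) c := by
  by_contra! hn
  obtain ⟨⟨c, hc, hcn⟩, c', hc', hcn'⟩ := hn
  rw [LinearMap.neg_apply, neg_nonpos] at hcn'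
  obtain ⟨x, hx, hx0⟩ := hC.2.2.1.isPreconnected.intermediate_value hc hc'
    φ.continuous_of_finiteDimensional.continuousOn ⟨hcn, hcn'⟩
  exact h x hx hx0

theorem isSupportingAt_mk_iff (hC : IsProperCone C) {φ : Vec d →ₗ[ℝ] ℝ} {v : Vec d}
    (hv : v ≠ 0) : IsSupportingAt (projOfCone C) φ (Projectivization.mk ℝ v hv) ↔
      φ v = 0 ∧ ∀ c ∈ C, φ c ≠ 0 := by
  have hrep : ∀ w (hw : w ≠ 0), φ (Projectivization.mk ℝ w hw).rep = 0 ↔ φ w = 0 := by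
    intro w hw
    obtain ⟨a, ha⟩ := Projectivization.exists_smul_eq_mk_rep ℝ w hw
    rw [← ha, Units.smul_def, map_smul, smul_eq_zero]
    simp
  constructor
  · rintro ⟨-, h1, h2⟩
    exact ⟨(hrep v hv).1 h1, fun c hc h =>
      h2 _ ⟨c, hC.ne_zero hc, hc, rfl⟩ ((hrep c (hC.ne_zero hc)).2 h)⟩
  · rintro ⟨h1, h2⟩
    refine ⟨?_, (hrep v hv).2 h1, ?_⟩
    · rintro rfl
      obtain ⟨c, hc⟩ := hC.1
      exact h2 c hc rfl
    · rintro _ ⟨c, hc0, hc, rfl⟩ h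
      exact h2 c hc ((hrep c hc0).1 h)

end IsProperCone

theorem exists_projMap_image_eq_octant {C : Set (Vec 2)} (hC : IsProperCone C)
    (h : ∃ k : Vec 2 ≃ₗ[ℝ] Vec 2, ∀ v, k v ∈ C ↔ v ∈ octantCone) :
    ∃ g : GL (Fin 3) ℝ, detPM1 g ∧ projMap g '' projOfCone C = projOfCone octantCone := by
  obtain ⟨k, hk⟩ := h
  let N : Matrix (Fin 3) (Fin 3) ℝ := LinearMap.toMatrix' k.symm.toLinearMap
  have hN : ∀ v, N *ᵥ v = k.symm v := fun v => LinearMap.toMatrix'_mulVec _ _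
  have hdet : N.det ≠ 0 := by
    rw [LinearMap.det_toMatrix']
    exact k.symm.isUnit_det'.ne_zero
  have hc0 : 0 < |N.det|⁻¹ := inv_pos.2 (abs_pos.2 hdet)
  obtain ⟨c, hc, hc3⟩ : ∃ c : ℝ, 0 < c ∧ c ^ 3 = |N.det|⁻¹ :=
    ⟨|N.det|⁻¹ ^ ((3 : ℕ) : ℝ)⁻¹, Real.rpow_pos_of_pos hc0 _,
      Real.rpow_inv_natCast_pow hc0.le (by norm_num)⟩
  have hdet' : (c • N).det = |N.det|⁻¹ * N.det := by
    rw [Matrix.det_smul, Fintype.card_fin, hc3]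
  let g : GL (Fin 3) ℝ := Matrix.GeneralLinearGroup.mkOfDetNeZero (c • N) (by
    rw [hdet']
    exact mul_ne_zero hc0.ne' hdet)
  have hg : ∀ v, (g : Matrix (Fin 3) (Fin 3) ℝ) *ᵥ v = c • k.symm v := by
    intro v
    rw [← hN]
    exact Matrix.smul_mulVec c N v
  refine ⟨g, ?_, ?_⟩
  · change (c • N).det = 1 ∨ (c • N).det = -1
    rw [hdet']
    rcases abs_choice N.det with h | h
    · left
      rw [h, inv_mul_cancel₀ hdet]
    · right
      rw [h, inv_neg, neg_mul, inv_mul_cancel₀ hdet]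
  · ext P
    constructor
    · rintro ⟨_, ⟨v, hv, hvC, rfl⟩, rfl⟩
      refine ⟨_, mulVec_ne_zero g hv, ?_, projMap_mk g hv⟩
      have hsymm : k.symm v ∈ octantCone := by
        rw [← hk, LinearEquiv.apply_symm_apply]
        exact hvC
      intro i
      have := mul_pos hc (hsymm i)
      rw [hg]
      exact this
    · rintro ⟨v, hv, hvO, rfl⟩
      have hkv := (hk v).2 hvO
      refine ⟨_, ⟨k v, hC.ne_zero hkv, hkv, rfl⟩, ?_⟩
      rw [projMap_mk, Projectivization.mk_eq_mk_iff']
      exact ⟨c, by rw [hg, LinearEquiv.symm_apply_apply]⟩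

/-- Kuiper–Benzécri: a divisible properly convex domain of `ℝP²` is either a triangle or
round (strictly convex with `C¹` boundary). -/
theorem kuiper_benzecri (Ω : Set (RP 2)) (hΩ : IsProperlyConvexDomain Ω)
    (hdiv : ∃ Γ : Subgroup (GL (Fin 3) ℝ), Divides Γ Ω) :
    (∃ g : GL (Fin 3) ℝ, detPM1 g ∧ projMap g '' Ω = projOfCone octantCone) ∨
    (IsStrictlyConvexDomain Ω ∧
      ∀ x ∈ frontier Ω,
        (∃ φ : Module.Dual ℝ (Vec 2), IsSupportingAt Ω φ x) ∧
        ∀ φ ψ : Module.Dual ℝ (Vec 2), IsSupportingAt Ω φ x → IsSupportingAt Ω ψ x →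
          LinearMap.ker φ = LinearMap.ker ψ) := by
  obtain ⟨C, hC, rfl⟩ := hΩ
  obtain ⟨Γ, -, -, hΓ, -, hco⟩ := hdiv
  have hq := hC.isQuasiHomogeneousCone hΓ hco
  refine or_iff_not_imp_left.2 fun hT => ?_
  have hT' := fun h => hT (exists_projMap_image_eq_octant hC h)
  obtain ⟨f, hf⟩ := hC.exists_norm_le
  refine ⟨fun v w hvw hfr => ?_, fun x hx => ?_⟩
  · have hv0 : v ≠ 0 := by simpa using hvw.ne_zero 0
    have hw0 : w ≠ 0 := by simpa using hvw.ne_zero 1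
    have hcomb : ∀ t : ℝ, t • v + (1 - t) • w ≠ 0 := by
      intro t h
      have := LinearIndependent.pair_iff.1 hvw _ _ h
      linarith [this.1, this.2]
    have hseg : ∀ t ∈ Set.Icc (0 : ℝ) 1, (t • v + (1 - t) • w ∈ closure C ∨
        -(t • v + (1 - t) • w) ∈ closure C) ∧ t • v + (1 - t) • w ∉ C ∧
        -(t • v + (1 - t) • w) ∉ C := fun t ht =>
      hC.mk_mem_frontier (hcomb t) (hfr t ht (hcomb t))
    have hfne : ∀ t ∈ Set.Icc (0 : ℝ) 1, f (t • v + (1 - t) • w) ≠ 0 := by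
      intro t ht h0
      rcases (hseg t ht).1 with h | h
      · exact hcomb t (norm_le_zero_iff.1 ((hf _ h).trans h0.le))
      · have := hf _ h
        rw [map_neg, h0, neg_zero, norm_le_zero_iff] at this
        exact hcomb t (neg_eq_zero.1 this)
    have hcont : Continuous fun t : ℝ => f (t • v + (1 - t) • w) := by fun_prop
    have key : ∀ v' w' : Vec 2, LinearIndependent ℝ ![v', w'] → v' ∈ closure C →
        w' ∈ closure C → (1 / 2 : ℝ) • v' + (1 - 1 / 2 : ℝ) • w' ∉ C → False := by
      intro v' w' hvw' hv' hw' hmid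
      have hmidcl := hC.add_mem_closure (hC.smul_mem_closure hv' (t := 1 / 2) (by norm_num))
        (hC.smul_mem_closure hw' (t := 1 - 1 / 2) (by norm_num))
      obtain ⟨φ, hφ, hφ0⟩ := hC.exists_pos_of_notMem hmidcl hmid
      have hφcl : ∀ u ∈ closure C, 0 ≤ φ u := fun u hu =>
        closure_minimal (fun c hc => (hφ c hc).le)
          (isClosed_le continuous_const φ.continuous_of_finiteDimensional) hu
      have h1 := hφcl v' hv'
      have h2 := hφcl w' hw'
      simp only [map_add, map_smul, smul_eq_mul] at hφ0
      exact hT' (exists_equiv_octantCone_of_segment hC hq hφ hvw' hv' hw' (by linarith)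
        (by linarith))
    have h1 := hseg 1 ⟨zero_le_one, le_rfl⟩
    have h0 := hseg 0 ⟨le_rfl, zero_le_one⟩
    have hm := hseg (1 / 2) ⟨by norm_num, by norm_num⟩
    simp only [one_smul, sub_self, zero_smul, add_zero, sub_zero, zero_add] at h0 h1
    have hnn : ∀ u ∈ closure C, 0 ≤ f u := fun u hu => (norm_nonneg u).trans (hf u hu)
    rcases h1.1 with hv | hv <;> rcases h0.1 with hw | hw
    · exact key v w hvw hv hw hm.2.1
    · obtain ⟨t, ht, ht0⟩ := intermediate_value_Icc (zero_le_one' ℝ) hcont.continuousOn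
        (show (0 : ℝ) ∈ _ by
          have := hnn _ hw
          rw [map_neg] at this
          simpa using ⟨neg_nonneg.1 this, hnn _ hv⟩)
      exact hfne t ht ht0
    · obtain ⟨t, ht, ht0⟩ := intermediate_value_Icc' (zero_le_one' ℝ) hcont.continuousOn
        (show (0 : ℝ) ∈ _ by
          have := hnn _ hv
          rw [map_neg] at this
          simpa using ⟨neg_nonneg.1 this, hnn _ hw⟩)
      exact hfne t ht ht0
    · refine key (-v) (-w) ?_ hv hw ?_
      · refine LinearIndependent.pair_iff.2 fun s t hst => ?_
        refine LinearIndependent.pair_iff.1 hvw s t ?_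
        rw [smul_neg, smul_neg, ← neg_add, neg_eq_zero] at hst
        exact hst
      · rw [smul_neg, smul_neg, ← neg_add]
        exact hm.2.2
  · obtain ⟨p, hp0, hpx, hp, hpC⟩ : ∃ (p : Vec 2) (hp0 : p ≠ 0),
        x = Projectivization.mk ℝ p hp0 ∧ p ∈ closure C ∧ p ∉ C := by
      induction x using Projectivization.ind with
      | h v hv =>
        obtain ⟨h | h, h1, h2⟩ := hC.mk_mem_frontier hv hx
        · exact ⟨v, hv, rfl, h, h1⟩
        · exact ⟨-v, neg_ne_zero.2 hv,
            (Projectivization.mk_eq_mk_iff' ℝ _ _ _ _).2 ⟨-1, by simp⟩, h, h2⟩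
    subst hpx
    refine ⟨?_, fun φ ψ hφ hψ => ?_⟩
    · obtain ⟨φ, hφ, hφp⟩ := hC.exists_pos_of_notMem hp hpC
      exact ⟨φ, (hC.isSupportingAt_mk_iff hp0).2 ⟨hφp, fun c hc => (hφ c hc).ne'⟩⟩
    · rw [hC.isSupportingAt_mk_iff] at hφ hψ
      by_contra hne
      have hnegker : ∀ χ : Vec 2 →ₗ[ℝ] ℝ, LinearMap.ker (-χ) = LinearMap.ker χ := by
        intro χ
        ext
        simp
      have hnegp : ∀ χ : Vec 2 →ₗ[ℝ] ℝ, χ p = 0 → (-χ) p = 0 := by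
        intro χ h
        simp [h]
      rcases hC.exists_sign hφ.2 with h1 | h1 <;> rcases hC.exists_sign hψ.2 with h2 | h2
      · exact hT' (exists_equiv_octantCone_of_corner hC hq h1 h2 hp hp0 hφ.1 hψ.1 hne)
      · exact hT' (exists_equiv_octantCone_of_corner hC hq h1 h2 hp hp0 hφ.1 (hnegp _ hψ.1)
          (by rwa [hnegker]))
      · exact hT' (exists_equiv_octantCone_of_corner hC hq h1 h2 hp hp0 (hnegp _ hφ.1) hψ.1
          (by rwa [hnegker]))
      · exact hT' (exists_equiv_octantCone_of_corner hC hq h1 h2 hp hp0 (hnegp _ hφ.1)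
          (hnegp _ hψ.1) (by rwa [hnegker, hnegker]))
end

section
/- Let Ω be a nonempty open bounded convex subset of ℝ^d. Then: (1) for any two distinct points x, y ∈ Ω, the affine line through x and y meets ∂Ω in exactly two points p and q (labeled so that p, x, y, q occur in this order), so the Hilbert metric d_Ω is well defined; (2) d_Ω is a metric on Ω; (3) the topology induced by d_Ω on Ω coincides with the subspace topology from ℝ^d; (4) the metric space (Ω, d_Ω) is complete; and (5) (Ω, d_Ω) is proper, i.e., every closed d_Ω-ball is compact. -/
section HilbertMetric

open Set Filter Topology
open scoped Pointwise

variable {E : Type*} [NormedAddCommGroup E] {Ω : Set E} {x y z p q : E}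

lemma preimage_add_mem_nhds_zero (hopen : IsOpen Ω) (hx : x ∈ Ω) :
    (fun v => x + v) ⁻¹' Ω ∈ 𝓝 (0 : E) :=
  (hopen.preimage (continuous_const_add x)).mem_nhds (by simpa using hx)

variable [NormedSpace ℝ E]

/-- The gauge of `y - x` with respect to the translate of `Ω` that moves `x` to the origin. -/
noncomputable def pointedGauge (Ω : Set E) (x y : E) : ℝ :=
  gauge ((fun v => x + v) ⁻¹' Ω) (y - x)

/-- The Funk weak metric of `Ω`. -/
noncomputable def funkDist (Ω : Set E) (x y : E) : ℝ :=
  -Real.log (1 - pointedGauge Ω x y)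

/-- The Hilbert distance of `Ω`, as the symmetrization of the Funk weak metric. -/
noncomputable def hilbertDist (Ω : Set E) (x y : E) : ℝ :=
  (1 / 2) * (funkDist Ω x y + funkDist Ω y x)

lemma absorbent_preimage_add (hopen : IsOpen Ω) (hx : x ∈ Ω) :
    Absorbent ℝ ((fun v => x + v) ⁻¹' Ω) :=
  absorbent_nhds_zero (preimage_add_mem_nhds_zero hopen hx)

lemma pointedGauge_nonneg (Ω : Set E) (x y : E) : 0 ≤ pointedGauge Ω x y := gauge_nonneg _

lemma pointedGauge_self (Ω : Set E) (x : E) : pointedGauge Ω x x = 0 := by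
  simp [pointedGauge]

lemma pointedGauge_add_smul {t : ℝ} (ht : 0 ≤ t) :
    pointedGauge Ω x (x + t • (y - x)) = t * pointedGauge Ω x y := by
  simp [pointedGauge, gauge_smul_of_nonneg ht]

lemma continuous_pointedGauge (hopen : IsOpen Ω) (hconv : Convex ℝ Ω) (hx : x ∈ Ω) :
    Continuous (pointedGauge Ω x) :=
  (continuous_gauge (hconv.translate_preimage_right x)
    (preimage_add_mem_nhds_zero hopen hx)).comp (continuous_id.sub continuous_const)

lemma pointedGauge_lt_one_iff (hopen : IsOpen Ω) (hconv : Convex ℝ Ω) (hx : x ∈ Ω) :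
    pointedGauge Ω x y < 1 ↔ y ∈ Ω := by
  rw [pointedGauge, gauge_lt_one_iff_mem_interior (hconv.translate_preimage_right x)
    (preimage_add_mem_nhds_zero hopen hx),
    (hopen.preimage (continuous_const_add x)).interior_eq]
  simp

lemma pointedGauge_eq_one_iff (hopen : IsOpen Ω) (hconv : Convex ℝ Ω) (hx : x ∈ Ω) :
    pointedGauge Ω x y = 1 ↔ y ∈ frontier Ω := by
  have h := (Homeomorph.addLeft x).preimage_frontier Ω
  rw [Homeomorph.coe_addLeft] at h
  rw [pointedGauge, gauge_eq_one_iff_mem_frontier (hconv.translate_preimage_right x)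
    (preimage_add_mem_nhds_zero hopen hx), ← h]
  simp

lemma mul_pointedGauge_le_norm {r : ℝ} (h : Metric.ball x r ⊆ Ω) :
    r * pointedGauge Ω x y ≤ ‖y - x‖ := by
  refine mul_gauge_le_norm fun v hv => h ?_
  simpa using hv

lemma exists_norm_sub_le_mul_pointedGauge (hopen : IsOpen Ω) (hbdd : Bornology.IsBounded Ω) :
    ∃ C > 0, ∀ x ∈ Ω, ∀ y, ‖y - x‖ ≤ C * pointedGauge Ω x y := by
  obtain ⟨R, hR, hsub⟩ := hbdd.subset_closedBall_lt 0 (0 : E)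
  refine ⟨2 * R, by positivity, fun x hx y => ?_⟩
  have h : ‖y - x‖ / (2 * R) ≤ pointedGauge Ω x y := by
    refine le_gauge_of_subset_closedBall (absorbent_preimage_add hopen hx) (by positivity) ?_
    intro v hv
    have h1 := hsub hx
    have h2 := hsub hv
    rw [mem_closedBall_zero_iff] at h1 h2 ⊢
    have h3 : ‖v‖ ≤ ‖x + v‖ + ‖x‖ := by simpa using norm_sub_le (x + v) x
    linarith
  rwa [div_le_iff₀ (by positivity), mul_comm] at h

lemma pointedGauge_pos (hopen : IsOpen Ω) (hbdd : Bornology.IsBounded Ω) (hx : x ∈ Ω)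
    (hxy : x ≠ y) : 0 < pointedGauge Ω x y := by
  obtain ⟨C, hC, h⟩ := exists_norm_sub_le_mul_pointedGauge hopen hbdd
  have h1 : 0 < ‖y - x‖ := norm_pos_iff.2 (sub_ne_zero.2 hxy.symm)
  exact pos_of_mul_pos_right (h1.trans_le (h x hx y)) hC.le

lemma one_sub_pointedGauge_mul_le (hopen : IsOpen Ω) (hconv : Convex ℝ Ω) (hx : x ∈ Ω)
    (hy : y ∈ Ω) (hz : z ∈ Ω) :
    (1 - pointedGauge Ω x y) * (1 - pointedGauge Ω y z) ≤ 1 - pointedGauge Ω x z := by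
  have lt_one {u v : E} (hu : u ∈ Ω) (hv : v ∈ Ω) : pointedGauge Ω u v < 1 :=
    (pointedGauge_lt_one_iff hopen hconv hu).2 hv
  refine mul_le_of_forall_lt_of_nonneg (by linarith [lt_one hx hy]) (by linarith [lt_one hx hz])
    fun a ha0 ha c hc0 hc => ?_
  obtain ⟨b, hb0, hb1, v, hv, hbv⟩ := exists_lt_of_gauge_lt (absorbent_preimage_add hopen hx)
    (show gauge _ (y - x) < 1 - a by rw [← pointedGauge]; linarith)
  obtain ⟨b', hb0', hb1', w, hw, hbw⟩ := exists_lt_of_gauge_lt (absorbent_preimage_add hopen hy)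
    (show gauge _ (z - y) < 1 - c by rw [← pointedGauge]; linarith)
  have hD : 0 < (1 - b') * b + b' := by nlinarith
  have hmem : z - x ∈ ((1 - b') * b + b') • ((fun v => x + v) ⁻¹' Ω) := by
    have hconvex := hconv hv hw (a := (1 - b') * b / ((1 - b') * b + b'))
      (b := b' / ((1 - b') * b + b')) (div_nonneg (by nlinarith) hD.le) (by positivity)
      (by field_simp)
    rw [← add_sub_cancel x (_ • _ + _ • _)] at hconvex
    refine ⟨_, hconvex, ?_⟩
    have hy' : y = x + b • v := by
      rw [show b • v = y - x from hbv]; abel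
    have hz' : z = y + b' • w := by
      rw [show b' • w = z - y from hbw]; abel
    simp only [hz', hy']
    match_scalars <;> field_simp <;> ring
  have h := gauge_le_of_mem hD.le hmem
  rw [← pointedGauge] at h
  nlinarith [mul_le_mul (show a ≤ 1 - b by linarith) (show c ≤ 1 - b' by linarith) hc0
    (by linarith)]

lemma funkDist_self (Ω : Set E) (x : E) : funkDist Ω x x = 0 := by
  simp [funkDist, pointedGauge_self]

lemma pointedGauge_le_funkDist (hopen : IsOpen Ω) (hconv : Convex ℝ Ω) (hx : x ∈ Ω)
    (hy : y ∈ Ω) : pointedGauge Ω x y ≤ funkDist Ω x y := by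
  have h := (pointedGauge_lt_one_iff hopen hconv hx).2 hy
  have := Real.log_le_sub_one_of_pos (sub_pos.2 h)
  rw [funkDist]
  linarith

lemma funkDist_nonneg (hopen : IsOpen Ω) (hconv : Convex ℝ Ω) (hx : x ∈ Ω) (hy : y ∈ Ω) :
    0 ≤ funkDist Ω x y :=
  (pointedGauge_nonneg Ω x y).trans (pointedGauge_le_funkDist hopen hconv hx hy)

lemma funkDist_triangle (hopen : IsOpen Ω) (hconv : Convex ℝ Ω) (hx : x ∈ Ω)
    (hy : y ∈ Ω) (hz : z ∈ Ω) : funkDist Ω x z ≤ funkDist Ω x y + funkDist Ω y z := by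
  have h1 := sub_pos.2 ((pointedGauge_lt_one_iff hopen hconv hx).2 hy)
  have h2 := sub_pos.2 ((pointedGauge_lt_one_iff hopen hconv hy).2 hz)
  have h := Real.log_le_log (mul_pos h1 h2) (one_sub_pointedGauge_mul_le hopen hconv hx hy hz)
  rw [Real.log_mul h1.ne' h2.ne'] at h
  simp only [funkDist]
  linarith

lemma hilbertDist_comm (Ω : Set E) (x y : E) : hilbertDist Ω x y = hilbertDist Ω y x := by
  rw [hilbertDist, hilbertDist, add_comm]

lemma funkDist_le_two_mul_hilbertDist (hopen : IsOpen Ω) (hconv : Convex ℝ Ω) (hx : x ∈ Ω)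
    (hy : y ∈ Ω) : funkDist Ω x y ≤ 2 * hilbertDist Ω x y := by
  have := funkDist_nonneg hopen hconv hy hx
  rw [hilbertDist]
  linarith

lemma exists_norm_sub_le_mul_hilbertDist (hopen : IsOpen Ω) (hbdd : Bornology.IsBounded Ω)
    (hconv : Convex ℝ Ω) :
    ∃ C > 0, ∀ x ∈ Ω, ∀ y ∈ Ω, ‖y - x‖ ≤ C * hilbertDist Ω x y := by
  obtain ⟨C, hC, h⟩ := exists_norm_sub_le_mul_pointedGauge hopen hbdd
  refine ⟨C * 2, by positivity, fun x hx y hy => (h x hx y).trans ?_⟩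
  rw [mul_assoc]
  exact mul_le_mul_of_nonneg_left ((pointedGauge_le_funkDist hopen hconv hx hy).trans
    (funkDist_le_two_mul_hilbertDist hopen hconv hx hy)) hC.le

lemma tendsto_hilbertDist (hopen : IsOpen Ω) (hx : x ∈ Ω) :
    Tendsto (hilbertDist Ω x) (𝓝 x) (𝓝 0) := by
  obtain ⟨r, hr, hball⟩ := Metric.isOpen_iff.1 hopen x hx
  have h0 : Tendsto (fun y => ‖y - x‖ / (r / 2)) (𝓝 x) (𝓝 0) := by
    have : Continuous fun y => ‖y - x‖ / (r / 2) := by fun_prop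
    simpa using this.tendsto x
  have hsub : ∀ᶠ y in 𝓝 x, Metric.ball y (r / 2) ⊆ Ω := by
    filter_upwards [Metric.ball_mem_nhds x (half_pos hr)] with y hy
    refine (Metric.ball_subset_ball' ?_).trans hball
    linarith [Metric.mem_ball.1 hy]
  have h1 : Tendsto (fun y => pointedGauge Ω x y) (𝓝 x) (𝓝 0) := by
    refine tendsto_of_tendsto_of_tendsto_of_le_of_le tendsto_const_nhds h0
      (fun y => pointedGauge_nonneg Ω x y) fun y => ?_
    rw [le_div_iff₀ (half_pos hr), mul_comm]
    exact mul_pointedGauge_le_norm ((Metric.ball_subset_ball (by linarith)).trans hball)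
  have h2 : Tendsto (fun y => pointedGauge Ω y x) (𝓝 x) (𝓝 0) := by
    refine tendsto_of_tendsto_of_tendsto_of_le_of_le' tendsto_const_nhds h0
      (Eventually.of_forall fun y => pointedGauge_nonneg Ω y x) ?_
    filter_upwards [hsub] with y hy
    rw [le_div_iff₀ (half_pos hr), mul_comm, norm_sub_rev]
    exact mul_pointedGauge_le_norm hy
  have key {f : E → ℝ} (hf : Tendsto f (𝓝 x) (𝓝 0)) :
      Tendsto (fun y => -Real.log (1 - f y)) (𝓝 x) (𝓝 0) := by
    have := ((hf.const_sub 1).log (by simp)).neg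
    simpa using this
  have h := ((key h1).add (key h2)).const_mul (1 / 2)
  rw [add_zero, mul_zero] at h
  exact h

/-- The Hilbert metric of a bounded open convex set, on top of the subspace topology. -/
@[reducible]
noncomputable def hilbertMetricSpace (hopen : IsOpen Ω) (hbdd : Bornology.IsBounded Ω)
    (hconv : Convex ℝ Ω) : MetricSpace Ω :=
  MetricSpace.ofDistTopology (fun x y : Ω => hilbertDist Ω x y)
    (fun x => by simp [hilbertDist, funkDist_self])
    (fun x y => hilbertDist_comm Ω x y)
    (fun x y z => by
      have h1 := funkDist_triangle hopen hconv x.2 y.2 z.2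
      have h2 := funkDist_triangle hopen hconv z.2 y.2 x.2
      simp only [hilbertDist]
      linarith)
    (fun s => by
      obtain ⟨C, hC, h⟩ := exists_norm_sub_le_mul_hilbertDist hopen hbdd hconv
      constructor
      · intro hs x hx
        obtain ⟨ε, hε, hball⟩ := Metric.isOpen_iff.1 hs x hx
        refine ⟨ε / C, by positivity, fun y hy => hball ?_⟩
        rw [lt_div_iff₀ hC, mul_comm] at hy
        rw [Metric.mem_ball, Subtype.dist_eq, dist_eq_norm]
        exact (h x x.2 y y.2).trans_lt hy
      · intro hs
        refine isOpen_iff_mem_nhds.2 fun x hx => ?_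
        obtain ⟨ε, hε, hsub⟩ := hs x hx
        have ht := (tendsto_hilbertDist hopen x.2).comp
          (continuous_subtype_val.tendsto x)
        filter_upwards [ht.eventually_lt_const hε] with y hy using hsub y hy)
    (fun x y hxy => by
      obtain ⟨C, hC, h⟩ := exists_norm_sub_le_mul_hilbertDist hopen hbdd hconv
      have := h x x.2 y y.2
      rw [hxy, mul_zero, norm_le_zero_iff, sub_eq_zero] at this
      exact Subtype.ext this.symm)

lemma isCompact_setOf_pointedGauge_le [FiniteDimensional ℝ E] (hopen : IsOpen Ω)
    (hbdd : Bornology.IsBounded Ω) (hconv : Convex ℝ Ω) (hx : x ∈ Ω) {c : ℝ} (hc : c < 1) :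
    IsCompact {y : Ω | pointedGauge Ω x y ≤ c} := by
  have := FiniteDimensional.proper_real E
  have hsub : {y | pointedGauge Ω x y ≤ c} ⊆ Ω := fun y hy =>
    (pointedGauge_lt_one_iff hopen hconv hx).1 (lt_of_le_of_lt hy hc)
  have hcomp : IsCompact {y | pointedGauge Ω x y ≤ c} :=
    Metric.isCompact_of_isClosed_isBounded
      (isClosed_le (continuous_pointedGauge hopen hconv hx) continuous_const) (hbdd.subset hsub)
  rw [Subtype.isCompact_iff]
  convert hcomp
  ext y
  simpa using fun hy => hsub hy

lemma isCompact_hilbert_closedBall [FiniteDimensional ℝ E] (hopen : IsOpen Ω)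
    (hbdd : Bornology.IsBounded Ω) (hconv : Convex ℝ Ω) (x : Ω) (r : ℝ) :
    IsCompact (@Metric.closedBall Ω
      (hilbertMetricSpace hopen hbdd hconv).toPseudoMetricSpace x r) := by
  have hK := isCompact_setOf_pointedGauge_le hopen hbdd hconv x.2
    (sub_lt_self 1 (Real.exp_pos (-(2 * r))))
  refine hK.of_isClosed_subset (@Metric.isClosed_closedBall Ω
    (hilbertMetricSpace hopen hbdd hconv).toPseudoMetricSpace x r) fun y hy => ?_
  have hy' : hilbertDist Ω x y ≤ r := by
    rw [hilbertDist_comm]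
    exact hy
  have h1 := funkDist_le_two_mul_hilbertDist hopen hconv x.2 y.2
  have h2 := sub_pos.2 ((pointedGauge_lt_one_iff hopen hconv x.2).2 y.2)
  have h3 : Real.exp (-(2 * r)) ≤ 1 - pointedGauge Ω x y := by
    rw [← Real.le_log_iff_exp_le h2]
    rw [funkDist] at h1
    linarith
  rw [mem_ofPred_eq]
  linarith

lemma norm_div_norm_eq_inv_one_sub_pointedGauge (hopen : IsOpen Ω) (hconv : Convex ℝ Ω)
    (hx : x ∈ Ω) (hq : q ∈ frontier Ω) (hy : y ∈ openSegment ℝ x q) :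
    ‖q - x‖ / ‖q - y‖ = (1 - pointedGauge Ω x y)⁻¹ := by
  rw [openSegment_eq_image'] at hy
  obtain ⟨t, ⟨ht0, ht1⟩, rfl⟩ := hy
  have hqx : q ≠ x := by
    rintro rfl
    exact (hopen.frontier_eq ▸ hq).2 hx
  have hne : ‖q - x‖ ≠ 0 := norm_ne_zero_iff.2 (sub_ne_zero.2 hqx)
  have hsub : q - (x + t • (q - x)) = (1 - t) • (q - x) := by module
  simp only [pointedGauge_add_smul ht0.le, (pointedGauge_eq_one_iff hopen hconv hx).2 hq,
    hsub, norm_smul, Real.norm_of_nonneg (sub_pos.2 ht1).le, mul_one]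
  have := (sub_pos.2 ht1).ne'
  field_simp

lemma hilbertDist_eq_log_cross_ratio (hopen : IsOpen Ω) (hconv : Convex ℝ Ω)
    (hx : x ∈ Ω) (hy : y ∈ Ω) (hp : p ∈ frontier Ω) (hq : q ∈ frontier Ω)
    (hxp : x ∈ openSegment ℝ p y) (hyq : y ∈ openSegment ℝ x q) :
    hilbertDist Ω x y =
      (1 / 2) * Real.log ((‖p - y‖ * ‖q - x‖) / (‖p - x‖ * ‖q - y‖)) := by
  rw [mul_div_mul_comm, norm_div_norm_eq_inv_one_sub_pointedGauge hopen hconv hx hq hyq,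
    norm_div_norm_eq_inv_one_sub_pointedGauge hopen hconv hy hp (openSegment_symm ℝ p y ▸ hxp)]
  have h1 := sub_pos.2 ((pointedGauge_lt_one_iff hopen hconv hx).2 hy)
  have h2 := sub_pos.2 ((pointedGauge_lt_one_iff hopen hconv hy).2 hx)
  rw [Real.log_mul (inv_ne_zero h2.ne') (inv_ne_zero h1.ne'), Real.log_inv, Real.log_inv,
    hilbertDist, funkDist, funkDist, add_comm]

lemma existsUnique_mem_frontier_mem_openSegment (hopen : IsOpen Ω)
    (hbdd : Bornology.IsBounded Ω) (hconv : Convex ℝ Ω) (hx : x ∈ Ω) (hy : y ∈ Ω)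
    (hxy : x ≠ y) : ∃! q, q ∈ frontier Ω ∧ y ∈ openSegment ℝ x q := by
  have hpos := pointedGauge_pos hopen hbdd hx hxy
  have hlt := (pointedGauge_lt_one_iff hopen hconv hx).2 hy
  refine ⟨x + (pointedGauge Ω x y)⁻¹ • (y - x), ⟨?_, ?_⟩, ?_⟩
  · rw [← pointedGauge_eq_one_iff hopen hconv hx, pointedGauge_add_smul (by positivity),
      inv_mul_cancel₀ hpos.ne']
  · rw [openSegment_eq_image']
    refine ⟨_, ⟨hpos, hlt⟩, ?_⟩
    simp [smul_smul, hpos.ne']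
  · rintro q ⟨hq, hyq⟩
    rw [openSegment_eq_image'] at hyq
    obtain ⟨t, ⟨ht0, ht1⟩, rfl⟩ := hyq
    simp [pointedGauge_add_smul ht0.le, (pointedGauge_eq_one_iff hopen hconv hx).2 hq,
      smul_smul, ht0.ne']

end HilbertMetric


/-- Basics of the Hilbert metric on a nonempty open bounded convex `Ω ⊆ ℝ^d`: the line
through two distinct points of `Ω` meets `∂Ω` in exactly two points (ordered
`p, x, y, q`), the Hilbert formula defines a metric, its topology is the Euclidean
subspace topology, and the resulting metric space is complete and proper. -/
theorem hilbert_metric_basics (d : ℕ) (Ω : Set (EuclideanSpace ℝ (Fin d)))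
    (hne : Ω.Nonempty) (hopen : IsOpen Ω) (hbdd : Bornology.IsBounded Ω)
    (hconv : Convex ℝ Ω) :
    (∀ x ∈ Ω, ∀ y ∈ Ω, x ≠ y →
      ∃! pq : EuclideanSpace ℝ (Fin d) × EuclideanSpace ℝ (Fin d),
        pq.1 ∈ frontier Ω ∧ pq.2 ∈ frontier Ω ∧
        x ∈ openSegment ℝ pq.1 y ∧ y ∈ openSegment ℝ x pq.2) ∧
    ∃ m : MetricSpace Ω,
      (∀ x y : Ω, ∀ p q : EuclideanSpace ℝ (Fin d),
        p ∈ frontier Ω → q ∈ frontier Ω →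
        (x : EuclideanSpace ℝ (Fin d)) ∈ openSegment ℝ p (y : EuclideanSpace ℝ (Fin d)) →
        (y : EuclideanSpace ℝ (Fin d)) ∈ openSegment ℝ (x : EuclideanSpace ℝ (Fin d)) q →
        m.dist x y = (1 / 2) * Real.log
          ((‖p - (y : EuclideanSpace ℝ (Fin d))‖ * ‖q - (x : EuclideanSpace ℝ (Fin d))‖) /
           (‖p - (x : EuclideanSpace ℝ (Fin d))‖ * ‖q - (y : EuclideanSpace ℝ (Fin d))‖))) ∧
      m.toUniformSpace.toTopologicalSpace = instTopologicalSpaceSubtype ∧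
      @CompleteSpace Ω m.toUniformSpace ∧
      ∀ (x : Ω) (r : ℝ), IsCompact (@Metric.closedBall Ω m.toPseudoMetricSpace x r) := by
  refine ⟨fun x hx y hy hxy => ?_, hilbertMetricSpace hopen hbdd hconv,
    fun x y p q hp hq hxp hyq =>
      hilbertDist_eq_log_cross_ratio hopen hconv x.2 y.2 hp hq hxp hyq,
    rfl, ?_, isCompact_hilbert_closedBall hopen hbdd hconv⟩
  · obtain ⟨q, hq, hq'⟩ :=
      existsUnique_mem_frontier_mem_openSegment hopen hbdd hconv hx hy hxy
    obtain ⟨p, hp, hp'⟩ :=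
      existsUnique_mem_frontier_mem_openSegment hopen hbdd hconv hy hx hxy.symm
    simp only [openSegment_symm ℝ y] at hp hp'
    refine ⟨(p, q), ⟨hp.1, hq.1, hp.2, hq.2⟩, ?_⟩
    rintro ⟨p', q'⟩ ⟨h1, h2, h3, h4⟩
    exact Prod.ext (hp' p' ⟨h1, h3⟩) (hq' q' ⟨h2, h4⟩)
  · exact @complete_of_proper Ω (hilbertMetricSpace hopen hbdd hconv).toPseudoMetricSpace
      (@ProperSpace.mk Ω (hilbertMetricSpace hopen hbdd hconv).toPseudoMetricSpace
        (isCompact_hilbert_closedBall hopen hbdd hconv))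
end

section
/- Let Ω ⊆ ℝ² be the interior of the triangle with vertices (0,0), (1,0), (0,1), equipped with its Hilbert metric d_Ω. Then (Ω, d_Ω) is isometric to ℝ² equipped with the norm N(u,v) = max(|u|, |v|, |u − v|), whose unit ball is a hexagon (linearly equivalent to the regular hexagon): there exists a bijection F : Ω → ℝ² with N(F(x) − F(y)) = d_Ω(x,y) for all x, y ∈ Ω. -/
/-- The interior of the triangle with vertices `(0,0)`, `(1,0)`, `(0,1)`. -/
def openTriangle : Set (EuclideanSpace ℝ (Fin 2)) :=
  {p | 0 < p 0 ∧ 0 < p 1 ∧ p 0 + p 1 < 1}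

/-- The hexagonal norm on `ℝ²`. -/
def hexNorm (w : ℝ × ℝ) : ℝ := max (max |w.1| |w.2|) |w.1 - w.2|

/-- The barycentric coordinates of a point with respect to the vertices `(1,0)`, `(0,1)`,
`(0,0)`. -/
def triangleBary (p : EuclideanSpace ℝ (Fin 2)) : Fin 3 → ℝ := ![p 0, p 1, 1 - p 0 - p 1]

lemma mem_openTriangle_iff_triangleBary_pos (p : EuclideanSpace ℝ (Fin 2)) :
    p ∈ openTriangle ↔ ∀ i, 0 < triangleBary p i := by
  simp only [openTriangle, Set.mem_ofPred_eq, triangleBary, Fin.forall_fin_succ]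
  simp [sub_sub]

lemma triangleBary_add_smul_sub (x y : EuclideanSpace ℝ (Fin 2)) (s : ℝ) (i : Fin 3) :
    triangleBary (x + s • (x - y)) i =
      triangleBary x i + s * (triangleBary x i - triangleBary y i) := by
  fin_cases i <;> simp [triangleBary]
  ring

lemma isOpen_openTriangle : IsOpen openTriangle := by
  have h0 : Continuous fun p : EuclideanSpace ℝ (Fin 2) => p 0 := by fun_prop
  have h1 : Continuous fun p : EuclideanSpace ℝ (Fin 2) => p 1 := by fun_prop
  exact (isOpen_lt continuous_const h0).inter
    ((isOpen_lt continuous_const h1).inter (isOpen_lt (h0.add h1) continuous_const))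

lemma exists_triangleBary_lt {x y : EuclideanSpace ℝ (Fin 2)} (hxy : x ≠ y) :
    ∃ i, triangleBary x i < triangleBary y i := by
  by_contra! h
  have h0 := h 0
  have h1 := h 1
  have h2 := h 2
  simp only [triangleBary, Matrix.cons_val] at h0 h1 h2
  apply hxy
  ext i
  fin_cases i
  · show x 0 = y 0
    linarith
  · show x 1 = y 1
    linarith

/-- The ray from `y` through `x` leaves the triangle through the side opposite to the vertex whose
barycentric coordinate has the largest relative decrease from `y` to `x`. -/
lemma exists_exit_point {x y : EuclideanSpace ℝ (Fin 2)} (hx : x ∈ openTriangle)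
    (hy : y ∈ openTriangle) (hxy : x ≠ y) :
    ∃ j, (∀ i, triangleBary y i / triangleBary x i ≤ triangleBary y j / triangleBary x j) ∧
      triangleBary x j < triangleBary y j ∧
      ∃ p ∈ frontier openTriangle, x ∈ openSegment ℝ p y ∧
        ‖p - x‖ ≠ 0 ∧ ‖p - y‖ = triangleBary y j / triangleBary x j * ‖p - x‖ := by
  have hx_pos := (mem_openTriangle_iff_triangleBary_pos x).1 hx
  have hy_pos := (mem_openTriangle_iff_triangleBary_pos y).1 hy
  obtain ⟨j, hj⟩ := Finite.exists_max fun i => triangleBary y i / triangleBary x i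
  obtain ⟨k, hk⟩ := exists_triangleBary_lt hxy
  have hlt : triangleBary x j < triangleBary y j :=
    (one_lt_div (hx_pos j)).1 (((one_lt_div (hx_pos k)).2 hk).trans_le (hj k))
  set s := triangleBary x j / (triangleBary y j - triangleBary x j) with hs
  have hd : 0 < triangleBary y j - triangleBary x j := sub_pos.2 hlt
  have hs0 : 0 < s := div_pos (hx_pos j) hd
  have hsmul : s * (triangleBary y j - triangleBary x j) = triangleBary x j :=
    div_mul_cancel₀ _ hd.ne'
  have hmem : ∀ t ∈ Set.Ico 0 s, x + t • (x - y) ∈ openTriangle := by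
    rintro t ⟨ht0, hts⟩
    rw [mem_openTriangle_iff_triangleBary_pos]
    intro i
    rw [triangleBary_add_smul_sub]
    have h1 : triangleBary y i * triangleBary x j ≤ triangleBary y j * triangleBary x i :=
      (div_le_div_iff₀ (hx_pos i) (hx_pos j)).1 (hj i)
    have h2 : t * (triangleBary y j - triangleBary x j) < triangleBary x j := by
      calc t * (triangleBary y j - triangleBary x j)
          < s * (triangleBary y j - triangleBary x j) := mul_lt_mul_of_pos_right hts hd
        _ = triangleBary x j := hsmul
    have h3 := mul_pos (hx_pos i) (sub_pos.2 h2)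
    have h4 := mul_le_mul_of_nonneg_left h1 ht0
    refine pos_of_mul_pos_left (b := triangleBary x j) ?_ (hx_pos j).le
    linarith
  have hcl : x + s • (x - y) ∈ closure openTriangle := by
    have hc : Continuous fun t : ℝ => x + t • (x - y) := by fun_prop
    have hsc : s ∈ closure (Set.Ico 0 s) := by
      rw [closure_Ico hs0.ne]; exact ⟨hs0.le, le_rfl⟩
    exact map_mem_closure (f := fun t : ℝ => x + t • (x - y)) hc hsc hmem
  have hne : ‖x - y‖ ≠ 0 := norm_ne_zero_iff.2 (sub_ne_zero.2 hxy)
  refine ⟨j, hj, hlt, x + s • (x - y), ?_, ?_, ?_, ?_⟩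
  · rw [isOpen_openTriangle.frontier_eq]
    refine ⟨hcl, fun h => ?_⟩
    have h1 := (mem_openTriangle_iff_triangleBary_pos _).1 h j
    rw [triangleBary_add_smul_sub] at h1
    linarith
  · refine ⟨1 / (1 + s), s / (1 + s), by positivity, by positivity, by field_simp, ?_⟩
    have : (1 + s) ≠ 0 := by positivity
    ext i
    simp only [PiLp.add_apply, PiLp.smul_apply, PiLp.sub_apply, smul_eq_mul]
    field_simp
    ring
  · rw [add_sub_cancel_left, norm_smul]
    exact mul_ne_zero (norm_ne_zero_iff.2 hs0.ne') hne
  · have e : x + s • (x - y) - y = (1 + s) • (x - y) := by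
      rw [add_smul, one_smul]; abel
    rw [e, add_sub_cancel_left, norm_smul, norm_smul, Real.norm_of_nonneg hs0.le,
      Real.norm_of_nonneg (by positivity : 0 ≤ 1 + s), ← mul_assoc]
    congr 1
    have := (hx_pos j).ne'
    rw [hs]
    field_simp
    ring

/-- Half the logarithms of the ratios of barycentric coordinates. -/
noncomputable def triangleLogMap (x : openTriangle) : ℝ × ℝ :=
  ((1 / 2) * (Real.log (triangleBary x 0) - Real.log (triangleBary x 2)),
    (1 / 2) * (Real.log (triangleBary x 1) - Real.log (triangleBary x 2)))

lemma hexNorm_half_differences (D : Fin 3 → ℝ) (i j : Fin 3) (hi : ∀ k, D k ≤ D i)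
    (hj : ∀ k, D j ≤ D k) :
    hexNorm ((1 / 2) * (D 0 - D 2), (1 / 2) * (D 1 - D 2)) = (1 / 2) * (D i - D j) := by
  have hi0 := hi 0
  have hi1 := hi 1
  have hi2 := hi 2
  have hj0 := hj 0
  have hj1 := hj 1
  have hj2 := hj 2
  unfold hexNorm
  apply le_antisymm
  · refine max_le (max_le ?_ ?_) ?_ <;> rw [abs_le] <;> constructor <;> dsimp only <;> linarith
  · fin_cases i <;> fin_cases j <;> simp only [le_max_iff, le_abs] <;> grind

lemma triangleLogMap_injective : Function.Injective triangleLogMap := by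
  intro x y h
  by_contra hne
  have hne' : (x : EuclideanSpace ℝ (Fin 2)) ≠ y := fun h => hne (Subtype.ext h)
  have hx_pos := (mem_openTriangle_iff_triangleBary_pos x).1 x.2
  have hy_pos := (mem_openTriangle_iff_triangleBary_pos y).1 y.2
  obtain ⟨i, hi⟩ := exists_triangleBary_lt hne'
  obtain ⟨j, hj⟩ := exists_triangleBary_lt hne'.symm
  have li := Real.log_lt_log (hx_pos i) hi
  have lj := Real.log_lt_log (hy_pos j) hj
  simp only [triangleLogMap, Prod.mk.injEq] at h
  obtain ⟨h0, h1⟩ := h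
  have key : ∀ k, Real.log (triangleBary x k) - Real.log (triangleBary y k) =
      Real.log (triangleBary x 2) - Real.log (triangleBary y 2) := by
    intro k
    fin_cases k <;> dsimp only [Fin.zero_eta, Fin.mk_one, Fin.reduceFinMk] <;> linarith
  have := key i
  have := key j
  linarith

lemma triangleLogMap_surjective : Function.Surjective triangleLogMap := by
  rintro ⟨u, v⟩
  have ha := Real.exp_pos (2 * u)
  have hb := Real.exp_pos (2 * v)
  set a := Real.exp (2 * u) with hau
  set b := Real.exp (2 * v) with hbv
  have hS : 0 < a + b + 1 := by positivity
  have h2 : 1 - a / (a + b + 1) - b / (a + b + 1) = 1 / (a + b + 1) := by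
    field_simp
    ring
  have hmem : !₂[a / (a + b + 1), b / (a + b + 1)] ∈ openTriangle := by
    rw [mem_openTriangle_iff_triangleBary_pos]
    intro i
    fin_cases i
    · simp [triangleBary]; positivity
    · simp [triangleBary]; positivity
    · simp only [triangleBary, Fin.reduceFinMk, Matrix.cons_val]
      rw [h2]; positivity
  refine ⟨⟨_, hmem⟩, ?_⟩
  simp only [triangleLogMap, triangleBary, Matrix.cons_val, h2]
  rw [Real.log_div ha.ne' hS.ne', Real.log_div hb.ne' hS.ne', Real.log_div one_ne_zero hS.ne',
    hau, hbv, Real.log_exp, Real.log_exp, Real.log_one]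
  ext <;> dsimp only <;> ring

/-- The Hilbert geometry of a triangle is isometric to the plane with the norm whose unit
ball is a (regular, up to linear equivalence) hexagon. Here `dΩ` is any function
satisfying the defining formula of the Hilbert metric of the open triangle `Ω`. -/
theorem triangle_hilbert_geometry_isometric_hexagonal_plane
    (dΩ : openTriangle → openTriangle → ℝ)
    (hdiag : ∀ x : openTriangle, dΩ x x = 0)
    (hformula : ∀ x y : openTriangle, ∀ p q : EuclideanSpace ℝ (Fin 2),
      p ∈ frontier openTriangle → q ∈ frontier openTriangle →
      (x : EuclideanSpace ℝ (Fin 2)) ∈ openSegment ℝ p (y : EuclideanSpace ℝ (Fin 2)) →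
      (y : EuclideanSpace ℝ (Fin 2)) ∈ openSegment ℝ (x : EuclideanSpace ℝ (Fin 2)) q →
      dΩ x y = (1 / 2) * Real.log
        ((‖p - (y : EuclideanSpace ℝ (Fin 2))‖ * ‖q - (x : EuclideanSpace ℝ (Fin 2))‖) /
         (‖p - (x : EuclideanSpace ℝ (Fin 2))‖ * ‖q - (y : EuclideanSpace ℝ (Fin 2))‖))) :
    ∃ F : openTriangle → ℝ × ℝ, Function.Bijective F ∧
      ∀ x y : openTriangle, hexNorm (F x - F y) = dΩ x y := by
  refine ⟨triangleLogMap, ⟨triangleLogMap_injective, triangleLogMap_surjective⟩, fun x y => ?_⟩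
  by_cases hxy : x = y
  · subst hxy
    simp [hdiag, hexNorm]
  have hne : (x : EuclideanSpace ℝ (Fin 2)) ≠ y := fun h => hxy (Subtype.ext h)
  have hx_pos := (mem_openTriangle_iff_triangleBary_pos x).1 x.2
  have hy_pos := (mem_openTriangle_iff_triangleBary_pos y).1 y.2
  obtain ⟨j, hj, -, p, hp, hpx, hp0, hpn⟩ := exists_exit_point x.2 y.2 hne
  obtain ⟨i, hi, -, q, hq, hqy, hq0, hqn⟩ := exists_exit_point y.2 x.2 hne.symm
  rw [openSegment_symm] at hqy
  rw [hformula x y p q hp hq hpx hqy, hpn, hqn]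
  have e : triangleBary y j / triangleBary x j * ‖p - x‖ *
      (triangleBary x i / triangleBary y i * ‖q - y‖) / (‖p - x‖ * ‖q - y‖) =
      (triangleBary x i / triangleBary y i) / (triangleBary x j / triangleBary y j) := by
    have := (hx_pos i).ne'
    have := (hx_pos j).ne'
    have := (hy_pos i).ne'
    have := (hy_pos j).ne'
    field_simp
  rw [e, Real.log_div (div_pos (hx_pos i) (hy_pos i)).ne' (div_pos (hx_pos j) (hy_pos j)).ne']
  rw [← hexNorm_half_differences
    (fun k => Real.log (triangleBary x k / triangleBary y k)) i j]
  · congr 1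
    simp only [Real.log_div (hx_pos _).ne' (hy_pos _).ne']
    ext <;> simp only [triangleLogMap, Prod.fst_sub, Prod.snd_sub] <;> ring
  · intro k
    exact Real.log_le_log (div_pos (hx_pos k) (hy_pos k)) (hi k)
  · intro k
    refine Real.log_le_log (div_pos (hx_pos j) (hy_pos j)) ?_
    rw [← inv_div, ← inv_div (triangleBary y k)]
    exact inv_anti₀ (div_pos (hy_pos k) (hx_pos k)) (hj k)
end

section
/- Let V = ℝ^{d+1}, let S be a finite set, and for each s ∈ S let α_s ∈ V* be nonzero and b_s ∈ V satisfy α_s(b_s) = 2; let σ_s(x) = x − α_s(x)·b_s, let Γ ≤ GL(V) be the subgroup generated by {σ_s : s ∈ S}, and let P̃ = {v ∈ V : α_s(v) ≤ 0 for all s ∈ S}. Assume P̃ has nonempty interior P̃°, that for each s ∈ S there exists v with α_s(v) = 0 and α_t(v) < 0 for all t ≠ s (each s defines a facet), and that γ(P̃°) ∩ P̃° = ∅ for every γ ∈ Γ with γ ≠ 1 (the tiles γP̃° are pairwise disjoint). Then the Cartan matrix A_{st} = α_s(b_t) satisfies: (V1) A_{st} ≤ 0 for all s ≠ t, and A_{st}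 = 0 if and only if A_{ts} = 0; and (V2) for all s ≠ t, either A_{st}·A_{ts} ≥ 4 or A_{st}·A_{ts} = 4·cos²(π/m) for some integer m ≥ 2. -/
open Real

/-- `β` is the linear form of a reflection `x ↦ x - β x • c` lying in the submonoid `G`. -/
def IsReflectionForm {E : Type*} [AddCommGroup E] [Module ℝ E]
    (G : Submonoid (E →ₗ[ℝ] E)) (β : Module.Dual ℝ E) : Prop :=
  ∃ c : E, β c = 2 ∧ LinearMap.id - β.smulRight c ∈ G

section

variable {E : Type*} [AddCommGroup E] [Module ℝ E] {G : Submonoid (E →ₗ[ℝ] E)}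

/-- Conjugating a reflection by the reflection `id - α ⊗ b` precomposes its form with it. -/
theorem IsReflectionForm.conj {α β : Module.Dual ℝ E} {b : E} (hab : α b = 2)
    (hG : LinearMap.id - α.smulRight b ∈ G) (hβ : IsReflectionForm G β) :
    IsReflectionForm G (β - β b • α) := by
  obtain ⟨c, hc, hcG⟩ := hβ
  refine ⟨c - α c • b, ?_, ?_⟩
  · simp only [LinearMap.sub_apply, LinearMap.smul_apply, map_sub, map_smul, smul_eq_mul, hab, hc]
    ring
  · convert G.mul_mem (G.mul_mem hG hcG) hG using 1
    ext x
    simp only [LinearMap.sub_apply, LinearMap.id_apply, LinearMap.smulRight_apply,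
      LinearMap.smul_apply, smul_eq_mul, Module.End.mul_apply, map_sub, map_smul, hab]
    module

/-- If `C` is disjoint from its translates under `G`, then no mirror of a reflection in `G`
meets `C`. -/
theorem IsReflectionForm.ne_zero_of_mem {β : Module.Dual ℝ E} {C : Set E}
    (htile : ∀ γ ∈ G, γ ≠ LinearMap.id → Disjoint (⇑γ '' C) C)
    (hβ : IsReflectionForm G β) {w : E} (hw : w ∈ C) : β w ≠ 0 := by
  intro h
  obtain ⟨c, hc, hcG⟩ := hβ
  refine Set.disjoint_left.1 (htile _ hcG ?_) ⟨w, hw, ?_⟩ hw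
  · intro hid
    have h1 := congrArg β (LinearMap.congr_fun hid c)
    simp [hc] at h1
  · simp [h]

/-- The forms obtained from `α` by alternately conjugating with two reflections whose Cartan
entries are `-2 cos θ * k` and `-2 cos θ / k`. -/
theorem isReflectionForm_sin {α β : Module.Dual ℝ E} {a b : E} (haa : α a = 2) (hbb : β b = 2)
    (haG : LinearMap.id - α.smulRight a ∈ G) (hbG : LinearMap.id - β.smulRight b ∈ G)
    {θ k : ℝ} (hθ : sin θ ≠ 0) (hab : α b = -(2 * cos θ * k)) (hba : k * β a = -(2 * cos θ))
    (n : ℕ) :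
    IsReflectionForm G ((sin ((2 * n + 1) * θ) / sin θ) • α
      + (sin ((2 * n) * θ) / sin θ * k) • β) ∧
    IsReflectionForm G ((sin ((2 * n + 1) * θ) / sin θ) • α
      + (sin ((2 * n + 2) * θ) / sin θ * k) • β) := by
  have sin_step (x : ℝ) : sin (x + θ) = 2 * cos θ * sin x - sin (x - θ) := by
    rw [sin_add, sin_sub]; ring
  have step (n : ℕ) (h : IsReflectionForm G ((sin ((2 * n + 1) * θ) / sin θ) • α
      + (sin ((2 * n) * θ) / sin θ * k) • β)) :
      IsReflectionForm G ((sin ((2 * n + 1) * θ) / sin θ) • α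
        + (sin ((2 * n + 2) * θ) / sin θ * k) • β) := by
    convert h.conj hbb hbG using 1
    have h1 := sin_step ((2 * n + 1) * θ)
    rw [show (2 * n + 1) * θ + θ = (2 * n + 2) * θ by ring,
      show (2 * n + 1) * θ - θ = 2 * n * θ by ring] at h1
    simp only [LinearMap.add_apply, LinearMap.smul_apply, smul_eq_mul, hab, hbb, h1]
    module
  induction n with
  | zero =>
    have h0 : IsReflectionForm G ((sin ((2 * (0 : ℕ) + 1) * θ) / sin θ) • α
        + (sin ((2 * (0 : ℕ)) * θ) / sin θ * k) • β) := by
      have hα : IsReflectionForm G α := ⟨a, haa, haG⟩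
      simpa [hθ] using hα
    exact ⟨h0, step 0 h0⟩
  | succ n ih =>
    have h0 : IsReflectionForm G ((sin ((2 * (n + 1 : ℕ) + 1) * θ) / sin θ) • α
        + (sin ((2 * (n + 1 : ℕ)) * θ) / sin θ * k) • β) := by
      convert ih.2.conj haa haG using 1
      have h1 := sin_step ((2 * n + 2) * θ)
      rw [show (2 * n + 2) * θ - θ = (2 * n + 1) * θ by ring] at h1
      push_cast
      rw [show (2 * ((n : ℝ) + 1) + 1) * θ = (2 * n + 2) * θ + θ by ring,
        show 2 * ((n : ℝ) + 1) * θ = (2 * n + 2) * θ by ring]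
      simp only [LinearMap.add_apply, LinearMap.smul_apply, smul_eq_mul, haa, h1,
        mul_assoc _ k, hba]
      module
    exact ⟨h0, step _ h0⟩

theorem cartan_entry_nonpos {α β : Module.Dual ℝ E} {b : E} (hbb : β b = 2)
    (hαG : IsReflectionForm G α) (hbG : LinearMap.id - β.smulRight b ∈ G)
    (hsign : ∀ p q : ℝ, IsReflectionForm G (p • α + q • β) → 0 ≤ p * q) : α b ≤ 0 := by
  have := hsign 1 (-α b) (by convert hαG.conj hbb hbG using 1; module)
  linarith

theorem cartan_entry_eq_zero {α β : Module.Dual ℝ E} {a b : E} (haa : α a = 2) (hbb : β b = 2)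
    (haG : LinearMap.id - α.smulRight a ∈ G) (hbG : LinearMap.id - β.smulRight b ∈ G)
    (hsign : ∀ p q : ℝ, IsReflectionForm G (p • α + q • β) → 0 ≤ p * q)
    (h : β a = 0) : α b = 0 := by
  have hα : IsReflectionForm G α := ⟨a, haa, haG⟩
  have h1 := cartan_entry_nonpos hbb hα hbG hsign
  have h2 := hsign (-1) (-α b) (by
    convert (hα.conj hbb hbG).conj haa haG using 1
    simp only [LinearMap.sub_apply, LinearMap.smul_apply, smul_eq_mul, haa, h]
    module)
  linarith

theorem exists_eq_pi_div_of_sin_mul_sin_nonneg {θ : ℝ} (h0 : 0 < θ) (h1 : θ ≤ π / 2)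
    (h : ∀ n : ℕ, 0 ≤ sin (n * θ) * sin ((n + 1) * θ)) : ∃ m : ℕ, 2 ≤ m ∧ θ = π / m := by
  have hπ := pi_pos
  obtain ⟨m, hm⟩ : ∃ m, ⌈π / θ⌉₊ = m + 1 :=
    Nat.exists_eq_succ_of_ne_zero (Nat.ceil_pos.2 (by positivity)).ne'
  have hle : π ≤ (m + 1) * θ := by
    have := Nat.le_ceil (π / θ)
    rw [hm, div_le_iff₀ h0] at this
    exact_mod_cast this
  have hlt : m * θ < π := by
    rw [← lt_div_iff₀ h0]
    exact Nat.lt_ceil.1 (by omega)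
  have hm1 : 1 ≤ m := by
    by_contra! hm0
    obtain rfl : m = 0 := by omega
    norm_num at hle
    linarith
  refine ⟨m + 1, by omega, ?_⟩
  have hpos : 0 < sin (m * θ) := sin_pos_of_pos_of_lt_pi (by positivity) hlt
  rcases hle.eq_or_lt with heq | hlt'
  · push_cast
    rw [heq]
    field_simp
  · have hneg : sin ((m + 1) * θ) < 0 := by
      have := sin_pos_of_pos_of_lt_pi (x := (m + 1) * θ - π) (by linarith) (by linarith)
      rw [sin_sub_pi] at this
      linarith
    exact absurd (h m) (not_le.2 (mul_neg_of_pos_of_neg hpos hneg))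

theorem cartan_product {α β : Module.Dual ℝ E} {a b : E} (haa : α a = 2) (hbb : β b = 2)
    (haG : LinearMap.id - α.smulRight a ∈ G) (hbG : LinearMap.id - β.smulRight b ∈ G)
    (hsign : ∀ p q : ℝ, IsReflectionForm G (p • α + q • β) → 0 ≤ p * q)
    (hab : α b < 0) (hba : β a < 0) (hlt : α b * β a < 4) :
    ∃ m : ℕ, 2 ≤ m ∧ α b * β a = 4 * cos (π / m) ^ 2 := by
  have hpos := mul_pos_of_neg_of_neg hab hba
  obtain ⟨θ, hθ0, hθ1, hθ⟩ : ∃ θ, 0 < θ ∧ θ < π / 2 ∧ α b * β a = 4 * cos θ ^ 2 := by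
    have hsq := Real.sq_sqrt hpos.le
    have hr := Real.sqrt_pos.2 hpos
    have hr2 : √(α b * β a) < 2 := by nlinarith
    refine ⟨arccos (√(α b * β a) / 2), arccos_pos.2 (by linarith),
      arccos_lt_pi_div_two.2 (by linarith), ?_⟩
    rw [cos_arccos (by linarith) (by linarith), div_pow, hsq]
    ring
  have hc : 0 < cos θ := cos_pos_of_mem_Ioo ⟨by linarith, hθ1⟩
  have hs : 0 < sin θ := sin_pos_of_pos_of_lt_pi hθ0 (by linarith)
  have hk : 0 < -α b / (2 * cos θ) := div_pos (by linarith) (by linarith)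
  have key := isReflectionForm_sin (k := -α b / (2 * cos θ)) haa hbb haG hbG hs.ne'
    (by field_simp) (by field_simp; linarith)
  have hnonneg {x y : ℝ} (h : 0 ≤ x / sin θ * (y / sin θ * (-α b / (2 * cos θ)))) :
      0 ≤ x * y := by
    rw [show x / sin θ * (y / sin θ * (-α b / (2 * cos θ)))
      = x * y * (-α b / (2 * cos θ) / sin θ ^ 2) by field_simp] at h
    exact nonneg_of_mul_nonneg_left h (by positivity)
  obtain ⟨m, hm, rfl⟩ := exists_eq_pi_div_of_sin_mul_sin_nonneg hθ0 hθ1.le (fun n => by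
    obtain ⟨j, rfl | rfl⟩ := n.even_or_odd'
    · have := hnonneg (hsign _ _ (key j).1)
      push_cast
      linarith
    · have := hnonneg (hsign _ _ (key j).2)
      push_cast
      rwa [show (2 * (j : ℝ) + 1 + 1) = 2 * j + 2 by ring])
  exact ⟨m, hm, hθ⟩

end

/-- Vinberg's conditions (V1) and (V2) are necessary for a projective Coxeter polytope:
if the reflections `σ_s = id − α_s ⊗ b_s` in the facets of the polyhedral cone
`P̃ = {α_s ≤ 0}` generate a group whose nontrivial elements move the interior of `P̃` off
itself, then the Cartan matrix `A_{st} = α_s(b_t)` satisfies (V1) and (V2). -/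
theorem vinberg_necessity {d : ℕ} {S : Type*} [Fintype S]
    (α : S → Module.Dual ℝ (Fin (d + 1) → ℝ)) (b : S → (Fin (d + 1) → ℝ))
    (hα : ∀ s, α s ≠ 0) (hab : ∀ s, α s (b s) = 2)
    (σ : S → ((Fin (d + 1) → ℝ) →ₗ[ℝ] (Fin (d + 1) → ℝ)))
    (hσ : ∀ s, σ s = LinearMap.id - (α s).smulRight (b s))
    (P : Set (Fin (d + 1) → ℝ)) (hP : P = {v | ∀ s, α s v ≤ 0})
    (hint : (interior P).Nonempty)
    (hfacet : ∀ s, ∃ v, α s v = 0 ∧ ∀ t, t ≠ s → α t v < 0)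
    (htile : ∀ γ ∈ Submonoid.closure (Set.range σ), γ ≠ LinearMap.id →
      Disjoint (⇑γ '' interior P) (interior P)) :
    (∀ s t, s ≠ t → α s (b t) ≤ 0 ∧ (α s (b t) = 0 ↔ α t (b s) = 0)) ∧
    (∀ s t, s ≠ t →
      4 ≤ α s (b t) * α t (b s) ∨
      ∃ m : ℕ, 2 ≤ m ∧ α s (b t) * α t (b s) = 4 * Real.cos (π / m) ^ 2) := by
  have hG (s : S) : LinearMap.id - (α s).smulRight (b s) ∈ Submonoid.closure (Set.range σ) :=
    Submonoid.subset_closure ⟨s, hσ s⟩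
  have hopen : {v | ∀ s, α s v < 0} ⊆ interior P := by
    refine interior_maximal (fun v hv => hP ▸ fun s => (hv s).le) ?_
    rw [Set.ofPred_forall]
    exact isOpen_iInter_of_finite fun s =>
      isOpen_lt (α s).continuous_of_finiteDimensional continuous_const
  have hsign (s t : S) (hst : s ≠ t) (p q : ℝ)
      (h : IsReflectionForm (Submonoid.closure (Set.range σ)) (p • α s + q • α t)) :
      0 ≤ p * q := by
    by_contra! hpq
    obtain ⟨v, hv, hv'⟩ := hfacet s
    obtain ⟨w, hw, hw'⟩ := hfacet t
    have hvt := hv' t hst.symm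
    have hws := hw' s hst
    have hp : 0 < |p| := abs_pos.2 (by rintro rfl; simp at hpq)
    have hq : 0 < |q| := abs_pos.2 (by rintro rfl; simp at hpq)
    have hx : 0 < |p| * -α s w := mul_pos hp (by linarith)
    have hy : 0 < |q| * -α t v := mul_pos hq (by linarith)
    refine h.ne_zero_of_mem (w := (|p| * -α s w) • v + (|q| * -α t v) • w) htile
      (hopen fun r => ?_) ?_
    · simp only [map_add, map_smul, smul_eq_mul]
      by_cases hrs : r = s
      · subst hrs
        rw [hv, mul_zero, zero_add]
        exact mul_neg_of_pos_of_neg hy hws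
      · have h1 := mul_neg_of_pos_of_neg hx (hv' r hrs)
        by_cases hrt : r = t
        · subst hrt
          rwa [hw, mul_zero, add_zero]
        · exact add_neg h1 (mul_neg_of_pos_of_neg hy (hw' r hrt))
    · simp only [map_add, map_smul, smul_eq_mul, LinearMap.add_apply, LinearMap.smul_apply, hv, hw]
      rcases mul_neg_iff.1 hpq with ⟨h1, h2⟩ | ⟨h1, h2⟩
      · rw [abs_of_pos h1, abs_of_neg h2]; ring
      · rw [abs_of_neg h1, abs_of_pos h2]; ring
  have hnonpos (s t : S) (hst : s ≠ t) : α s (b t) ≤ 0 :=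
    cartan_entry_nonpos (hab t) ⟨b s, hab s, hG s⟩ (hG t) (hsign s t hst)
  have hzero (s t : S) (hst : s ≠ t) : α t (b s) = 0 → α s (b t) = 0 :=
    cartan_entry_eq_zero (hab s) (hab t) (hG s) (hG t) (hsign s t hst)
  refine ⟨fun s t hst => ⟨hnonpos s t hst, hzero t s hst.symm, hzero s t hst⟩,
    fun s t hst => ?_⟩
  rcases (hnonpos s t hst).eq_or_lt with h | h
  · exact Or.inr ⟨2, le_rfl, by simp [h]⟩
  · refine (le_or_gt 4 _).imp_right fun hlt => ?_
    refine cartan_product (hab s) (hab t) (hG s) (hG t) (hsign s t hst) h ?_ hlt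
    exact lt_of_le_of_ne (hnonpos t s hst.symm) fun h0 => h.ne (hzero s t hst h0)
end

section
/- Let V = ℝ^{d+1}, let S be a finite set, and for each s ∈ S let α_s ∈ V* be nonzero and b_s ∈ V satisfy α_s(b_s) = 2; let σ_s(x) = x − α_s(x)·b_s and let P̃ = {v ∈ V : α_s(v) ≤ 0 for all s ∈ S}. Assume P̃ has nonempty interior, that for each s ∈ S there exists v with α_s(v) = 0 and α_t(v) < 0 for all t ≠ s, and that the Cartan matrix A_{st} = α_s(b_t) satisfies Vinberg's conditions (V1) and (V2). Let M be the Coxeter matrix defined by M_{ss} = 1, M_{st} = m when A_{st}·A_{ts} = 4·cos²(π/m) < 4 with m ≥ 2 an integer, and M_{st} = ∞ when A_{st}·A_{ts} ≥ 4, and let W be the associated Coxeter group. Then there is a unique group homomorphism σ : W → GL(V) with σ(s) = σ_s for every s ∈ S; this homomorphism is injective, and its image Γ (the subgroup generated by the σ_s) is a discrete subgroup of GL(V). -/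
open Matrix Real

noncomputable section

/-- The reflection matrix `σ_s = Id − b_s ⊗ a_s`, acting by `x ↦ x − (a_s ⬝ x) b_s`. -/
def reflMat {d : ℕ} (a b : Fin (d + 1) → ℝ) : Matrix (Fin (d + 1)) (Fin (d + 1)) ℝ :=
  1 - Matrix.vecMulVec b a

theorem reflMat_mulVec {d : ℕ} (a b x : Fin (d + 1) → ℝ) :
    reflMat a b *ᵥ x = x - (a ⬝ᵥ x) • b := by
  simp [reflMat, Matrix.sub_mulVec, Matrix.vecMulVec_mulVec]

theorem reflMat_eq_toMatrixAlgEquiv'_reflection {d : ℕ} {a b : Fin (d + 1) → ℝ}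
    (h : dotProductEquiv ℝ (Fin (d + 1)) a b = 2) :
    reflMat a b = LinearMap.toMatrixAlgEquiv' (Module.reflection h).toLinearMap := by
  apply Matrix.toLinAlgEquiv'.injective
  refine LinearMap.ext fun x => ?_
  rw [Matrix.toLinAlgEquiv'_toMatrixAlgEquiv', Matrix.toLinAlgEquiv'_apply, reflMat_mulVec]
  simp [Module.reflection_apply]

theorem dotProduct_reflMat_mulVec {d : ℕ} (c a b x : Fin (d + 1) → ℝ) :
    c ⬝ᵥ (reflMat a b *ᵥ x) = c ⬝ᵥ x - (c ⬝ᵥ b) * (a ⬝ᵥ x) := by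
  rw [reflMat_mulVec, dotProduct_sub, dotProduct_smul, smul_eq_mul, mul_comm]

theorem reflMat_mul_self {d : ℕ} {a b : Fin (d + 1) → ℝ} (hab : a ⬝ᵥ b = 2) :
    reflMat a b * reflMat a b = 1 := by
  apply Matrix.ext_of_mulVec_single
  intro i
  rw [← Matrix.mulVec_mulVec, reflMat_mulVec, reflMat_mulVec, dotProduct_sub, dotProduct_smul, hab,
    Matrix.one_mulVec, smul_eq_mul]
  module

/-- Two reflections whose Cartan numbers have product `4 cos² (π / m)` have a product of order
dividing `m`. -/
theorem reflection_mul_reflection_pow_eq_one {V : Type*} [AddCommGroup V] [Module ℝ V]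
    {f g : Module.Dual ℝ V} {x y : V} (hf : f x = 2) (hg : g y = 2)
    (h0 : f y = 0 ↔ g x = 0) {m : ℕ} (hm : 2 ≤ m) (h : f y * g x = 4 * cos (π / m) ^ 2) :
    (Module.reflection hf * Module.reflection hg) ^ m = 1 := by
  ext1 z
  rw [Module.reflection_mul_reflection_pow_apply hf hg m z _ rfl]
  obtain rfl | hm3 := hm.eq_or_lt
  · have hfy : f y = 0 := by
      have : f y * g x = 0 := by simpa using h
      rcases mul_eq_zero.1 this with h | h
      · exact h
      · exact h0.2 h
    have hgx := h0.1 hfy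
    norm_num [hfy, hgx]
    module
  · have hm0 : (0 : ℝ) < m := by positivity
    set θ : ℝ := 2 * π / m with hθ
    have ht : f y * g x - 2 = 2 * cos θ := by
      rw [h, hθ, mul_div_assoc, cos_two_mul]; ring
    have hsin : sin θ ≠ 0 := by
      refine (sin_pos_of_pos_of_lt_pi (by positivity) ?_).ne'
      rw [hθ, div_lt_iff₀ hm0, mul_comm]
      have : (2 : ℝ) < m := by exact_mod_cast hm3
      gcongr
    have hS := fun n : ℤ => Polynomial.Chebyshev.S_two_mul_real_cos θ n
    rw [ht]
    rcases Nat.even_or_odd' m with ⟨k, hk | hk⟩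
    · have e1 : ((m : ℤ) - 2) / 2 = k - 1 := by omega
      have e2 : ((m : ℤ) - 1) / 2 = k - 1 := by omega
      have hz : (Polynomial.Chebyshev.S ℝ ((k : ℤ) - 1)).eval (2 * cos θ) = 0 := by
        apply (mul_eq_zero_iff_right hsin).1
        rw [hS]
        have : ((((k : ℤ) - 1 : ℤ) : ℝ) + 1) * θ = π := by
          rw [hθ]; push_cast; rw [hk]; push_cast
          have : (k : ℝ) ≠ 0 := by rintro h; simp [hk, h] at hm0
          field_simp
          ring
        rw [this, sin_pi]
      rw [e1, e2, hz]
      simp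
    · have e1 : ((m : ℤ) - 2) / 2 = k - 1 := by omega
      have e2 : ((m : ℤ) - 1) / 2 = k := by omega
      have e3 : ((m : ℤ) - 3) / 2 = k - 1 := by omega
      have e4 : (m : ℤ) / 2 = k := by omega
      have hz : (Polynomial.Chebyshev.S ℝ (k : ℤ)).eval (2 * cos θ) +
          (Polynomial.Chebyshev.S ℝ ((k : ℤ) - 1)).eval (2 * cos θ) = 0 := by
        apply (mul_eq_zero_iff_right hsin).1
        rw [add_mul, hS, hS]
        have : (((k : ℤ) : ℝ) + 1) * θ = 2 * π - ((((k : ℤ) - 1 : ℤ) : ℝ) + 1) * θ := by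
          rw [hθ]; push_cast; rw [hk]; push_cast
          field_simp
          ring
        rw [this, sin_two_pi_sub, neg_add_cancel]
      rw [e1, e2, e3, e4, hz]
      simp

theorem reflMat_mul_reflMat_pow_eq_one {d : ℕ} {a b a' b' : Fin (d + 1) → ℝ}
    (hab : a ⬝ᵥ b = 2) (hab' : a' ⬝ᵥ b' = 2) (h0 : a ⬝ᵥ b' = 0 ↔ a' ⬝ᵥ b = 0) {m : ℕ}
    (hm : 2 ≤ m) (h : (a ⬝ᵥ b') * (a' ⬝ᵥ b) = 4 * cos (π / m) ^ 2) :
    (reflMat a b * reflMat a' b') ^ m = 1 := by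
  have hf : dotProductEquiv ℝ (Fin (d + 1)) a b = 2 := by simpa using hab
  have hg : dotProductEquiv ℝ (Fin (d + 1)) a' b' = 2 := by simpa using hab'
  have key := reflection_mul_reflection_pow_eq_one hf hg (by simpa using h0) hm (by simpa using h)
  rw [reflMat_eq_toMatrixAlgEquiv'_reflection hf, reflMat_eq_toMatrixAlgEquiv'_reflection hg,
    ← map_mul, ← map_pow]
  have hone := congrArg
    (LinearEquiv.automorphismGroup.toLinearMapMonoidHom (R := ℝ) (M := Fin (d + 1) → ℝ)) key
  rw [map_pow, map_mul, map_one] at hone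
  exact (congrArg LinearMap.toMatrixAlgEquiv' hone).trans (map_one _)

/-- The coefficients of the roots of a dihedral reflection group, for off-diagonal Cartan numbers
`-α` and `-β`. -/
def dihedralCoeff (α β : ℝ) : ℕ → ℝ
  | 0 => 0
  | 1 => 1
  | n + 2 => (if Even n then α else β) * dihedralCoeff α β (n + 1) - dihedralCoeff α β n

theorem dihedralCoeff_pos_of_four_le {α β : ℝ} (hα : 0 ≤ α) (hβ : 0 ≤ β) (h : 4 ≤ α * β) (n : ℕ) :
    0 < dihedralCoeff α β (n + 1) := by
  have hα' : 0 < α := hα.lt_of_ne (by rintro rfl; linarith)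
  have hβ' : 0 < β := hβ.lt_of_ne (by rintro rfl; linarith)
  suffices H : 0 < dihedralCoeff α β (n + 1) ∧
      2 * dihedralCoeff α β n ≤ (if Even n then α else β) * dihedralCoeff α β (n + 1) from H.1
  induction n with
  | zero => simp [dihedralCoeff, hα]
  | succ n ih =>
    obtain ⟨h1, h2⟩ := ih
    rw [dihedralCoeff]
    by_cases hn : Even n
    · simp only [hn, if_true, Nat.even_add_one, not_true, if_false] at h2 ⊢
      have := mul_pos hα' h1
      refine ⟨by linarith, ?_⟩
      nlinarith
    · simp only [hn, if_true, Nat.even_add_one, not_false_eq_true, if_false] at h2 ⊢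
      have := mul_pos hβ' h1
      refine ⟨by linarith, ?_⟩
      nlinarith

theorem dihedralCoeff_mul_sin {α β θ : ℝ} (h : α * β = 4 * cos θ ^ 2) (hθ : cos θ ≠ 0) (n : ℕ) :
    dihedralCoeff α β (2 * n) * sin θ * (2 * cos θ) = α * sin ((2 * n : ℕ) * θ) ∧
      dihedralCoeff α β (2 * n + 1) * sin θ = sin ((2 * n + 1 : ℕ) * θ) := by
  have hrec : ∀ x : ℝ, sin (x + 2 * θ) = 2 * cos θ * sin (x + θ) - sin x := by
    intro x
    rw [sin_add, sin_add, sin_two_mul, cos_two_mul]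
    ring
  induction n with
  | zero => simp [dihedralCoeff]
  | succ n ih =>
    obtain ⟨h1, h2⟩ := ih
    have e0 := hrec ((2 * n : ℕ) * θ)
    have e1 := hrec ((2 * n + 1 : ℕ) * θ)
    have c0 : ((2 * n : ℕ) : ℝ) * θ + θ = (2 * n + 1 : ℕ) * θ := by push_cast; ring
    have c1 : ((2 * n : ℕ) : ℝ) * θ + 2 * θ = (2 * (n + 1) : ℕ) * θ := by push_cast; ring
    have c2 : ((2 * n + 1 : ℕ) : ℝ) * θ + θ = (2 * (n + 1) : ℕ) * θ := by push_cast; ring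
    have c3 : ((2 * n + 1 : ℕ) : ℝ) * θ + 2 * θ = (2 * (n + 1) + 1 : ℕ) * θ := by push_cast; ring
    rw [c0, c1] at e0
    rw [c2, c3] at e1
    have d0 : dihedralCoeff α β (2 * (n + 1)) =
        α * dihedralCoeff α β (2 * n + 1) - dihedralCoeff α β (2 * n) := by
      rw [show 2 * (n + 1) = 2 * n + 2 by ring, dihedralCoeff]; simp
    have d1 : dihedralCoeff α β (2 * (n + 1) + 1) =
        β * dihedralCoeff α β (2 * (n + 1)) - dihedralCoeff α β (2 * n + 1) := by
      rw [show 2 * (n + 1) + 1 = (2 * n + 1) + 2 by ring, dihedralCoeff]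
      simp [mul_add]
    have A : dihedralCoeff α β (2 * (n + 1)) * sin θ * (2 * cos θ) =
        α * sin ((2 * (n + 1) : ℕ) * θ) := by
      rw [d0, e0]
      linear_combination 2 * cos θ * α * h2 - h1
    refine ⟨A, ?_⟩
    rw [d1, e1]
    have hc : 2 * cos θ ≠ 0 := by simpa using hθ
    apply mul_right_cancel₀ hc
    linear_combination β * A - 2 * cos θ * h2 + sin ((2 * (n + 1) : ℕ) * θ) * h

theorem dihedralCoeff_nonneg_of_eq_cos {α β : ℝ} (hα : 0 ≤ α) {m : ℕ} (hm : 2 ≤ m)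
    (h0 : α = 0 ↔ β = 0) (h : α * β = 4 * cos (π / m) ^ 2) {n : ℕ} (hn : n ≤ m) :
    0 ≤ dihedralCoeff α β n ∧ (0 < n → n < m → 0 < dihedralCoeff α β n) := by
  obtain rfl | hm3 := hm.eq_or_lt
  · have : α * β = 0 := by simpa using h
    have hα0 : α = 0 := by
      rcases mul_eq_zero.1 this with h | h
      · exact h
      · exact h0.2 h
    interval_cases n <;> simp [dihedralCoeff, hα0]
  · have hm0 : (0 : ℝ) < m := by positivity
    have hθ0 : 0 < π / m := by positivity
    have hm3' : (2 : ℝ) < m := by exact_mod_cast hm3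
    have hθ1 : π / m < π / 2 := by gcongr
    have hcos : 0 < cos (π / m) := cos_pos_of_mem_Ioo ⟨by linarith, hθ1⟩
    have hsin : 0 < sin (π / m) := sin_pos_of_pos_of_lt_pi hθ0 (by linarith [pi_pos])
    have hα' : 0 < α := hα.lt_of_ne (by
      rintro rfl
      have : 0 < cos (π / m) ^ 2 := by positivity
      linarith)
    have hle : n * (π / m) ≤ π := by
      rw [mul_div_assoc', div_le_iff₀ hm0, mul_comm]
      have : (n : ℝ) ≤ m := by exact_mod_cast hn
      gcongr
    have hlt : n < m → n * (π / m) < π := by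
      intro hn
      rw [mul_div_assoc', div_lt_iff₀ hm0, mul_comm]
      have : (n : ℝ) < m := by exact_mod_cast hn
      gcongr
    have hnn : 0 ≤ sin (n * (π / m)) := sin_nonneg_of_nonneg_of_le_pi (by positivity) hle
    have hpos : 0 < n → n < m → 0 < sin (n * (π / m)) := fun h1 h2 =>
      sin_pos_of_pos_of_lt_pi (by positivity) (hlt h2)
    rcases Nat.even_or_odd' n with ⟨k, rfl | rfl⟩
    · have hk := (dihedralCoeff_mul_sin h hcos.ne' k).1
      have hk' : dihedralCoeff α β (2 * k) =
          α * sin ((2 * k : ℕ) * (π / m)) / (sin (π / m) * (2 * cos (π / m))) := by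
        rw [← hk]; field_simp
      rw [hk']
      refine ⟨by positivity, fun h1 h2 => ?_⟩
      have := hpos h1 h2
      positivity
    · have hk := (dihedralCoeff_mul_sin h hcos.ne' k).2
      have hk' : dihedralCoeff α β (2 * k + 1) =
          sin ((2 * k + 1 : ℕ) * (π / m)) / sin (π / m) := by
        rw [← hk]; field_simp
      rw [hk']
      refine ⟨by positivity, fun h1 h2 => ?_⟩
      have := hpos h1 h2
      positivity

section Representation

variable {d : ℕ} {S : Type*} {a b : S → Fin (d + 1) → ℝ} {M : CoxeterMatrix S}
  {φ : M.Group →* GL (Fin (d + 1)) ℝ}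

theorem dotProduct_rep_simple
    (hφ : ∀ s, (φ (M.toCoxeterSystem.simple s) : Matrix (Fin (d + 1)) (Fin (d + 1)) ℝ) =
      reflMat (a s) (b s)) (c : Fin (d + 1) → ℝ) (s : S) (x : Fin (d + 1) → ℝ) :
    c ⬝ᵥ ((φ (M.toCoxeterSystem.simple s)).val *ᵥ x) = c ⬝ᵥ x - (c ⬝ᵥ b s) * (a s ⬝ᵥ x) := by
  rw [hφ, dotProduct_reflMat_mulVec]

/-- The root obtained by applying an alternating word in `s` and `t` to the simple root of `s`. -/
theorem dotProduct_rep_alternatingWord (hab : ∀ s, a s ⬝ᵥ b s = 2)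
    (hφ : ∀ s, (φ (M.toCoxeterSystem.simple s) : Matrix (Fin (d + 1)) (Fin (d + 1)) ℝ) =
      reflMat (a s) (b s)) (s t : S) (k : ℕ) (x : Fin (d + 1) → ℝ) :
    a s ⬝ᵥ ((φ (M.toCoxeterSystem.wordProd (CoxeterSystem.alternatingWord s t k))⁻¹).val *ᵥ x) =
      dihedralCoeff (-(a s ⬝ᵥ b t)) (-(a t ⬝ᵥ b s)) (if Even k then k + 1 else k) * (a s ⬝ᵥ x) +
      dihedralCoeff (-(a s ⬝ᵥ b t)) (-(a t ⬝ᵥ b s)) (if Even k then k else k + 1) *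
        (a t ⬝ᵥ x) := by
  induction k generalizing x with
  | zero => simp [CoxeterSystem.alternatingWord, dihedralCoeff]
  | succ k ih =>
    rw [CoxeterSystem.alternatingWord_succ', CoxeterSystem.wordProd_cons, _root_.mul_inv_rev,
      CoxeterSystem.inv_simple, map_mul, Units.val_mul, ← Matrix.mulVec_mulVec, ih,
      dotProduct_rep_simple hφ, dotProduct_rep_simple hφ]
    by_cases hk : Even k
    · simp only [hk, if_true, Nat.even_add_one, not_true, if_false, dihedralCoeff, hab]
      ring
    · simp only [hk, if_true, Nat.even_add_one, not_false_eq_true, if_false, dihedralCoeff, hab]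
      ring

/-- The chamber of the simple roots stays on the positive side of a simple wall `s` under `w⁻¹`,
as soon as `s` is not a right descent of `w`. -/
theorem dotProduct_rep_inv_neg (hab : ∀ s, a s ⬝ᵥ b s = 2)
    (hV1 : ∀ s t, s ≠ t → a s ⬝ᵥ b t ≤ 0 ∧ (a s ⬝ᵥ b t = 0 ↔ a t ⬝ᵥ b s = 0))
    (hM : ∀ s t, s ≠ t →
      (M s t = 0 ∧ 4 ≤ (a s ⬝ᵥ b t) * (a t ⬝ᵥ b s)) ∨
      (2 ≤ M s t ∧ (a s ⬝ᵥ b t) * (a t ⬝ᵥ b s) = 4 * Real.cos (π / M s t) ^ 2))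
    (hφ : ∀ s, (φ (M.toCoxeterSystem.simple s) : Matrix (Fin (d + 1)) (Fin (d + 1)) ℝ) =
      reflMat (a s) (b s)) {x : Fin (d + 1) → ℝ} (hx : ∀ s, a s ⬝ᵥ x < 0) {w : M.Group} {s : S}
    (hw : ¬ M.toCoxeterSystem.IsRightDescent w s) :
    a s ⬝ᵥ ((φ w⁻¹).val *ᵥ x) < 0 := by
  induction hn : M.toCoxeterSystem.length w using Nat.strong_induction_on generalizing w s with
  | _ n ih =>
  set cs := M.toCoxeterSystem
  by_cases hw1 : w = 1
  · simpa [hw1] using hx s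
  obtain ⟨t, ht⟩ := cs.exists_rightDescent_of_ne_one hw1
  have hst : s ≠ t := by rintro rfl; exact hw ht
  -- the longest alternating suffix in `s`, `t` of a reduced word for `w`
  let Q : ℕ → Prop := fun k => ∃ v, w = v * cs.wordProd (CoxeterSystem.alternatingWord s t k) ∧
    cs.length w = cs.length v + k
  have hQ1 : Q 1 := by
    refine ⟨w * cs.simple t, ?_, ?_⟩
    · simp [CoxeterSystem.alternatingWord]
    · exact (cs.isRightDescent_iff.1 ht).symm
  classical
  have hQle : ∀ k, Q k → k ≤ n := by rintro k ⟨v, -, hv⟩; omega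
  have h1n : 1 ≤ n := hQle 1 hQ1
  obtain ⟨v, hwv, hlen⟩ : Q (Nat.findGreatest Q n) := Nat.findGreatest_spec h1n hQ1
  have hk1 : 1 ≤ Nat.findGreatest Q n := Nat.le_findGreatest h1n hQ1
  have hmax : ¬ Q (Nat.findGreatest Q n + 1) := fun h =>
    absurd (Nat.le_findGreatest (hQle _ h) h) (by omega)
  set k := Nat.findGreatest Q n
  clear_value k
  -- neither `s` nor `t` is a right descent of `v`
  have hfirst : ¬ cs.IsRightDescent v (if Even k then t else s) := by
    intro h
    apply hmax
    refine ⟨v * cs.simple (if Even k then t else s), ?_, ?_⟩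
    · rw [CoxeterSystem.alternatingWord_succ', cs.wordProd_cons, ← mul_assoc,
        cs.simple_mul_simple_cancel_right, ← hwv]
    · have := cs.isRightDescent_iff.1 h
      omega
  have hsecond : ¬ cs.IsRightDescent v (if Even k then s else t) := by
    intro h
    obtain ⟨j, rfl⟩ : ∃ j, k = j + 1 := ⟨k - 1, by omega⟩
    have hd := cs.isRightDescent_iff.1 h
    have hwv' : w = v * cs.simple (if Even (j + 1) then s else t) *
        cs.wordProd (CoxeterSystem.alternatingWord s t j) := by
      rw [hwv, CoxeterSystem.alternatingWord_succ', cs.wordProd_cons, ← mul_assoc]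
      by_cases hj : Even j <;> simp [hj, Nat.even_add_one]
    have h1 := cs.length_mul_le (v * cs.simple (if Even (j + 1) then s else t))
      (cs.wordProd (CoxeterSystem.alternatingWord s t j))
    have h2 := cs.length_wordProd_le (CoxeterSystem.alternatingWord s t j)
    rw [CoxeterSystem.length_alternatingWord] at h2
    rw [← hwv'] at h1
    omega
  have hvs : ¬ cs.IsRightDescent v s := by
    by_cases h : Even k
    · simpa [h] using hsecond
    · simpa [h] using hfirst
  have hvt : ¬ cs.IsRightDescent v t := by
    by_cases h : Even k
    · simpa [h] using hfirst
    · simpa [h] using hsecond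
  have hps := ih _ (by omega) hvs rfl
  have hpt := ih _ (by omega) hvt rfl
  have hkm : M t s ≠ 0 → k + 1 ≤ M t s := by
    intro hM0
    by_contra hlt
    apply cs.not_isReduced_alternatingWord t s hM0 (m := k + 1) (by omega)
    have h3 := cs.not_isRightDescent_iff.1 hw
    have h4 : w * cs.simple s = v * cs.wordProd (CoxeterSystem.alternatingWord t s (k + 1)) := by
      rw [CoxeterSystem.alternatingWord_succ, cs.wordProd_concat, ← mul_assoc, ← hwv]
    have h5 := cs.length_mul_le v (cs.wordProd (CoxeterSystem.alternatingWord t s (k + 1)))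
    have h6 := cs.length_wordProd_le (CoxeterSystem.alternatingWord t s (k + 1))
    rw [← h4] at h5
    rw [CoxeterSystem.length_alternatingWord] at h6
    rw [CoxeterSystem.IsReduced, CoxeterSystem.length_alternatingWord]
    omega
  have hcoeff : 0 < dihedralCoeff (-(a s ⬝ᵥ b t)) (-(a t ⬝ᵥ b s)) k ∧
      0 ≤ dihedralCoeff (-(a s ⬝ᵥ b t)) (-(a t ⬝ᵥ b s)) (k + 1) := by
    have hα : 0 ≤ -(a s ⬝ᵥ b t) := neg_nonneg.2 (hV1 s t hst).1
    have hβ : 0 ≤ -(a t ⬝ᵥ b s) := neg_nonneg.2 (hV1 t s hst.symm).1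
    rcases hM s t hst with ⟨-, h4⟩ | ⟨h2, hc⟩
    · obtain ⟨j, rfl⟩ : ∃ j, k = j + 1 := ⟨k - 1, by omega⟩
      have h4' : 4 ≤ -(a s ⬝ᵥ b t) * -(a t ⬝ᵥ b s) := by rwa [neg_mul_neg]
      exact ⟨dihedralCoeff_pos_of_four_le hα hβ h4' _,
        (dihedralCoeff_pos_of_four_le hα hβ h4' _).le⟩
    · have hkm' := hkm (by rw [M.symmetric]; omega)
      rw [M.symmetric] at hkm'
      have hc' : -(a s ⬝ᵥ b t) * -(a t ⬝ᵥ b s) = 4 * Real.cos (π / M s t) ^ 2 := by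
        rwa [neg_mul_neg]
      have h0 : -(a s ⬝ᵥ b t) = 0 ↔ -(a t ⬝ᵥ b s) = 0 := by simpa using (hV1 s t hst).2
      exact ⟨(dihedralCoeff_nonneg_of_eq_cos hα h2 h0 hc' (by omega)).2 (by omega) (by omega),
        (dihedralCoeff_nonneg_of_eq_cos hα h2 h0 hc' hkm').1⟩
  rw [hwv, _root_.mul_inv_rev, map_mul, Units.val_mul, ← Matrix.mulVec_mulVec,
    dotProduct_rep_alternatingWord hab hφ]
  obtain ⟨hc1, hc2⟩ := hcoeff
  by_cases h : Even k
  · simp only [h, if_true]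
    nlinarith
  · simp only [h, if_false]
    nlinarith

/-- Only the identity maps a point of the open chamber into the open chamber. -/
theorem eq_one_of_rep_inv_mem_chamber (hab : ∀ s, a s ⬝ᵥ b s = 2)
    (hV1 : ∀ s t, s ≠ t → a s ⬝ᵥ b t ≤ 0 ∧ (a s ⬝ᵥ b t = 0 ↔ a t ⬝ᵥ b s = 0))
    (hM : ∀ s t, s ≠ t →
      (M s t = 0 ∧ 4 ≤ (a s ⬝ᵥ b t) * (a t ⬝ᵥ b s)) ∨
      (2 ≤ M s t ∧ (a s ⬝ᵥ b t) * (a t ⬝ᵥ b s) = 4 * Real.cos (π / M s t) ^ 2))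
    (hφ : ∀ s, (φ (M.toCoxeterSystem.simple s) : Matrix (Fin (d + 1)) (Fin (d + 1)) ℝ) =
      reflMat (a s) (b s)) {x : Fin (d + 1) → ℝ} (hx : ∀ s, a s ⬝ᵥ x < 0) {w : M.Group}
    (hwx : ∀ s, a s ⬝ᵥ ((φ w⁻¹).val *ᵥ x) < 0) : w = 1 := by
  by_contra hw1
  obtain ⟨s, hs⟩ := M.toCoxeterSystem.exists_rightDescent_of_ne_one hw1
  have h := dotProduct_rep_inv_neg hab hV1 hM hφ hx
    (M.toCoxeterSystem.isRightDescent_iff_not_isRightDescent_mul.1 hs)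
  rw [_root_.mul_inv_rev, CoxeterSystem.inv_simple, map_mul, Units.val_mul, ← Matrix.mulVec_mulVec,
    dotProduct_rep_simple hφ, hab] at h
  linarith [hwx s]

end Representation

theorem exists_dotProduct_neg_of_interior_nonempty {ι S : Type*} [Fintype ι] {a : S → ι → ℝ}
    (ha : ∀ s, a s ≠ 0) (h : (interior {v | ∀ s, a s ⬝ᵥ v ≤ 0}).Nonempty) :
    ∃ x, ∀ s, a s ⬝ᵥ x < 0 := by
  obtain ⟨x, hx⟩ := h
  refine ⟨x, fun s => ?_⟩
  have hline : Filter.Tendsto (fun ε : ℝ => x + ε • a s) (nhdsWithin 0 (Set.Ioi 0)) (nhds x) := by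
    have : Continuous fun ε : ℝ => x + ε • a s := by fun_prop
    simpa using (this.tendsto 0).mono_left nhdsWithin_le_nhds
  have hev := hline.eventually (isOpen_interior.mem_nhds hx)
  obtain ⟨ε, hε, hε0⟩ := (hev.and self_mem_nhdsWithin).exists
  have h1 := interior_subset hε s
  rw [dotProduct_add, dotProduct_smul, smul_eq_mul] at h1
  have h2 : 0 < a s ⬝ᵥ a s := by
    refine (Finset.sum_nonneg fun i _ => mul_self_nonneg (a s i)).lt_of_ne' ?_
    exact fun h => ha s (dotProduct_self_eq_zero.1 h)
  have h3 := mul_pos (Set.mem_Ioi.1 hε0) h2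
  linarith

/-- Tits–Vinberg theorem (first two items): given data satisfying Vinberg's conditions
(V1), (V2), with Coxeter matrix `M` read off from the Cartan matrix `A_{st} = α_s(b_t)`,
there is a unique homomorphism `σ : W → GL_{d+1}(ℝ)` sending the simple generators to the
reflections `σ_s`; it is injective with discrete image. -/
theorem tits_vinberg {d : ℕ} {S : Type*} [Fintype S]
    (a : S → (Fin (d + 1) → ℝ)) (b : S → (Fin (d + 1) → ℝ))
    (ha : ∀ s, a s ≠ 0) (hab : ∀ s, a s ⬝ᵥ b s = 2)
    (P : Set (Fin (d + 1) → ℝ)) (hP : P = {v | ∀ s, a s ⬝ᵥ v ≤ 0})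
    (hint : (interior P).Nonempty)
    (hfacet : ∀ s, ∃ v, a s ⬝ᵥ v = 0 ∧ ∀ t, t ≠ s → a t ⬝ᵥ v < 0)
    (hV1 : ∀ s t, s ≠ t → a s ⬝ᵥ b t ≤ 0 ∧ (a s ⬝ᵥ b t = 0 ↔ a t ⬝ᵥ b s = 0))
    (M : CoxeterMatrix S)
    (hM : ∀ s t, s ≠ t →
      (M s t = 0 ∧ 4 ≤ (a s ⬝ᵥ b t) * (a t ⬝ᵥ b s)) ∨
      (2 ≤ M s t ∧ (a s ⬝ᵥ b t) * (a t ⬝ᵥ b s) = 4 * Real.cos (π / M s t) ^ 2)) :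
    (∃! φ : M.Group →* GL (Fin (d + 1)) ℝ,
      ∀ s : S, (φ (M.simple s) : Matrix (Fin (d + 1)) (Fin (d + 1)) ℝ) = reflMat (a s) (b s)) ∧
    ∀ φ : M.Group →* GL (Fin (d + 1)) ℝ,
      (∀ s : S, (φ (M.simple s) : Matrix (Fin (d + 1)) (Fin (d + 1)) ℝ) = reflMat (a s) (b s)) →
      Function.Injective φ ∧ DiscreteTopology (Set.range φ) := by
  subst hP
  obtain ⟨x, hx⟩ := exists_dotProduct_neg_of_interior_nonempty ha hint
  let r : S → GL (Fin (d + 1)) ℝ := fun s =>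
    ⟨reflMat (a s) (b s), reflMat (a s) (b s), reflMat_mul_self (hab s), reflMat_mul_self (hab s)⟩
  have hr : M.IsLiftable r := by
    intro s t
    apply Units.ext
    rw [Units.val_pow_eq_pow_val, Units.val_mul, Units.val_one]
    change (reflMat (a s) (b s) * reflMat (a t) (b t)) ^ M s t = 1
    by_cases hst : s = t
    · subst hst
      rw [M.diagonal, pow_one, reflMat_mul_self (hab s)]
    · rcases hM s t hst with ⟨h, -⟩ | ⟨h2, hc⟩
      · rw [h, pow_zero]
      · exact reflMat_mul_reflMat_pow_eq_one (hab s) (hab t) (hV1 s t hst).2 h2 hc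
  refine ⟨⟨M.toCoxeterSystem.lift ⟨r, hr⟩, fun s => ?_, fun ψ hψ => ?_⟩, fun φ hφ => ?_⟩
  · exact congrArg Units.val (M.toCoxeterSystem.lift_apply_simple hr s)
  · refine M.toCoxeterSystem.ext_simple fun s => Units.ext ?_
    rw [M.toCoxeterSystem.lift_apply_simple hr s]
    exact hψ s
  have key : ∀ w : M.Group, (∀ s, a s ⬝ᵥ ((φ w⁻¹).val *ᵥ x) < 0) → w = 1 := fun w =>
    eq_one_of_rep_inv_mem_chamber hab hV1 hM hφ hx
  refine ⟨(injective_iff_map_eq_one φ).2 fun w hw => key w fun s => ?_, ?_⟩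
  · simpa [map_inv, hw] using hx s
  change DiscreteTopology φ.range
  rw [discreteTopology_iff_isOpen_singleton_one]
  let U : Set φ.range := {γ | ∀ s, a s ⬝ᵥ ((γ⁻¹ : φ.range).val.val *ᵥ x) < 0}
  have hU : IsOpen U := by
    simp only [U, Set.ofPred_forall]
    refine isOpen_iInter_of_finite fun s => isOpen_lt ?_ continuous_const
    have : Continuous fun γ : φ.range => ((γ⁻¹ : φ.range).val.val) :=
      Units.continuous_val.comp (continuous_subtype_val.comp continuous_inv)
    exact continuous_const.dotProduct (this.matrix_mulVec continuous_const)
  convert hU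
  ext γ
  constructor
  · rintro rfl
    simpa [U] using hx
  · obtain ⟨_, w, rfl⟩ := γ
    intro h
    have hw : w = 1 := key w fun s => by simpa [U] using h s
    subst hw
    exact Subtype.ext (map_one φ)

end
end

section
/- Let V = ℝ^{d+1}, let S be a finite set, and for each s ∈ S let α_s ∈ V* be nonzero and b_s ∈ V satisfy α_s(b_s) = 2; let σ_s(x) = x − α_s(x)·b_s, let Γ ≤ GL(V) be the subgroup generated by {σ_s : s ∈ S}, and let P̃ = {v ∈ V : α_s(v) ≤ 0 for all s ∈ S}. Assume P̃ has nonempty interior, that for each s ∈ S there exists v with α_s(v) = 0 and α_t(v) < 0 for all t ≠ s, and that the Cartan matrix A_{st} = α_s(b_t) satisfies Vinberg's conditions (V1) and (V2). Then the union of tiles 𝒞 = ⋃_{γ ∈ Γ} γ(P̃) is a convex cone in V. -/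
open Real

/-- The sequence `0, 1, r, r² - 1, …` of rescaled Chebyshev polynomials of the second kind. -/
noncomputable def chebSeq (r : ℝ) : ℕ → ℝ
  | 0 => 0
  | 1 => 1
  | k + 2 => r * chebSeq r (k + 1) - chebSeq r k

theorem chebSeq_nonneg_of_two_le {r : ℝ} (hr : 2 ≤ r) (k : ℕ) : 0 ≤ chebSeq r k := by
  suffices h : 0 ≤ chebSeq r k ∧ chebSeq r k ≤ chebSeq r (k + 1) from h.1
  induction k with
  | zero => simp [chebSeq]
  | succ k ih =>
    refine ⟨ih.1.trans ih.2, ?_⟩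
    rw [chebSeq]
    nlinarith [ih.1, ih.2]

theorem sin_mul_chebSeq (θ : ℝ) (k : ℕ) :
    sin θ * chebSeq (2 * cos θ) k = sin (k * θ) := by
  induction k using Nat.twoStepInduction with
  | zero => simp [chebSeq]
  | one => simp [chebSeq]
  | more k h₀ h₁ =>
    rw [chebSeq]
    have e₁ : ((k + 2 : ℕ) : ℝ) * θ = ((k + 1 : ℕ) : ℝ) * θ + θ := by push_cast; ring
    have e₂ : (k : ℝ) * θ = ((k + 1 : ℕ) : ℝ) * θ - θ := by push_cast; ring
    rw [e₂, sin_sub] at h₀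
    rw [e₁, sin_add]
    linear_combination 2 * cos θ * h₁ - h₀

theorem sin_pi_div_pos {m : ℕ} (hm : 2 ≤ m) : 0 < sin (π / m) := by
  have hm' : (2 : ℝ) ≤ m := by exact_mod_cast hm
  refine sin_pos_of_pos_of_lt_pi (by positivity) ?_
  rw [div_lt_iff₀ (by positivity)]
  nlinarith [pi_pos]

theorem chebSeq_cos_pi_div_nonneg {m : ℕ} (hm : 2 ≤ m) {k : ℕ} (hk : k ≤ m) :
    0 ≤ chebSeq (2 * cos (π / m)) k := by
  have hm' : (0 : ℝ) < m := by exact_mod_cast (by omega : 0 < m)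
  refine nonneg_of_mul_nonneg_right ?_ (sin_pi_div_pos hm)
  rw [sin_mul_chebSeq]
  refine sin_nonneg_of_nonneg_of_le_pi (by positivity) ?_
  rw [mul_div_assoc', div_le_iff₀ hm', mul_comm]
  exact mul_le_mul_of_nonneg_left (by exact_mod_cast hk) pi_pos.le

theorem chebSeq_cos_pi_div_self {m : ℕ} (hm : 2 ≤ m) :
    chebSeq (2 * cos (π / m)) m = 0 := by
  have hm' : (m : ℝ) ≠ 0 := by exact_mod_cast (by omega : m ≠ 0)
  have h := sin_mul_chebSeq (π / m) m
  rw [mul_div_cancel₀ _ hm', sin_pi] at h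
  exact (mul_eq_zero.1 h).resolve_left (sin_pi_div_pos hm).ne'

/-- The alternating word `a, b, a, …` with `k` letters. -/
def altWord {S : Type*} : ℕ → S → S → List S
  | 0, _, _ => []
  | k + 1, a, b => a :: altWord k b a

section altWord

variable {S T : Type*}

theorem length_altWord (k : ℕ) (a b : S) : (altWord k a b).length = k := by
  induction k generalizing a b with
  | zero => rfl
  | succ k ih => simp [altWord, ih]

theorem map_altWord (f : S → T) (k : ℕ) (a b : S) :
    (altWord k a b).map f = altWord k (f a) (f b) := by
  induction k generalizing a b with
  | zero => rfl
  | succ k ih => simp [altWord, ih]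

theorem altWord_succ_eq_append (k : ℕ) (a b : S) :
    altWord (k + 1) a b = altWord k a b ++ [if Even k then a else b] := by
  induction k generalizing a b with
  | zero => simp [altWord]
  | succ k ih =>
    rw [altWord, ih b a, altWord, List.cons_append]
    by_cases hk : Even k <;> simp [Nat.even_add_one, hk]

theorem exists_altWord_add_eq_append (m n : ℕ) (a b : S) :
    ∃ l : List S, l.length = n ∧ altWord (m + n) a b = altWord m a b ++ l := by
  induction n with
  | zero => exact ⟨[], by simp⟩
  | succ n ih =>
    obtain ⟨l, hl, h⟩ := ih
    refine ⟨l ++ [if Even (m + n) then a else b], by simp [hl], ?_⟩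
    rw [← add_assoc, altWord_succ_eq_append, h, List.append_assoc]

end altWord

section Dihedral

variable {V : Type*} [AddCommGroup V] [Module ℝ V]

theorem apply_prod_altWord {r : ℝ} {f g : Module.Dual ℝ V} {a b : Module.End ℝ V}
    (hfa : ∀ v, f (a v) = -f v) (hgb : ∀ v, g (b v) = -g v)
    (hfb : ∀ v, f (b v) = f v + r * g v) (hga : ∀ v, g (a v) = g v + r * f v)
    (k : ℕ) (v : V) :
    f ((altWord k b a).prod v) =
      chebSeq r (k + 1) * (if Even k then f v else g v) +
        chebSeq r k * (if Even k then g v else f v) := by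
  induction k using Nat.twoStepInduction generalizing f g a b with
  | zero => simp [altWord, chebSeq]
  | one => simp [altWord, chebSeq, hfb]; ring
  | more k h₀ h₁ =>
    have e₁ := h₁ hgb hfa hga hfb
    have e₀ := h₀ hfa hgb hfb hga
    have : f ((altWord (k + 2) b a).prod v) =
        r * g ((altWord (k + 1) a b).prod v) - f ((altWord k b a).prod v) := by
      simp only [altWord, List.prod_cons, Module.End.mul_apply, hfb, hfa]
      ring
    rw [this, e₀, e₁, chebSeq, chebSeq]
    by_cases hk : Even k <;> simp [Nat.even_add_one, hk, chebSeq] <;> ring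

theorem exists_prod_altWord_apply_eq_add {x y : V} {a b : Module.End ℝ V}
    (ha : ∀ v, ∃ c : ℝ, a v = v + c • x) (hb : ∀ v, ∃ c : ℝ, b v = v + c • y)
    (k : ℕ) (v : V) : ∃ p q : ℝ, (altWord k a b).prod v = v + (p • x + q • y) := by
  induction k generalizing a b x y with
  | zero => exact ⟨0, 0, by simp [altWord]⟩
  | succ k ih =>
    obtain ⟨q, p, h⟩ := ih hb ha
    obtain ⟨c, hc⟩ := ha ((altWord k b a).prod v)
    refine ⟨p + c, q, ?_⟩
    rw [altWord, List.prod_cons, Module.End.mul_apply, hc, h]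
    module

/-- The weights make the restriction of the Cartan matrix to two indices symmetric. -/
theorem exists_symmetrizing_weight {p q r : ℝ} (hp : 0 ≤ p) (hr : 0 ≤ r)
    (hpq : p = 0 ↔ q = 0) (h : p * q = r ^ 2) : ∃ w : ℝ, 0 < w ∧ p = r * w ∧ q * w = r := by
  rcases hr.eq_or_lt with rfl | hr
  · have hp : p = 0 := by
      rcases mul_eq_zero.1 (h.trans (by norm_num)) with h | h
      exacts [h, hpq.2 h]
    exact ⟨1, one_pos, by simp [hp], by simp [hpq.1 hp]⟩
  · have hp' : 0 < p := hp.lt_of_ne' fun h₀ ↦ by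
      rw [h₀, zero_mul] at h
      exact (pow_pos hr 2).ne h
    refine ⟨p / r, by positivity, by field_simp, ?_⟩
    field_simp
    linarith

variable {f g : Module.Dual ℝ V} {x y : V} {a b : Module.End ℝ V}

theorem apply_prod_altWord_of_weight {r w : ℝ} (hfx : f x = 2) (hgy : g y = 2)
    (ha : ∀ v, a v = v - f v • x) (hb : ∀ v, b v = v - g v • y)
    (hp : -f y = r * w) (hq : -g x * w = r) (k : ℕ) (v : V) :
    f ((altWord k b a).prod v) =
      chebSeq r (k + 1) * (if Even k then f v else w * g v) +
        chebSeq r k * (if Even k then w * g v else f v) := by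
  refine apply_prod_altWord (g := w • g) ?_ ?_ ?_ ?_ k v <;> intro v
  · simp [ha, hfx]; ring
  · simp [hb, hgy]; ring
  · simp [hb]; linear_combination g v * hp
  · simp [ha]; linear_combination f v * hq

theorem apply_prod_altWord_comm {r w : ℝ} (hfx : f x = 2) (hgy : g y = 2)
    (ha : ∀ v, a v = v - f v • x) (hb : ∀ v, b v = v - g v • y)
    (hp : -f y = r * w) (hq : -g x * w = r) {n : ℕ} (hn : chebSeq r (n + 1) = 0) (v : V) :
    f ((altWord (n + 1) b a).prod v) = f ((altWord (n + 1) a b).prod v) := by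
  have h₁ : f ((altWord (n + 1) a b).prod v) = -f ((altWord n b a).prod v) := by
    simp [altWord, ha, hfx]; ring
  rw [h₁, apply_prod_altWord_of_weight hfx hgy ha hb hp hq,
    apply_prod_altWord_of_weight hfx hgy ha hb hp hq, chebSeq, hn]
  by_cases hk : Even n <;> simp [Nat.even_add_one, hk]

theorem prod_altWord_comm {r w : ℝ} (hw : 0 < w) (hfx : f x = 2) (hgy : g y = 2)
    (ha : ∀ v, a v = v - f v • x) (hb : ∀ v, b v = v - g v • y)
    (hp : -f y = r * w) (hq : -g x * w = r) (hr : r ^ 2 ≠ 4)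
    {n : ℕ} (hn : chebSeq r (n + 1) = 0) :
    (altWord (n + 1) b a).prod = (altWord (n + 1) a b).prod := by
  ext v
  have hf := apply_prod_altWord_comm hfx hgy ha hb hp hq hn v
  have hp' : -g x = r * w⁻¹ := by field_simp; linarith
  have hq' : -f y * w⁻¹ = r := by field_simp; linarith
  have hg := (apply_prod_altWord_comm hgy hfx hb ha hp' hq' hn v).symm
  have ha' : ∀ v, ∃ c : ℝ, a v = v + c • x := fun v ↦ ⟨-f v, by rw [ha]; module⟩
  have hb' : ∀ v, ∃ c : ℝ, b v = v + c • y := fun v ↦ ⟨-g v, by rw [hb]; module⟩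
  obtain ⟨q₁, p₁, h₁⟩ := exists_prod_altWord_apply_eq_add hb' ha' (n + 1) v
  obtain ⟨p₂, q₂, h₂⟩ := exists_prod_altWord_apply_eq_add ha' hb' (n + 1) v
  rw [h₁, h₂] at hf hg ⊢
  simp only [map_add, map_smul, smul_eq_mul, hfx, hgy] at hf hg
  have hdet : 4 - r ^ 2 ≠ 0 := sub_ne_zero.2 hr.symm
  have hfg : f y * g x = r ^ 2 := by linear_combination (-g x) * hp + r * w * hp' +
    r ^ 2 * (mul_inv_cancel₀ hw.ne')
  have e₁ : p₁ = p₂ := by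
    refine sub_eq_zero.1 ((mul_eq_zero.1 (?_ : (4 - r ^ 2) * (p₁ - p₂) = 0)).resolve_left hdet)
    linear_combination 2 * hf - f y * hg + (p₁ - p₂) * hfg
  have e₂ : q₁ = q₂ := by
    refine sub_eq_zero.1 ((mul_eq_zero.1 (?_ : (4 - r ^ 2) * (q₁ - q₂) = 0)).resolve_left hdet)
    linear_combination 2 * hg - g x * hf + (q₁ - q₂) * hfg
  rw [e₁, e₂, add_comm (q₂ • y)]

/-- Vinberg's conditions for a pair of reflections: an alternating word either pulls back the
functional `f` to a nonnegative combination of `f` and `g`, or is long enough to contain one side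
of a braid relation. -/
theorem nonneg_combination_or_braid (hfx : f x = 2) (hgy : g y = 2)
    (ha : ∀ v, a v = v - f v • x) (hb : ∀ v, b v = v - g v • y)
    (hfy : f y ≤ 0) (hfg : f y = 0 ↔ g x = 0)
    (h : 4 ≤ f y * g x ∨ ∃ m : ℕ, 2 ≤ m ∧ f y * g x = 4 * cos (π / m) ^ 2) (k : ℕ) :
    (∃ p q : ℝ, 0 ≤ p ∧ 0 ≤ q ∧ ∀ v, f ((altWord k b a).prod v) = p * f v + q * g v) ∨
      ∃ n < k, (altWord (n + 1) b a).prod = (altWord (n + 1) a b).prod := by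
  have hfg' : -f y = 0 ↔ -g x = 0 := by simpa using hfg
  have key {r : ℝ} (hr : 0 ≤ r) (hrr : f y * g x = r ^ 2) (h₀ : 0 ≤ chebSeq r k)
      (h₁ : 0 ≤ chebSeq r (k + 1)) :
      ∃ p q : ℝ, 0 ≤ p ∧ 0 ≤ q ∧ ∀ v, f ((altWord k b a).prod v) = p * f v + q * g v := by
    obtain ⟨w, hw, hp, hq⟩ :=
      exists_symmetrizing_weight (neg_nonneg.2 hfy) hr hfg' (by linarith)
    have H := apply_prod_altWord_of_weight hfx hgy ha hb hp hq k
    by_cases hk : Even k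
    · exact ⟨_, _, h₁, mul_nonneg h₀ hw.le, fun v ↦ by rw [H]; simp [hk]; ring⟩
    · exact ⟨_, _, h₀, mul_nonneg h₁ hw.le, fun v ↦ by rw [H]; simp [hk]; ring⟩
  rcases h with h | ⟨m, hm, h⟩
  · have h2 : 2 ≤ √(f y * g x) := by
      rw [Real.le_sqrt' two_pos]; linarith
    exact Or.inl (key (by linarith) (Real.sq_sqrt (zero_le_four.trans h)).symm
      (chebSeq_nonneg_of_two_le h2 _) (chebSeq_nonneg_of_two_le h2 _))
  · have hm' : (2 : ℝ) ≤ m := by exact_mod_cast hm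
    have hc : 0 ≤ 2 * cos (π / m) := by
      refine mul_nonneg zero_le_two (cos_nonneg_of_neg_pi_div_two_le_of_le ?_ ?_)
      · exact (neg_nonpos.2 (by positivity)).trans (by positivity)
      · exact div_le_div_of_nonneg_left pi_pos.le two_pos hm'
    have hrr : f y * g x = (2 * cos (π / m)) ^ 2 := by rw [h]; ring
    by_cases hk : k < m
    · exact Or.inl (key hc hrr (chebSeq_cos_pi_div_nonneg hm hk.le)
        (chebSeq_cos_pi_div_nonneg hm hk))
    · obtain ⟨n, rfl⟩ : ∃ n, m = n + 1 := ⟨m - 1, by omega⟩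
      obtain ⟨w, hw, hp, hq⟩ :=
        exists_symmetrizing_weight (neg_nonneg.2 hfy) hc hfg' (by linarith)
      refine Or.inr ⟨n, by omega, prod_altWord_comm hw hfx hgy ha hb hp hq ?_
        (chebSeq_cos_pi_div_self hm)⟩
      nlinarith [sin_sq_add_cos_sq (π / (n + 1 : ℕ)), pow_pos (sin_pi_div_pos hm) 2]

end Dihedral

section Words

variable {S M : Type*} [Monoid M] {σ : S → M}

theorem prod_map_mul_prod_map_reverse (hσ : ∀ s, σ s * σ s = 1) (l : List S) :
    (l.map σ).prod * (l.reverse.map σ).prod = 1 := by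
  induction l with
  | nil => simp
  | cons s l ih =>
    simp only [List.map_cons, List.prod_cons, List.reverse_cons, List.map_append,
      List.prod_append, List.map_nil, List.prod_nil, mul_one]
    rw [mul_assoc, ← mul_assoc _ _ (σ s), ih, one_mul, hσ]

variable (σ) in
/-- A word is reduced if no shorter word has the same product. -/
def IsReducedWord (l : List S) : Prop :=
  ∀ l' : List S, (l'.map σ).prod = (l.map σ).prod → l.length ≤ l'.length

variable (σ) in
/-- The letter `s` is not a left descent of the product of the word `l`, when `l` is reduced. -/
def NotLeftDescent (s : S) (l : List S) : Prop :=
  ∀ l' : List S, (l'.map σ).prod = σ s * (l.map σ).prod → l.length ≤ l'.length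

/-- A maximal alternating prefix: a coset decomposition with respect to two generators. -/
theorem exists_altWord_append (hσ : ∀ s, σ s * σ s = 1) {s t : S} {l : List S}
    (hl : IsReducedWord σ (t :: l)) :
    ∃ (k : ℕ) (v : List S), v.length < (t :: l).length ∧ k + v.length = (t :: l).length ∧
      (((altWord k t s) ++ v).map σ).prod = ((t :: l).map σ).prod ∧
      IsReducedWord σ v ∧ NotLeftDescent σ s v ∧ NotLeftDescent σ t v := by
  classical
  let Q : ℕ → Prop := fun n ↦ ∃ k, ∃ v : List S, v.length = n ∧ 0 < k ∧
    k + v.length = (t :: l).length ∧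
      (((altWord k t s) ++ v).map σ).prod = ((t :: l).map σ).prod
  have hQ : ∃ n, Q n := ⟨l.length, 1, l, rfl, one_pos, by simp [add_comm], by simp [altWord]⟩
  obtain ⟨k, v, hvn, hk, hkv, hprod⟩ := Nat.find_spec hQ
  have hmin := fun n ↦ Nat.find_min (m := n) hQ
  rw [← hvn] at hmin
  have hred : ∀ l' : List S, (l'.map σ).prod = ((t :: l).map σ).prod →
    (t :: l).length ≤ l'.length := hl
  have hnext : NotLeftDescent σ (if Even k then t else s) v := by
    intro l' hl'
    by_contra! hlt
    have hp : (((altWord (k + 1) t s) ++ l').map σ).prod = ((t :: l).map σ).prod := by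
      rw [← hprod, altWord_succ_eq_append]
      simp only [List.map_append, List.prod_append, hl', List.map_cons, List.map_nil,
        List.prod_cons, List.prod_nil, mul_one]
      rw [mul_assoc, ← mul_assoc (σ _) (σ _), hσ, one_mul]
    have := hred _ hp
    rw [List.length_append, length_altWord] at this
    exact hmin _ hlt ⟨k + 1, l', rfl, by omega, by omega, hp⟩
  have hlast : NotLeftDescent σ (if Even k then s else t) v := by
    intro l' hl'
    by_contra! hlt
    obtain ⟨j, rfl⟩ : ∃ j, k = j + 1 := ⟨k - 1, by omega⟩
    have e : (if Even (j + 1) then s else t) = if Even j then t else s := by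
      by_cases hj : Even j <;> simp [Nat.even_add_one, hj]
    have hp : (((altWord j t s) ++ l').map σ).prod = ((t :: l).map σ).prod := by
      rw [← hprod, altWord_succ_eq_append]
      simp only [List.map_append, List.prod_append, hl', List.map_cons, List.map_nil,
        List.prod_cons, List.prod_nil, mul_one, e, mul_assoc]
    have := hred _ hp
    rw [List.length_append, length_altWord] at this
    omega
  refine ⟨k, v, by omega, hkv, hprod, ?_, ?_, ?_⟩
  · intro l' hl'
    have := hred (altWord k t s ++ l') (by
      rw [← hprod, List.map_append, List.prod_append, hl', List.map_append, List.prod_append])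
    rw [List.length_append, length_altWord] at this
    omega
  · by_cases hk : Even k
    · simpa [hk] using hlast
    · simpa [hk] using hnext
  · by_cases hk : Even k
    · simpa [hk] using hnext
    · simpa [hk] using hlast

end Words

section Tiles

variable {S V : Type*} [AddCommGroup V] [Module ℝ V]
  {α : S → Module.Dual ℝ V} {σ : S → Module.End ℝ V}

/-- Tits' lemma: if `s` is not a left descent of a reduced word, the corresponding tile lies on
the same side of the wall of `s` as the fundamental one. -/
theorem apply_prod_nonpos_of_notLeftDescent (hσ : ∀ s, σ s * σ s = 1)
    (hdih : ∀ s t, s ≠ t → ∀ k,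
      (∃ p q : ℝ, 0 ≤ p ∧ 0 ≤ q ∧
        ∀ v, α s (((altWord k t s).map σ).prod v) = p * α s v + q * α t v) ∨
      ∃ n < k, ((altWord (n + 1) t s).map σ).prod = ((altWord (n + 1) s t).map σ).prod)
    {l : List S} (hl : IsReducedWord σ l) {s : S} (hs : NotLeftDescent σ s l)
    {x : V} (hx : ∀ s, α s x ≤ 0) : α s ((l.map σ).prod x) ≤ 0 := by
  induction hn : l.length using Nat.strong_induction_on generalizing l s with
  | _ n ih =>
    subst hn
    rcases l with _ | ⟨t, l⟩
    · simpa using hx s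
    have hst : s ≠ t := by
      rintro rfl
      have := hs l (by rw [List.map_cons, List.prod_cons, ← mul_assoc, hσ, one_mul])
      simp at this
    obtain ⟨k, v, hv, hkv, hprod, hred, hsv, htv⟩ := exists_altWord_append (s := s) hσ hl
    rcases hdih s t hst k with ⟨p, q, hp, hq, hpq⟩ | ⟨n, hnk, hn⟩
    · rw [← hprod, List.map_append, List.prod_append, Module.End.mul_apply, hpq]
      exact add_nonpos (mul_nonpos_of_nonneg_of_nonpos hp (ih _ hv hred hsv rfl))
        (mul_nonpos_of_nonneg_of_nonpos hq (ih _ hv hred htv rfl))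
    · exfalso
      obtain ⟨j, rfl⟩ : ∃ j, k = n + 1 + j := ⟨k - (n + 1), by omega⟩
      obtain ⟨u, hu, hau⟩ := exists_altWord_add_eq_append (n + 1) j t s
      have := hs (altWord n t s ++ u ++ v) (by
        rw [← hprod, hau, List.map_append, List.map_append, List.map_append, List.map_append,
          List.prod_append, List.prod_append, List.prod_append, List.prod_append, hn]
        simp only [altWord, List.map_cons, List.prod_cons]
        rw [← mul_assoc, ← mul_assoc, ← mul_assoc, hσ, one_mul])
      simp only [List.length_append, length_altWord] at this
      omega

variable [Finite S]

/-- A segment leaving the fundamental chamber crosses one of its walls at a last point. -/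
theorem exists_exit_point_s18 {x y : V} (hx : ∀ s, α s x ≤ 0) {s₀ : S} (hy : 0 < α s₀ y) :
    ∃ s, 0 < α s y ∧ ∃ z ∈ segment ℝ x y, α s z = 0 ∧ ∀ t, α t z ≤ 0 := by
  let τ : S → ℝ := fun s ↦ -α s x / (α s y - α s x)
  obtain ⟨s, hs, hmin⟩ :=
    Set.exists_min_image {s | 0 < α s y} τ (Set.toFinite _) ⟨s₀, hy⟩
  rw [Set.mem_ofPred_eq] at hs
  have hpos {t : S} (ht : 0 < α t y) : 0 < α t y - α t x := by linarith [hx t]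
  have h₀ : 0 ≤ τ s := div_nonneg (neg_nonneg.2 (hx s)) (hpos hs).le
  have h₁ : τ s ≤ 1 := (div_le_one (hpos hs)).2 (by linarith)
  have hval (t : S) : α t ((1 - τ s) • x + τ s • y) = α t x + τ s * (α t y - α t x) := by
    simp; ring
  refine ⟨s, hs, (1 - τ s) • x + τ s • y, ⟨1 - τ s, τ s, by linarith, h₀, by ring, rfl⟩, ?_, ?_⟩
  · rw [hval, div_mul_cancel₀ _ (hpos hs).ne', add_neg_cancel]
  · intro t
    by_cases ht : 0 < α t y
    · have := (le_div_iff₀ (hpos ht)).1 (hmin t ht)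
      rw [hval]
      linarith
    · simp only [map_add, map_smul, smul_eq_mul]
      have := mul_nonneg (sub_nonneg.2 h₁) (neg_nonneg.2 (hx t))
      have := mul_nonneg h₀ (neg_nonneg.2 (not_lt.1 ht))
      linarith

theorem segment_subset_union {x y z : V} (hz : z ∈ segment ℝ x y) :
    segment ℝ x y ⊆ segment ℝ x z ∪ segment ℝ z y := by
  rw [segment_eq_image_lineMap] at hz
  obtain ⟨c, ⟨hc₀, hc₁⟩, rfl⟩ := hz
  rw [segment_eq_image_lineMap]
  rintro _ ⟨d, ⟨hd₀, hd₁⟩, rfl⟩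
  have key (u v w : ℝ) (h : w ∈ segment ℝ u v) : AffineMap.lineMap x y w ∈
      segment ℝ (AffineMap.lineMap x y u) (AffineMap.lineMap x y v : V) := by
    rw [← image_segment ℝ (AffineMap.lineMap x y : ℝ →ᵃ[ℝ] V)]
    exact Set.mem_image_of_mem _ h
  rcases le_total d c with h | h
  · left
    simpa using key 0 c d (by rw [segment_eq_Icc hc₀]; exact ⟨hd₀, h⟩)
  · right
    simpa using key c 1 d (by rw [segment_eq_Icc hc₁]; exact ⟨h, hd₁⟩)

theorem segment_subset_tiles {P C : Set V} (hP : P = {v | ∀ s, α s v ≤ 0})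
    (hσ : ∀ s, σ s * σ s = 1) (hfix : ∀ s v, α s v = 0 → σ s v = v)
    (hside : ∀ l : List S, IsReducedWord σ l → ∀ s, NotLeftDescent σ s l →
      ∀ x ∈ P, α s ((l.map σ).prod x) ≤ 0)
    (hPC : P ⊆ C) (hC : ∀ s, ∀ v ∈ C, σ s v ∈ C) (l : List S) {x y : V} (hx : x ∈ P)
    (hy : y ∈ P) : segment ℝ x ((l.map σ).prod y) ⊆ C := by
  have hconv : Convex ℝ P := by
    rw [hP, Set.ofPred_forall]
    exact convex_iInter fun s ↦ convex_halfSpace_le (α s).isLinear 0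
  induction hn : l.length using Nat.strong_induction_on generalizing l x with
  | _ n ih =>
    subst hn
    by_cases hred : IsReducedWord σ l
    · by_cases hmem : (l.map σ).prod y ∈ P
      · exact (hconv.segment_subset hx hmem).trans hPC
      · have hx' : ∀ s, α s x ≤ 0 := by simpa [hP] using hx
        obtain ⟨s₀, hs₀⟩ : ∃ s, 0 < α s ((l.map σ).prod y) := by simpa [hP] using hmem
        obtain ⟨s, hs, z, hz, hsz, hzP⟩ := exists_exit_point_s18 hx' hs₀
        have hzP' : z ∈ P := by rw [hP]; exact hzP
        have hdesc : ¬ NotLeftDescent σ s l := fun h ↦ (hside l hred s h y hy).not_gt hs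
        simp only [NotLeftDescent, not_forall, not_le] at hdesc
        obtain ⟨l', hl', hlt⟩ := hdesc
        have hsub := ih _ hlt l' hzP' rfl
        refine (segment_subset_union hz).trans
          (Set.union_subset ((hconv.segment_subset hx hzP').trans hPC) ?_)
        have himage : segment ℝ z ((l.map σ).prod y) =
            σ s '' segment ℝ z ((l'.map σ).prod y) := by
          rw [show (σ s '' segment ℝ z ((l'.map σ).prod y)) = _ from
            image_segment ℝ (σ s).toAffineMap _ _]
          simp only [LinearMap.coe_toAffineMap]
          rw [hfix s z hsz, hl', ← Module.End.mul_apply, ← mul_assoc, hσ, one_mul]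
        rw [himage]
        rintro _ ⟨v, hv, rfl⟩
        exact hC s v (hsub hv)
    · simp only [IsReducedWord, not_forall, not_le] at hred
      obtain ⟨l', hl', hlt⟩ := hred
      rw [← hl']
      exact ih _ hlt l' hx rfl

end Tiles

/-- Tits–Vinberg theorem (third item): under Vinberg's conditions (V1) and (V2) on the
Cartan matrix `A_{st} = α_s(b_t)`, the union of the tiles `γ(P̃)`, over the group `Γ`
generated by the reflections `σ_s`, is a convex cone in `V = ℝ^{d+1}`. -/
theorem tits_vinberg_union_of_tiles_convex {d : ℕ} {S : Type*} [Fintype S]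
    (α : S → Module.Dual ℝ (Fin (d + 1) → ℝ)) (b : S → (Fin (d + 1) → ℝ))
    (hα : ∀ s, α s ≠ 0) (hab : ∀ s, α s (b s) = 2)
    (σ : S → ((Fin (d + 1) → ℝ) →ₗ[ℝ] (Fin (d + 1) → ℝ)))
    (hσ : ∀ s, σ s = LinearMap.id - (α s).smulRight (b s))
    (P : Set (Fin (d + 1) → ℝ)) (hP : P = {v | ∀ s, α s v ≤ 0})
    (hint : (interior P).Nonempty)
    (hfacet : ∀ s, ∃ v, α s v = 0 ∧ ∀ t, t ≠ s → α t v < 0)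
    (hV1 : ∀ s t, s ≠ t → α s (b t) ≤ 0 ∧ (α s (b t) = 0 ↔ α t (b s) = 0))
    (hV2 : ∀ s t, s ≠ t →
      4 ≤ α s (b t) * α t (b s) ∨
      ∃ m : ℕ, 2 ≤ m ∧ α s (b t) * α t (b s) = 4 * Real.cos (π / m) ^ 2)
    (𝒞 : Set (Fin (d + 1) → ℝ))
    (h𝒞 : 𝒞 = ⋃ γ ∈ Submonoid.closure (Set.range σ), ⇑γ '' P) :
    Convex ℝ 𝒞 ∧ ∀ x ∈ 𝒞, ∀ t : ℝ, 0 < t → t • x ∈ 𝒞 := by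
  have hσv (s v) : σ s v = v - α s v • b s := by rw [hσ]; rfl
  have hinv (s) : σ s * σ s = 1 := by
    refine LinearMap.ext fun v ↦ ?_
    simp only [Module.End.mul_apply, hσv, map_sub, map_smul, hab, smul_eq_mul, Module.End.one_apply]
    module
  have hmem (v) : v ∈ 𝒞 ↔ ∃ l : List S, ∃ x ∈ P, (l.map σ).prod x = v := by
    simp only [h𝒞, Set.mem_iUnion, exists_prop, Set.mem_image]
    constructor
    · rintro ⟨γ, hγ, x, hx, rfl⟩
      obtain ⟨l, hl, rfl⟩ := Submonoid.exists_list_of_mem_closure hγ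
      obtain ⟨l, rfl⟩ : l ∈ Set.range (List.map σ) := by
        rw [Set.range_list_map]
        exact hl
      exact ⟨l, x, hx, rfl⟩
    · rintro ⟨l, x, hx, rfl⟩
      refine ⟨_, Submonoid.list_prod_mem _ fun γ hγ ↦ Submonoid.subset_closure ?_, x, hx, rfl⟩
      obtain ⟨s, -, rfl⟩ := List.mem_map.1 hγ
      exact ⟨s, rfl⟩
  have hword (l : List S) (v) (hv : v ∈ 𝒞) : (l.map σ).prod v ∈ 𝒞 := by
    obtain ⟨l', x, hx, rfl⟩ := (hmem v).1 hv
    exact (hmem _).2 ⟨l ++ l', x, hx, by simp⟩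
  have hPC : P ⊆ 𝒞 := fun x hx ↦ (hmem x).2 ⟨[], x, hx, by simp⟩
  have hdih (s t) (hst : s ≠ t) (k : ℕ) :
      (∃ p q : ℝ, 0 ≤ p ∧ 0 ≤ q ∧
        ∀ v, α s (((altWord k t s).map σ).prod v) = p * α s v + q * α t v) ∨
      ∃ n < k, ((altWord (n + 1) t s).map σ).prod = ((altWord (n + 1) s t).map σ).prod := by
    rw [map_altWord]
    simp_rw [map_altWord]
    exact nonneg_combination_or_braid (hab s) (hab t) (hσv s) (hσv t) (hV1 s t hst).1
      (hV1 s t hst).2 (hV2 s t hst) k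
  have hside (l : List S) (hl : IsReducedWord σ l) (s) (hs : NotLeftDescent σ s l) (x)
      (hx : x ∈ P) : α s ((l.map σ).prod x) ≤ 0 :=
    apply_prod_nonpos_of_notLeftDescent hinv hdih hl hs (by simpa [hP] using hx)
  constructor
  · rw [convex_iff_segment_subset]
    intro x hx y hy
    obtain ⟨l, x, hxP, rfl⟩ := (hmem x).1 hx
    have hy' := hword l.reverse y hy
    obtain ⟨l', z, hzP, hz⟩ := (hmem _).1 hy'
    have hyz : y = (l.map σ).prod ((l'.map σ).prod z) := by
      rw [hz, ← Module.End.mul_apply, prod_map_mul_prod_map_reverse hinv, Module.End.one_apply]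
    have hsub := segment_subset_tiles hP hinv
      (fun s v h ↦ by rw [hσv, h, zero_smul, sub_zero]) hside hPC
      (fun s v hv ↦ by simpa using hword [s] v hv) l' hxP hzP
    rw [hyz]
    refine (image_segment ℝ (l.map σ).prod.toAffineMap x ((l'.map σ).prod z)).ge.trans ?_
    rintro _ ⟨v, hv, rfl⟩
    exact hword l v (hsub hv)
  · intro x hx t ht
    obtain ⟨l, x, hxP, rfl⟩ := (hmem x).1 hx
    refine (hmem _).2 ⟨l, t • x, ?_, map_smul _ _ _⟩
    rw [hP] at hxP ⊢
    intro s
    rw [map_smul, smul_eq_mul]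
    exact mul_nonpos_of_nonneg_of_nonpos ht.le (hxP s)
end
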